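/- Let Ω₁, Ω₂ ⊂ ℂⁿ be bounded strictly pseudoconvex domains with C^∞ boundary, let φ : Ω₁ → Ω₂ be a proper holomorphic mapping, and let ρ be a plurisubharmonic defining function for Ω₂ which is C^∞ on a neighborhood of Ω̄₂ and satisfies det H(ρ)(w) ≤ C₀ · dist(w, ∂Ω₂)^{4n} for all w ∈ Ω₂ and some constant C₀. Then the composition r = ρ ∘ φ belongs to C^{1,1}(Ω̄₁): r is C¹ on Ω₁ with first-order partial derivatives Lipschitz on Ω₁, so that r and ∇r extend continuously to Ω̄₁ and r = 0 on ∂Ω₁. -/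

import Mathlib

open Complex Metric

noncomputable section

/-- The Wirtinger derivative `∂f/∂z_j` of `f : ℂⁿ → ℂ` at `z`. -/
def wDz (n : ℕ) (j : Fin n) (f : EuclideanSpace ℂ (Fin n) → ℂ)
    (z : EuclideanSpace ℂ (Fin n)) : ℂ :=
  (fderiv ℝ f z (EuclideanSpace.single j 1)
    - Complex.I * fderiv ℝ f z (EuclideanSpace.single j Complex.I)) / 2

/-- The Wirtinger derivative `∂f/∂z̄_j` of `f : ℂⁿ → ℂ` at `z`. -/
def wDzBar (n : ℕ) (j : Fin n) (f : EuclideanSpace ℂ (Fin n) → ℂ)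
    (z : EuclideanSpace ℂ (Fin n)) : ℂ :=
  (fderiv ℝ f z (EuclideanSpace.single j 1)
    + Complex.I * fderiv ℝ f z (EuclideanSpace.single j Complex.I)) / 2

/-- The complex Hessian matrix `H(u)(z) = [∂²u/∂z_i∂z̄_j(z)]` of a real-valued `u`. -/
def cHess (n : ℕ) (u : EuclideanSpace ℂ (Fin n) → ℝ)
    (z : EuclideanSpace ℂ (Fin n)) : Matrix (Fin n) (Fin n) ℂ :=
  Matrix.of fun i j => wDz n i (fun w => wDzBar n j (fun v => ((u v : ℝ) : ℂ)) w) z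

/-- The Hermitian form `Σ_{i,j} H(u)(z)_{ij} w_i w̄_j`. -/
def cHessForm (n : ℕ) (u : EuclideanSpace ℂ (Fin n) → ℝ)
    (z : EuclideanSpace ℂ (Fin n)) (w : Fin n → ℂ) : ℂ :=
  ∑ i, ∑ j, cHess n u z i j * w i * (starRingEnd ℂ) (w j)

/-- The pairing `Σ_j (∂u/∂z_j)(z) w_j` of the complex gradient with a vector. -/
def cGradPair (n : ℕ) (u : EuclideanSpace ℂ (Fin n) → ℝ)
    (z : EuclideanSpace ℂ (Fin n)) (w : Fin n → ℂ) : ℂ :=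
  ∑ j, wDz n j (fun v => ((u v : ℝ) : ℂ)) z * w j

/-- `ρ` is a `C^k` defining function for `Ω`, defined on the open neighborhood `U` of `Ω̄`. -/
def IsDefiningFn (n : ℕ) (k : ℕ∞) (Ω U : Set (EuclideanSpace ℂ (Fin n)))
    (ρ : EuclideanSpace ℂ (Fin n) → ℝ) : Prop :=
  IsOpen U ∧ closure Ω ⊆ U ∧ ContDiffOn ℝ k ρ U ∧
    Ω = {z ∈ U | ρ z < 0} ∧ ∀ z ∈ frontier Ω, fderiv ℝ ρ z ≠ 0

/-- `Ω` is a bounded strictly pseudoconvex domain with `C^k` boundary. -/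
def IsStrictlyPseudoconvexDomain (n : ℕ) (k : ℕ∞)
    (Ω : Set (EuclideanSpace ℂ (Fin n))) : Prop :=
  IsOpen Ω ∧ Bornology.IsBounded Ω ∧
    ∃ U ρ, IsDefiningFn n k Ω U ρ ∧
      ∀ z ∈ frontier Ω, ∀ w : Fin n → ℂ, w ≠ 0 →
        cGradPair n ρ z w = 0 → 0 < (cHessForm n ρ z w).re

/-- The complex Jacobian matrix `φ'(z) = [∂φ_i/∂z_j(z)]` of `φ : ℂⁿ → ℂⁿ`. -/
def jacobian (n : ℕ) (φ : EuclideanSpace ℂ (Fin n) → EuclideanSpace ℂ (Fin n))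
    (z : EuclideanSpace ℂ (Fin n)) : Matrix (Fin n) (Fin n) ℂ :=
  Matrix.of fun i j => wDz n j (fun w => φ w i) z

/-- `φ` is a proper map from `Ω₁` to `Ω₂`. -/
def IsProperMapOn (n : ℕ) (φ : EuclideanSpace ℂ (Fin n) → EuclideanSpace ℂ (Fin n))
    (Ω₁ Ω₂ : Set (EuclideanSpace ℂ (Fin n))) : Prop :=
  Set.MapsTo φ Ω₁ Ω₂ ∧ ∀ K ⊆ Ω₂, IsCompact K → IsCompact {z ∈ Ω₁ | φ z ∈ K}



set_option linter.unusedSectionVars false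
set_option linter.unusedVariables false

set_option linter.unusedSectionVars false
set_option linter.unusedVariables false

section CalcReal

variable {E : Type*} [NormedAddCommGroup E] [NormedSpace ℝ E]
variable {F : Type*} [NormedAddCommGroup F] [NormedSpace ℝ F]
variable {G : Type*} [NormedAddCommGroup G] [NormedSpace ℝ G]

/-- Second real derivative. -/
def D2 {E : Type*} [NormedAddCommGroup E] [NormedSpace ℝ E] {G : Type*} [NormedAddCommGroup G]
    [NormedSpace ℝ G] (u : E → G) (z : E) : E →L[ℝ] E →L[ℝ] G := fderiv ℝ (fderiv ℝ u) z

/-- Polarised Levi form (times 4). -/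
def Bv {E : Type*} [NormedAddCommGroup E] [NormedSpace ℂ E] [NormedSpace ℝ E]
    (u : E → ℝ) (z ξ η : E) : ℝ := D2 u z ξ η + D2 u z (I • ξ) (I • η)

/-- Levi form (times 4). -/
def Lv {E : Type*} [NormedAddCommGroup E] [NormedSpace ℂ E] [NormedSpace ℝ E]
    (u : E → ℝ) (z ξ : E) : ℝ := D2 u z ξ ξ + D2 u z (I • ξ) (I • ξ)

lemma cda_fderiv_diff {u : E → G} {z : E} (h : ContDiffAt ℝ 2 u z) :
    DifferentiableAt ℝ (fderiv ℝ u) z :=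
  (h.fderiv_right (m := 1) (by norm_num)).differentiableAt (by norm_num)

lemma cda_ev_diff {u : E → G} {z : E} (h : ContDiffAt ℝ 2 u z) :
    ∀ᶠ x in nhds z, DifferentiableAt ℝ u x := by
  filter_upwards [h.eventually (by simp)] with x hx
  exact hx.differentiableAt (by norm_num)

lemma D2_congr {u v : E → G} {z : E} (h : u =ᶠ[nhds z] v) : D2 u z = D2 v z := by
  unfold D2
  exact (h.fderiv).fderiv_eq

lemma D2_add {u v : E → G} {z : E} (hu : ContDiffAt ℝ 2 u z) (hv : ContDiffAt ℝ 2 v z) :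
    D2 (fun x => u x + v x) z = D2 u z + D2 v z := by
  unfold D2
  have : fderiv ℝ (fun x => u x + v x) =ᶠ[nhds z] fun x => fderiv ℝ u x + fderiv ℝ v x := by
    filter_upwards [cda_ev_diff hu, cda_ev_diff hv] with x h1 h2
    exact fderiv_fun_add h1 h2
  rw [this.fderiv_eq]
  exact fderiv_fun_add (cda_fderiv_diff hu) (cda_fderiv_diff hv)

lemma D2_const_mul {u : E → ℝ} {z : E} (c : ℝ) (hu : ContDiffAt ℝ 2 u z) :
    D2 (fun x => c * u x) z = c • D2 u z := by
  unfold D2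
  have : fderiv ℝ (fun x => c * u x) =ᶠ[nhds z] fun x => c • fderiv ℝ u x := by
    filter_upwards [cda_ev_diff hu] with x h1
    exact fderiv_const_mul h1 c
  rw [this.fderiv_eq]
  exact fderiv_fun_const_smul (cda_fderiv_diff hu) c

lemma D2_const (c : G) (z : E) : D2 (fun _ : E => c) z = 0 := by
  unfold D2
  have : fderiv ℝ (fun _ : E => c) = fun _ => 0 := by ext x; simp
  rw [this]; simp

lemma D2_clm (L : E →L[ℝ] G) (z : E) : D2 (fun x : E => L x) z = 0 := by
  unfold D2
  have : fderiv ℝ (fun x : E => L x) = fun _ => L := by ext x; simp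
  rw [this]; simp

lemma D2_symm {u : E → G} {z : E} (hu : ContDiffAt ℝ 2 u z) (ξ η : E) :
    D2 u z ξ η = D2 u z η ξ := by
  have := hu.isSymmSndFDerivAt (by simp)
  exact this ξ η

lemma D2_sq {u : E → ℝ} {z : E} (hu : ContDiffAt ℝ 2 u z) (ξ η : E) :
    D2 (fun x => u x ^ 2) z ξ η = 2 * u z * D2 u z ξ η + 2 * (fderiv ℝ u z ξ * fderiv ℝ u z η) := by
  unfold D2
  have : fderiv ℝ (fun x => u x ^ 2) =ᶠ[nhds z] fun x => (2 * u x) • fderiv ℝ u x := by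
    filter_upwards [cda_ev_diff hu] with x h1
    have := (h1.hasFDerivAt.pow 2).fderiv
    simpa using this
  rw [this.fderiv_eq]
  have hu' := hu.differentiableAt (by norm_num)
  have h2 : HasFDerivAt (fun x => 2 * u x) ((2:ℝ) • fderiv ℝ u z) z := hu'.hasFDerivAt.const_mul 2
  have := (h2.smul (cda_fderiv_diff hu).hasFDerivAt).fderiv
  rw [show (fun x => (2 * u x) • fderiv ℝ u x) = (fun x => 2 * u x) • fderiv ℝ u from rfl, this]
  simp
  ring

lemma D2_comp {u : F → G} {T : E → F} {z : E} (hu : ContDiffAt ℝ 2 u (T z))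
    (hT : ContDiffAt ℝ 2 T z) (ξ η : E) :
    D2 (fun x => u (T x)) z ξ η = D2 u (T z) (fderiv ℝ T z ξ) (fderiv ℝ T z η)
      + fderiv ℝ u (T z) (D2 T z ξ η) := by
  unfold D2
  have hTc : ContinuousAt T z := hT.continuousAt
  have : fderiv ℝ (fun x => u (T x)) =ᶠ[nhds z] fun x => (fderiv ℝ u (T x)).comp (fderiv ℝ T x) := by
    filter_upwards [cda_ev_diff hT, hTc.eventually (cda_ev_diff hu)] with x h1 h2
    exact fderiv_comp x h2 h1
  rw [this.fderiv_eq]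
  have hT' := hT.differentiableAt (by norm_num)
  have h1 : HasFDerivAt (fun x => fderiv ℝ u (T x)) ((fderiv ℝ (fderiv ℝ u) (T z)).comp (fderiv ℝ T z)) z :=
    HasFDerivAt.comp z (cda_fderiv_diff hu).hasFDerivAt hT'.hasFDerivAt
  have := (h1.clm_comp (cda_fderiv_diff hT).hasFDerivAt).fderiv
  rw [this]
  simp [add_comm]

end CalcReal

section Calc

variable {E : Type*} [NormedAddCommGroup E] [NormedSpace ℂ E] [NormedSpace ℝ E] [IsScalarTower ℝ ℂ E]
variable {F : Type*} [NormedAddCommGroup F] [NormedSpace ℂ F] [NormedSpace ℝ F] [IsScalarTower ℝ ℂ F]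
variable {G : Type*} [NormedAddCommGroup G] [NormedSpace ℝ G]

lemma fderiv_real_eq {T : E → F} {z : E} (h : DifferentiableAt ℂ T z) :
    fderiv ℝ T z = (fderiv ℂ T z).restrictScalars ℝ := h.fderiv_restrictScalars ℝ

lemma D2_holo {T : E → F} {z : E} (hT : ∀ᶠ x in nhds z, DifferentiableAt ℂ T x)
    (hT2 : DifferentiableAt ℂ (fderiv ℂ T) z) (ξ η : E) :
    D2 T z ξ η = fderiv ℂ (fderiv ℂ T) z ξ η := by
  unfold D2
  have : fderiv ℝ T =ᶠ[nhds z] fun x => ContinuousLinearMap.restrictScalarsL ℂ E F ℝ ℝ (fderiv ℂ T x) := by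
    filter_upwards [hT] with x hx
    rw [fderiv_real_eq hx]; rfl
  rw [this.fderiv_eq]
  have h2 : HasFDerivAt (fderiv ℂ T) ((fderiv ℂ (fderiv ℂ T) z).restrictScalars ℝ) z :=
    hT2.hasFDerivAt.restrictScalars ℝ
  have h3 := (HasFDerivAt.comp z (ContinuousLinearMap.restrictScalarsL ℂ E F ℝ ℝ).hasFDerivAt h2).fderiv
  rw [show (fun x => ContinuousLinearMap.restrictScalarsL ℂ E F ℝ ℝ (fderiv ℂ T x)) =
    (ContinuousLinearMap.restrictScalarsL ℂ E F ℝ ℝ) ∘ fderiv ℂ T from rfl, h3]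
  rfl

lemma Lv_comp_holo {u : F → ℝ} {T : E → F} {z : E} (hu : ContDiffAt ℝ 2 u (T z))
    (hTr : ContDiffAt ℝ 2 T z)
    (hT : ∀ᶠ x in nhds z, DifferentiableAt ℂ T x)
    (hT2 : DifferentiableAt ℂ (fderiv ℂ T) z) (ξ : E) :
    Lv (fun x => u (T x)) z ξ = Lv u (T z) (fderiv ℂ T z ξ) := by
  unfold Lv
  rw [D2_comp hu hTr, D2_comp hu hTr, D2_holo hT hT2, D2_holo hT hT2, fderiv_real_eq hT.self_of_nhds]
  simp [smul_smul]
  ring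

lemma Lv_add {u v : E → ℝ} {z : E} (hu : ContDiffAt ℝ 2 u z) (hv : ContDiffAt ℝ 2 v z) (ξ : E) :
    Lv (fun x => u x + v x) z ξ = Lv u z ξ + Lv v z ξ := by
  unfold Lv
  rw [D2_add hu hv]; simp; ring

lemma Lv_const_mul {u : E → ℝ} {z : E} (c : ℝ) (hu : ContDiffAt ℝ 2 u z) (ξ : E) :
    Lv (fun x => c * u x) z ξ = c * Lv u z ξ := by
  unfold Lv
  rw [D2_const_mul c hu]; simp; ring

lemma Lv_sub {u v : E → ℝ} {z : E} (hu : ContDiffAt ℝ 2 u z) (hv : ContDiffAt ℝ 2 v z) (ξ : E) :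
    Lv (fun x => u x - v x) z ξ = Lv u z ξ - Lv v z ξ := by
  have h := Lv_add hu (contDiffAt_const (c := (-1:ℝ)) |>.mul hv) ξ
  rw [Lv_const_mul _ hv] at h
  simpa [sub_eq_add_neg] using h

lemma Lv_const (c : ℝ) (z ξ : E) : Lv (fun _ : E => c) z ξ = 0 := by
  unfold Lv; rw [D2_const]; simp

lemma Lv_clm (L : E →L[ℝ] ℝ) (z ξ : E) : Lv (fun x : E => L x) z ξ = 0 := by
  unfold Lv; rw [D2_clm]; simp

lemma Lv_sq {u : E → ℝ} {z : E} (hu : ContDiffAt ℝ 2 u z) (ξ : E) :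
    Lv (fun x => u x ^ 2) z ξ = 2 * u z * Lv u z ξ +
      2 * ((fderiv ℝ u z ξ) ^ 2 + (fderiv ℝ u z (I • ξ)) ^ 2) := by
  unfold Lv
  rw [D2_sq hu, D2_sq hu]; ring

lemma Lv_congr {u v : E → ℝ} {z : E} (h : u =ᶠ[nhds z] v) (ξ : E) : Lv u z ξ = Lv v z ξ := by
  unfold Lv; rw [D2_congr h]

lemma Lv_add_vec {u : E → ℝ} {z : E} (hu : ContDiffAt ℝ 2 u z) (ξ η : E) :
    Lv u z (ξ + η) = Lv u z ξ + 2 * Bv u z ξ η + Lv u z η := by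
  unfold Lv Bv
  simp only [smul_add, map_add, add_apply]
  rw [D2_symm hu η ξ, D2_symm hu (I • η) (I • ξ)]; ring

/-- Quadratic forms built from bilinear maps. -/
lemma D2_bilin (B : E →L[ℝ] E →L[ℝ] ℝ) (z ξ η : E) :
    D2 (fun x => B x x) z ξ η = B ξ η + B η ξ := by
  unfold D2
  have : fderiv ℝ (fun x => B x x) = fun x => (B + B.flip) x := by
    ext x y
    have h := (B.hasFDerivAt (x := x)).clm_apply (hasFDerivAt_id x)
    have := h.fderiv
    simp only [id] at this
    rw [this]; simp
  rw [this, ContinuousLinearMap.fderiv]; simp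

lemma Lv_shift_bilin (B : E →L[ℝ] E →L[ℝ] ℝ) (p z ξ : E) :
    Lv (fun x => B (x - p) (x - p)) z ξ = 2 * (B ξ ξ + B (I • ξ) (I • ξ)) := by
  have h : ∀ ξ η, D2 (fun x => B (x - p) (x - p)) z ξ η = B ξ η + B η ξ := by
    intro ξ η
    have h1 : ContDiff ℝ 2 (fun x : E => B x x) := B.contDiff.clm_apply contDiff_id
    have h2 : ContDiff ℝ 2 (fun x : E => x - p) := contDiff_id.sub contDiff_const
    have := D2_comp (u := fun x : E => B x x) (T := fun x : E => x - p) (z := z) h1.contDiffAt h2.contDiffAt ξ η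
    rw [this, D2_bilin]
    have h3 : fderiv ℝ (fun x : E => x - p) = fun _ => ContinuousLinearMap.id ℝ E := by
      ext x y; simp [fderiv_sub_const]
    have h4 : D2 (fun x : E => x - p) z = 0 := by unfold D2; rw [h3]; simp
    rw [h4, h3]; simp
  unfold Lv; rw [h, h]; ring

lemma normI (ξ : E) : ‖I • ξ‖ = ‖ξ‖ := by rw [norm_smul]; simp

lemma Bv_le {u : E → ℝ} {z : E} {C : ℝ} (h : ‖D2 u z‖ ≤ C) (ξ η : E) :
    |Bv u z ξ η| ≤ 2 * C * ‖ξ‖ * ‖η‖ := by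
  have h1 : ∀ ξ η : E, |D2 u z ξ η| ≤ C * ‖ξ‖ * ‖η‖ := fun ξ η => by
    have := (D2 u z).le_opNorm₂ ξ η
    rw [← Real.norm_eq_abs]
    refine this.trans ?_
    gcongr
  have a := h1 ξ η
  have b := h1 (I • ξ) (I • η)
  rw [normI, normI] at b
  unfold Bv
  refine (abs_add_le _ _).trans ?_
  linarith

lemma Lv_le {u : E → ℝ} {z : E} {C : ℝ} (h : ‖D2 u z‖ ≤ C) (ξ : E) :
    |Lv u z ξ| ≤ 2 * C * ‖ξ‖ ^ 2 := by
  have := Bv_le h ξ ξ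
  unfold Bv at this; unfold Lv; rw [pow_two]; linarith

lemma Bv_sub_le {u : E → ℝ} {z w : E} {C : ℝ} (h : ‖D2 u z - D2 u w‖ ≤ C) (ξ η : E) :
    |Bv u z ξ η - Bv u w ξ η| ≤ 2 * C * ‖ξ‖ * ‖η‖ := by
  have h1 : ∀ ξ η : E, |D2 u z ξ η - D2 u w ξ η| ≤ C * ‖ξ‖ * ‖η‖ := fun ξ η => by
    have := (D2 u z - D2 u w).le_opNorm₂ ξ η
    rw [← Real.norm_eq_abs]
    refine this.trans ?_
    gcongr
  have a := h1 ξ η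
  have b := h1 (I • ξ) (I • η)
  rw [normI, normI] at b
  unfold Bv
  have : (D2 u z ξ η + D2 u z (I • ξ) (I • η)) - (D2 u w ξ η + D2 u w (I • ξ) (I • η)) =
    (D2 u z ξ η - D2 u w ξ η) + (D2 u z (I • ξ) (I • η) - D2 u w (I • ξ) (I • η)) := by ring
  rw [this]
  refine (abs_add_le _ _).trans ?_
  linarith

end Calc

section MP
variable {E : Type*} [NormedAddCommGroup E] [NormedSpace ℂ E] [NormedSpace ℝ E] [IsScalarTower ℝ ℂ E]

lemma D2_nonpos_of_localMax {E : Type*} [NormedAddCommGroup E] [NormedSpace ℝ E]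
    {u : E → ℝ} {z : E} (hu : ContDiffAt ℝ 2 u z) (hm : IsLocalMax u z) (ξ : E) :
    D2 u z ξ ξ ≤ 0 := by
  by_contra hpos
  push Not at hpos
  set T : ℝ → E := fun t => z + t • ξ with hT
  have hT0 : T 0 = z := by simp [hT]
  have hTd : ∀ t, HasDerivAt T ξ t := fun t => by
    have := ((hasDerivAt_id t).smul_const ξ).const_add z
    simp only [id, one_smul] at this
    exact this
  have hTc : ContinuousAt T 0 := (hTd 0).continuousAt
  set g : ℝ → ℝ := fun t => u (T t) with hg
  have hgmax : IsLocalMax g 0 := by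
    have : Filter.Tendsto T (nhds 0) (nhds z) := by simpa [hT0] using hTc.tendsto
    have h2 := this.eventually hm
    filter_upwards [h2] with t ht
    simpa [hg, hT0] using ht
  have hd1 : ∀ᶠ t in nhds 0, HasDerivAt g (fderiv ℝ u (T t) ξ) t := by
    have : Filter.Tendsto T (nhds 0) (nhds z) := by simpa [hT0] using hTc.tendsto
    filter_upwards [this.eventually (cda_ev_diff hu)] with t ht
    exact ht.hasFDerivAt.comp_hasDerivAt t (hTd t)
  have hd2 : HasDerivAt (fun t => fderiv ℝ u (T t) ξ) (D2 u z ξ ξ) 0 := by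
    have h1 : HasFDerivAt (fderiv ℝ u) (D2 u z) (T 0) := by
      rw [hT0]; exact (cda_fderiv_diff hu).hasFDerivAt
    have h2 := (h1.comp_hasDerivAt 0 (hTd 0)).clm_apply (hasDerivAt_const 0 ξ)
    simpa using h2
  have e1 : deriv g =ᶠ[nhds 0] fun t => fderiv ℝ u (T t) ξ := by
    filter_upwards [hd1] with t ht using ht.deriv
  have e2 : deriv (deriv g) 0 = D2 u z ξ ξ := by rw [e1.deriv_eq]; exact hd2.deriv
  have hmin : IsLocalMin g 0 := isLocalMin_of_deriv_deriv_pos (by rw [e2]; exact hpos)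
    hgmax.deriv_eq_zero hd1.self_of_nhds.continuousAt
  have hc : g =ᶠ[nhds 0] fun _ => g 0 := by
    filter_upwards [hmin, hgmax] with t h1 h2 using le_antisymm h2 h1
  have : deriv (deriv g) 0 = 0 := by
    rw [hc.deriv.deriv_eq]; simp
  linarith

lemma Lv_nonpos_of_localMax {u : E → ℝ} {z : E} (hu : ContDiffAt ℝ 2 u z) (hm : IsLocalMax u z)
    (ξ : E) : Lv u z ξ ≤ 0 := by
  unfold Lv
  linarith [D2_nonpos_of_localMax hu hm ξ, D2_nonpos_of_localMax hu hm (I • ξ)]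

lemma max_principle {K : Set E} (hK : IsCompact K) {Φ : E → ℝ} (hΦ : ContinuousOn Φ K)
    (h : ∀ z ∈ K, Φ z ≤ 0 ∨ (K ∈ nhds z ∧ ContDiffAt ℝ 2 Φ z ∧ ∃ ξ, 0 < Lv Φ z ξ)) :
    ∀ z ∈ K, Φ z ≤ 0 := by
  intro z hz
  obtain ⟨m, hmK, hm⟩ := hK.exists_isMaxOn ⟨z, hz⟩ hΦ
  refine (hm hz).trans ?_
  rcases h m hmK with h0 | ⟨hn, hc, ξ, hξ⟩
  · exact h0
  · have : IsLocalMax Φ m := by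
      filter_upwards [hn] with x hx using hm hx
    exact absurd (Lv_nonpos_of_localMax hc this ξ) (not_le.mpr hξ)

end MP


section Disc
variable {E : Type*} [NormedAddCommGroup E] [InnerProductSpace ℂ E] [NormedSpace ℝ E] [IsScalarTower ℝ ℂ E]

lemma real_smul_eq {E : Type*} [NormedAddCommGroup E] [NormedSpace ℂ E] [NormedSpace ℝ E]
    [IsScalarTower ℝ ℂ E] (r : ℝ) (x : E) : r • x = (r : ℂ) • x :=
  (algebraMap_smul ℂ r x).symm

/-- The real inner product as a bilinear map. -/
def reInner (E : Type*) [NormedAddCommGroup E] [InnerProductSpace ℂ E] [NormedSpace ℝ E]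
    [IsScalarTower ℝ ℂ E] : E →L[ℝ] E →L[ℝ] ℝ :=
  LinearMap.mkContinuous₂ (LinearMap.mk₂ ℝ (fun x y : E => (inner ℂ x y : ℂ).re)
    (by intro x y z; simp [inner_add_left])
    (by intro r x y; rw [real_smul_eq, inner_smul_left]; simp)
    (by intro x y z; simp [inner_add_right])
    (by intro r x y; rw [real_smul_eq, inner_smul_right]; simp)) 1
    (by
      intro x y
      simp only [LinearMap.mk₂_apply, one_mul]
      exact (Complex.abs_re_le_norm _).trans (norm_inner_le_norm x y))

lemma reInner_apply (x y : E) : reInner E x y = (inner ℂ x y : ℂ).re := rfl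

lemma reInner_self (x : E) : reInner E x x = ‖x‖ ^ 2 := by
  rw [reInner_apply]
  have := inner_self_eq_norm_sq (𝕜 := ℂ) x
  simpa using this

lemma normSq_fun_eq (p : E) : (fun x : E => ‖x - p‖ ^ 2) = fun x => reInner E (x - p) (x - p) := by
  ext x; rw [reInner_self]

lemma contDiff_normSq_sub (p : E) {m} : ContDiff ℝ m (fun x : E => ‖x - p‖ ^ 2) := by
  rw [normSq_fun_eq]
  exact ((reInner E).contDiff.comp (contDiff_id.sub contDiff_const)).clm_apply
    (contDiff_id.sub contDiff_const)

lemma Lv_normSq (p z ξ : E) : Lv (fun x : E => ‖x - p‖ ^ 2) z ξ = 4 * ‖ξ‖ ^ 2 := by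
  rw [normSq_fun_eq, Lv_shift_bilin, reInner_self, reInner_self, normI]; ring

lemma holo1_facts [CompleteSpace E] {g : ℂ → E} {U : Set ℂ} (hU : IsOpen U)
    (hg : DifferentiableOn ℂ g U) {ζ : ℂ} (hζ : ζ ∈ U) :
    ContDiffAt ℝ 2 g ζ ∧ (∀ᶠ x in nhds ζ, DifferentiableAt ℂ g x) ∧
      DifferentiableAt ℂ (fderiv ℂ g) ζ := by
  have h : ContDiffAt ℂ 2 g ζ := (hg.contDiffOn hU).contDiffAt (hU.mem_nhds hζ)
  refine ⟨h.restrict_scalars ℝ, ?_, ?_⟩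
  · filter_upwards [hU.mem_nhds hζ] with x hx
    exact hg.differentiableAt (hU.mem_nhds hx)
  · exact (h.fderiv_right (m := 1) (by norm_num)).differentiableAt (by norm_num)

lemma disc_lemma [CompleteSpace E] {g : ℂ → E} {V : ℂ → ℝ} {R c M : ℝ} {U : Set ℂ} (hU : IsOpen U)
    (hUR : closedBall 0 R ⊆ U) (hR : 0 < R) (hc : 0 < c)
    (hg : DifferentiableOn ℂ g U) (hg0 : g 0 = 0)
    (hV : ∀ ζ ∈ closedBall (0:ℂ) R, ContDiffAt ℝ 2 V ζ)
    (hL : ∀ ζ ∈ closedBall (0:ℂ) R, 4 * c * ‖deriv g ζ‖ ^ 2 ≤ Lv V ζ 1)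
    (hM : ∀ ζ ∈ closedBall (0:ℂ) R, V ζ ≤ M) :
    c * ‖deriv g 0‖ ^ 2 * R ^ 2 ≤ M - V 0 := by
  set a := deriv g 0 with ha
  set k : ℂ → E := dslope g 0 with hk
  have h0U : (0:ℂ) ∈ U := hUR (mem_closedBall_self hR.le)
  have hkd : DifferentiableOn ℂ k U :=
    (Complex.differentiableOn_dslope (hU.mem_nhds h0U)).2 hg
  have hk0 : k 0 = a := by simp [hk, ha]
  have hgk : ∀ ζ, g ζ = ζ • k ζ := fun ζ => by
    have := sub_smul_dslope g 0 ζ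
    simp [hg0] at this
    rw [hk]; exact this.symm
  set L : E →L[ℝ] ℝ := reInner E a with hLdef
  have key : ∀ ε > 0, c * ‖a‖ ^ 2 * R ^ 2 ≤ M - V 0 + ε * R ^ 2 := by
    intro ε hε
    set Φ : ℂ → ℝ := fun ζ => (V ζ - c * ‖g ζ - 0‖ ^ 2) + ((2 * c * R ^ 2) * L (k ζ) +
      (ε * ‖ζ - 0‖ ^ 2 + (- M - c * ‖a‖ ^ 2 * R ^ 2 - ε * R ^ 2))) with hΦ
    have hN : ∀ ζ ∈ closedBall (0:ℂ) R, ContDiffAt ℝ 2 (fun ζ => ‖g ζ - 0‖ ^ 2) ζ := fun ζ hζ =>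
      (contDiff_normSq_sub (0:E)).contDiffAt.comp ζ (holo1_facts hU hg (hUR hζ)).1
    have hLk : ∀ ζ ∈ closedBall (0:ℂ) R, ContDiffAt ℝ 2 (fun ζ => L (k ζ)) ζ := fun ζ hζ =>
      L.contDiff.contDiffAt.comp ζ (holo1_facts hU hkd (hUR hζ)).1
    have hz : ∀ ζ : ℂ, ContDiffAt ℝ 2 (fun ζ : ℂ => ‖ζ - 0‖ ^ 2) ζ := fun ζ =>
      (contDiff_normSq_sub (0:ℂ)).contDiffAt
    have hcd : ∀ ζ ∈ closedBall (0:ℂ) R, ContDiffAt ℝ 2 Φ ζ := fun ζ hζ =>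
      ((hV ζ hζ).sub (contDiffAt_const.mul (hN ζ hζ))).add ((contDiffAt_const.mul (hLk ζ hζ)).add
        ((contDiffAt_const.mul (hz ζ)).add contDiffAt_const))
    have hmp := max_principle (isCompact_closedBall (0:ℂ) R) (Φ := Φ)
      (fun ζ hζ => (hcd ζ hζ).continuousAt.continuousWithinAt) (by
        intro ζ hζ
        rcases (mem_closedBall_zero_iff.1 hζ).lt_or_eq with hlt | heq
        · right
          refine ⟨Filter.mem_of_superset (isOpen_ball.mem_nhds (mem_ball_zero_iff.2 hlt)) ball_subset_closedBall, hcd ζ hζ, 1, ?_⟩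
          have f1 := holo1_facts hU hg (hUR hζ)
          have f2 := holo1_facts hU hkd (hUR hζ)
          have e1 : Lv (fun ζ => ‖g ζ - 0‖ ^ 2) ζ 1 = 4 * ‖deriv g ζ‖ ^ 2 := by
            have := Lv_comp_holo (u := fun x : E => ‖x - 0‖ ^ 2) (T := g) (z := ζ)
              (contDiff_normSq_sub (0:E)).contDiffAt f1.1 f1.2.1 f1.2.2 1
            rw [this, Lv_normSq]; simp
          have e2 : Lv (fun ζ => L (k ζ)) ζ 1 = 0 := by
            have := Lv_comp_holo (u := fun x : E => L x) (T := k) (z := ζ)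
              L.contDiff.contDiffAt f2.1 f2.2.1 f2.2.2 1
            rw [this, Lv_clm]
          have e3 : Lv Φ ζ 1 = Lv V ζ 1 - c * (4 * ‖deriv g ζ‖ ^ 2) + ε * 4 := by
            rw [hΦ, Lv_add ((hV ζ hζ).sub (contDiffAt_const.mul (hN ζ hζ)))
              ((contDiffAt_const.mul (hLk ζ hζ)).add
                ((contDiffAt_const.mul (hz ζ)).add contDiffAt_const)),
              Lv_sub (hV ζ hζ) (contDiffAt_const.mul (hN ζ hζ)), Lv_const_mul _ (hN ζ hζ), e1,
              Lv_add (contDiffAt_const.mul (hLk ζ hζ))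
                ((contDiffAt_const.mul (hz ζ)).add contDiffAt_const), Lv_const_mul _ (hLk ζ hζ), e2,
              Lv_add (contDiffAt_const.mul (hz ζ)) contDiffAt_const, Lv_const_mul _ (hz ζ),
              Lv_normSq, Lv_const]
            simp
          rw [e3]
          have := hL ζ hζ
          linarith
        · left
          have h1 := hM ζ hζ
          have h2 : ‖g ζ - 0‖ ^ 2 = R ^ 2 * ‖k ζ‖ ^ 2 := by
            rw [sub_zero, hgk, norm_smul, heq]; ring
          have h3 : 2 * L (k ζ) ≤ ‖k ζ‖ ^ 2 + ‖a‖ ^ 2 := by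
            have h4 : L (k ζ) ≤ ‖a‖ * ‖k ζ‖ := by
              rw [hLdef, reInner_apply]
              exact (Complex.re_le_norm _).trans (norm_inner_le_norm _ _)
            nlinarith [sq_nonneg (‖a‖ - ‖k ζ‖)]
          simp only [hΦ]
          rw [h2, sub_zero, heq]
          have h5 : 0 ≤ c * R ^ 2 := by positivity
          nlinarith [mul_le_mul_of_nonneg_left h3 h5])
    have := hmp 0 (mem_closedBall_self hR.le)
    simp only [hΦ, hg0, hk0, hLdef, reInner_self] at this
    simp at this
    nlinarith
  refine le_of_forall_pos_le_add fun δ hδ => ?_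
  have := key (δ / R ^ 2) (by positivity)
  rwa [div_mul_cancel₀ _ (by positivity)] at this

end Disc

section BC

lemma bc1 {G : ℂ → ℂ} {R M : ℝ} (hR : 0 < R) (hM : 0 < M) (hG : DifferentiableOn ℂ G (ball 0 R))
    (hG0 : G 0 = 0) (h : ∀ ζ ∈ ball (0:ℂ) R, (G ζ).re ≤ M) : ‖deriv G 0‖ ≤ 4 * M / R ∧ ‖deriv (deriv G) 0‖ ≤ 32 * M / R ^ 2 := by
  have hb : ∀ ζ ∈ ball (0:ℂ) R, ‖G ζ‖ ≤ 2 * M * ‖ζ‖ / (R - ‖ζ‖) := by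
    intro ζ hζ
    have := Complex.borelCaratheodory_zero hM hG (fun z hz => by simpa using h z hz) hR hζ hG0
    exact this
  have hb2 : ∀ ζ ∈ closedBall (0:ℂ) (R/2), ‖G ζ‖ ≤ 2 * M := by
    intro ζ hζ
    rw [mem_closedBall_zero_iff] at hζ
    refine (hb ζ (by rw [mem_ball_zero_iff]; linarith)).trans ?_
    rw [div_le_iff₀ (by linarith)]
    nlinarith [norm_nonneg ζ]
  have hsub : ∀ ζ ∈ ball (0:ℂ) R, DifferentiableAt ℂ G ζ := fun ζ hζ =>
    hG.differentiableAt (isOpen_ball.mem_nhds hζ)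
  have hd : ∀ ζ ∈ closedBall (0:ℂ) (R/4), ‖deriv G ζ‖ ≤ 2 * M / (R / 4) := by
    intro ζ hζ
    rw [mem_closedBall_zero_iff] at hζ
    refine Complex.norm_deriv_le_of_forall_mem_sphere_norm_le (by positivity) ?_ ?_
    · refine DifferentiableOn.diffContOnCl ?_
      rw [closure_ball _ (by positivity)]
      intro x hx
      rw [mem_closedBall, dist_eq_norm] at hx
      refine (hsub x ?_).differentiableWithinAt
      rw [mem_ball_zero_iff]
      calc ‖x‖ = ‖(x - ζ) + ζ‖ := by ring_nf
        _ ≤ ‖x - ζ‖ + ‖ζ‖ := norm_add_le _ _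
        _ < R := by linarith
    · intro x hx
      rw [mem_sphere, dist_eq_norm] at hx
      refine hb2 x ?_
      rw [mem_closedBall_zero_iff]
      calc ‖x‖ = ‖(x - ζ) + ζ‖ := by ring_nf
        _ ≤ ‖x - ζ‖ + ‖ζ‖ := norm_add_le _ _
        _ ≤ R / 2 := by linarith
  constructor
  · have : ‖deriv G 0‖ ≤ 2 * M / (R / 2) := by
      refine Complex.norm_deriv_le_of_forall_mem_sphere_norm_le (by positivity) ?_ ?_
      · refine DifferentiableOn.diffContOnCl ?_
        rw [closure_ball _ (by positivity)]
        intro x hx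
        refine (hsub x ?_).differentiableWithinAt
        rw [mem_closedBall_zero_iff] at hx
        rw [mem_ball_zero_iff]; linarith
      · intro x hx
        exact hb2 x (sphere_subset_closedBall hx)
    refine this.trans (le_of_eq ?_)
    field_simp; ring
  · have : ‖deriv (deriv G) 0‖ ≤ (2 * M / (R / 4)) / (R / 4) := by
      refine Complex.norm_deriv_le_of_forall_mem_sphere_norm_le (by positivity) ?_ ?_
      · refine DifferentiableOn.diffContOnCl ?_
        rw [closure_ball _ (by positivity)]
        have : DifferentiableOn ℂ (deriv G) (ball 0 R) := hG.deriv isOpen_ball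
        refine this.mono fun x hx => ?_
        rw [mem_closedBall_zero_iff] at hx
        rw [mem_ball_zero_iff]; linarith
      · intro x hx
        exact hd x (sphere_subset_closedBall hx)
    refine this.trans (le_of_eq ?_)
    field_simp; ring

lemma bc2 {G : ℂ → ℂ} {R M : ℝ} {a : ℂ} (hR : 0 < R) (hM : 0 < M) (hG : DifferentiableOn ℂ G (ball 0 R))
    (hG0 : G 0 = 0) (h : ∀ ζ ∈ ball (0:ℂ) R, (G ζ).re ≤ (a * ζ).re + M) :
    ‖deriv (deriv G) 0‖ ≤ 32 * M / R ^ 2 := by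
  have h1 : DifferentiableOn ℂ (fun ζ => G ζ - a * ζ) (ball 0 R) := by fun_prop
  have h2 := (bc1 hR hM h1 (by simp [hG0]) (fun ζ hζ => by
    have := h ζ hζ
    simp only [Complex.sub_re]; linarith)).2
  have h3 : deriv (fun ζ => G ζ - a * ζ) =ᶠ[nhds 0] fun ζ => deriv G ζ - a := by
    filter_upwards [isOpen_ball.mem_nhds (mem_ball_self hR)] with x hx
    have : DifferentiableAt ℂ G x := hG.differentiableAt (isOpen_ball.mem_nhds hx)
    have hh : HasDerivAt (fun ζ => G ζ - a * ζ) (deriv G x - a * 1) x :=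
      this.hasDerivAt.sub ((hasDerivAt_id x).const_mul a)
    rw [hh.deriv]; ring
  rw [h3.deriv_eq, deriv_sub_const] at h2
  exact h2

end BC


section Holo
variable {E : Type*} [NormedAddCommGroup E] [NormedSpace ℂ E]
variable {F : Type*} [NormedAddCommGroup F] [NormedSpace ℂ F]

lemma line_hasDerivAt (z ξ : E) (ζ : ℂ) : HasDerivAt (fun ζ : ℂ => z + ζ • ξ) ξ ζ := by
  have := ((hasDerivAt_id ζ).smul_const ξ).const_add z
  simp only [id, one_smul] at this
  exact this

lemma line_isOpen {Ω : Set E} (hΩ : IsOpen Ω) (z ξ : E) : IsOpen {ζ : ℂ | z + ζ • ξ ∈ Ω} :=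
  hΩ.preimage (by fun_prop)

lemma line_diffOn {Ω : Set E} (hΩ : IsOpen Ω) {φ : E → F} (hφ : DifferentiableOn ℂ φ Ω) (z ξ : E) :
    DifferentiableOn ℂ (fun ζ : ℂ => φ (z + ζ • ξ)) {ζ : ℂ | z + ζ • ξ ∈ Ω} := by
  intro ζ hζ
  have h1 : DifferentiableAt ℂ φ (z + ζ • ξ) := hφ.differentiableAt (hΩ.mem_nhds hζ)
  exact (DifferentiableAt.comp ζ h1 (line_hasDerivAt z ξ ζ).differentiableAt).differentiableWithinAt

lemma line_deriv {φ : E → F} {z ξ : E} {ζ : ℂ} (hφ : DifferentiableAt ℂ φ (z + ζ • ξ)) :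
    deriv (fun ζ : ℂ => φ (z + ζ • ξ)) ζ = fderiv ℂ φ (z + ζ • ξ) ξ :=
  (hφ.hasFDerivAt.comp_hasDerivAt ζ (line_hasDerivAt z ξ ζ)).deriv

lemma line_mem {z ξ : E} {R : ℝ} (hξ : ‖ξ‖ ≤ 1) {ζ : ℂ} (hζ : ‖ζ‖ ≤ R) :
    z + ζ • ξ ∈ closedBall z R := by
  rw [mem_closedBall, dist_eq_norm, add_sub_cancel_left, norm_smul]
  have := norm_nonneg ζ
  nlinarith [norm_nonneg ξ]

lemma cauchy_fderiv [CompleteSpace F] {Ω : Set E} (hΩ : IsOpen Ω) {φ : E → F} (hφ : DifferentiableOn ℂ φ Ω)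
    {z : E} {R M : ℝ} (hR : 0 < R) (hM0 : 0 ≤ M) (hs : closedBall z R ⊆ Ω)
    (hM : ∀ x ∈ closedBall z R, ‖φ x‖ ≤ M) : ‖fderiv ℂ φ z‖ ≤ M / R := by
  refine ContinuousLinearMap.opNorm_le_of_unit_norm (by positivity) fun ξ hξ => ?_
  have h1 := line_deriv (φ := φ) (z := z) (ξ := ξ) (ζ := 0)
    (by simpa using hφ.differentiableAt (hΩ.mem_nhds (hs (mem_closedBall_self hR.le))))
  simp only [zero_smul, add_zero] at h1
  rw [← h1]
  refine Complex.norm_deriv_le_of_forall_mem_sphere_norm_le hR ?_ ?_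
  · refine DifferentiableOn.diffContOnCl ?_
    rw [closure_ball _ hR.ne']
    refine (line_diffOn hΩ hφ z ξ).mono fun ζ hζ => hs (line_mem hξ.le (by simpa using hζ))
  · intro ζ hζ
    exact hM _ (line_mem hξ.le (by simpa using hζ.le))

lemma holo_fderiv_apply [FiniteDimensional ℂ E] [FiniteDimensional ℂ F] {Ω : Set E} (hΩ : IsOpen Ω)
    {φ : E → F} (hφ : DifferentiableOn ℂ φ Ω) {z0 : E} (hz0 : z0 ∈ Ω) {ξ : E} (hξ : ‖ξ‖ ≤ 1) :
    DifferentiableAt ℂ (fun z => fderiv ℂ φ z ξ) z0 := by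
  have : CompleteSpace F := FiniteDimensional.complete ℂ F
  have : ProperSpace E := FiniteDimensional.proper ℂ E
  obtain ⟨R', hR', hsub⟩ := Metric.isOpen_iff.1 hΩ z0 hz0
  set R := R' / 8 with hRdef
  have hR : 0 < R := by positivity
  have hsub2 : closedBall z0 (4 * R) ⊆ Ω :=
    (closedBall_subset_ball (by rw [hRdef]; linarith)).trans hsub
  obtain ⟨M, hM⟩ := (isCompact_closedBall z0 (4 * R)).exists_bound_of_continuousOn
    (hφ.continuousOn.mono hsub2)
  have hM0 : 0 ≤ M := (norm_nonneg _).trans (hM z0 (mem_closedBall_self (by positivity)))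
  have hder : ∀ x ∈ ball z0 (2 * R), ‖fderiv ℂ φ x‖ ≤ M / R := by
    intro x hx
    have : closedBall x R ⊆ closedBall z0 (4 * R) :=
      closedBall_subset_closedBall' (by rw [mem_ball] at hx; linarith)
    exact cauchy_fderiv hΩ hφ hR hM0 (this.trans hsub2) fun y hy => hM y (this hy)
  have hcm : ∀ θ : ℝ, ‖circleMap 0 R θ‖ = R := fun θ => by simp [abs_of_pos hR]
  have hpt : ∀ z ∈ ball z0 R, ∀ θ : ℝ, z + circleMap 0 R θ • ξ ∈ ball z0 (2 * R) := by
    intro z hz θ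
    have h1 := line_mem (z := z) hξ (hcm θ).le
    rw [mem_closedBall] at h1
    rw [mem_ball] at hz ⊢
    linarith [dist_triangle (z + circleMap 0 R θ • ξ) z z0]
  have hb2 : ball z0 (2 * R) ⊆ Ω := (ball_subset_closedBall.trans
    (closedBall_subset_closedBall (by linarith))).trans hsub2
  -- coefficient
  set c : ℝ → ℂ := fun θ => deriv (circleMap 0 R) θ * ((circleMap 0 R θ - 0) ^ 2)⁻¹ with hcdef
  have hccont : Continuous c := by
    simp only [hcdef, deriv_circleMap, sub_zero]
    have h2 : Continuous (circleMap 0 R) := continuous_circleMap 0 R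
    refine (h2.mul continuous_const).mul ((h2.pow 2).inv₀ fun θ => ?_)
    have := hcm θ
    intro h
    have h0 : circleMap 0 R θ = 0 := by simpa using h
    rw [h0] at this; simp at this; linarith
  have hFcont : ∀ z ∈ ball z0 R, Continuous (fun θ => φ (z + circleMap 0 R θ • ξ)) := by
    intro z hz
    rw [continuous_iff_continuousAt]
    intro θ
    have h1 : ContinuousAt φ (z + circleMap 0 R θ • ξ) :=
      (hφ.differentiableAt (hΩ.mem_nhds (hb2 (hpt z hz θ)))).continuousAt
    have h2 : Continuous (circleMap 0 R) := continuous_circleMap 0 R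
    exact ContinuousAt.comp (f := fun θ => z + circleMap 0 R θ • ξ) h1
      (by fun_prop)
  have key : ∀ z ∈ ball z0 R, fderiv ℂ φ z ξ = (2 * Real.pi * I : ℂ)⁻¹ •
      ∫ θ in (0:ℝ)..(2 * Real.pi), c θ • φ (z + circleMap 0 R θ • ξ) := by
    intro z hz
    have hzΩ : z ∈ Ω := hb2 (ball_subset_ball (by linarith) hz)
    have h1 := line_deriv (φ := φ) (z := z) (ξ := ξ) (ζ := 0)
      (by simpa using hφ.differentiableAt (hΩ.mem_nhds hzΩ))
    simp only [zero_smul, add_zero] at h1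
    have h2 := Complex.cderiv_eq_deriv (line_isOpen hΩ z ξ) (line_diffOn hΩ hφ z ξ) hR (z := 0)
      (fun ζ hζ => hb2 (by
        have h1 := line_mem (z := z) hξ (by simpa using hζ : ‖ζ‖ ≤ R)
        rw [mem_closedBall] at h1
        rw [mem_ball] at hz ⊢
        linarith [dist_triangle (z + ζ • ξ) z z0]))
    rw [← h1, ← h2, Complex.cderiv, circleIntegral]
    simp only [hcdef, smul_smul]
  have hev : (fun z => fderiv ℂ φ z ξ) =ᶠ[nhds z0] fun z => (2 * Real.pi * I : ℂ)⁻¹ •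
      ∫ θ in (0:ℝ)..(2 * Real.pi), c θ • φ (z + circleMap 0 R θ • ξ) := by
    filter_upwards [ball_mem_nhds z0 hR] with z hz using key z hz
  refine DifferentiableAt.congr_of_eventuallyEq ?_ hev
  refine DifferentiableAt.const_smul ?_ _
  borelize E
  borelize F
  borelize (E →L[ℂ] F)
  have : SecondCountableTopology E := by
    exact secondCountable_of_proper
  have : FiniteDimensional ℂ (E →L[ℂ] F) := inferInstance
  have : ProperSpace (E →L[ℂ] F) := FiniteDimensional.proper ℂ _
  have : SecondCountableTopology (E →L[ℂ] F) := secondCountable_of_proper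
  obtain ⟨Cc, hCc⟩ := (isCompact_Icc (a := (0:ℝ)) (b := 2 * Real.pi)).exists_bound_of_continuousOn
    hccont.continuousOn
  refine (intervalIntegral.hasFDerivAt_integral_of_dominated_of_fderiv_le (𝕜 := ℂ)
    (F := fun z θ => c θ • φ (z + circleMap 0 R θ • ξ))
    (F' := fun z θ => c θ • fderiv ℂ φ (z + circleMap 0 R θ • ξ))
    (bound := fun _ => Cc * (M / R)) (ball_mem_nhds z0 hR) ?_ ?_ ?_ ?_ ?_ ?_).differentiableAt
  · filter_upwards [ball_mem_nhds z0 hR] with z hz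
    exact (hccont.smul (hFcont z hz)).aestronglyMeasurable
  · exact (hccont.smul (hFcont z0 (mem_ball_self hR))).intervalIntegrable _ _
  · refine (hccont.aestronglyMeasurable).smul ?_
    refine Measurable.aestronglyMeasurable ?_
    refine (measurable_fderiv ℂ φ).comp ?_
    have h2 : Continuous (circleMap 0 R) := continuous_circleMap 0 R
    exact (by fun_prop : Continuous fun θ => z0 + circleMap 0 R θ • ξ).measurable
  · refine Filter.Eventually.of_forall fun θ hθ z hz => ?_
    rw [Set.uIoc_of_le Real.two_pi_pos.le] at hθ
    rw [norm_smul]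
    have h1 := hCc θ ⟨hθ.1.le, hθ.2⟩
    have h2 := hder _ (hpt z hz θ)
    have := (norm_nonneg _).trans h1
    gcongr
  · exact intervalIntegrable_const
  · refine Filter.Eventually.of_forall fun θ hθ z hz => ?_
    have h1 := (hφ.differentiableAt (hΩ.mem_nhds (hb2 (hpt z hz θ)))).hasFDerivAt
    have h2 : HasFDerivAt (fun z => z + circleMap 0 R θ • ξ) (ContinuousLinearMap.id ℂ E) z :=
      (hasFDerivAt_id z).add_const _
    exact (HasFDerivAt.comp z h1 h2).const_smul (c θ)

lemma holo_fderiv [FiniteDimensional ℂ E] [FiniteDimensional ℂ F] {Ω : Set E} (hΩ : IsOpen Ω)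
    {φ : E → F} (hφ : DifferentiableOn ℂ φ Ω) : DifferentiableOn ℂ (fderiv ℂ φ) Ω := by
  intro z hz
  refine DifferentiableAt.differentiableWithinAt ?_
  have key : ∀ ξ : E, DifferentiableAt ℂ (fun z => fderiv ℂ φ z ξ) z := by
    intro ξ
    by_cases hξ : ξ = 0
    · simp [hξ]
    · have h1 := holo_fderiv_apply hΩ hφ hz (ξ := ((‖ξ‖⁻¹ : ℝ) : ℂ) • ξ)
        (by rw [norm_smul]; simp [norm_ne_zero_iff.2 hξ])
      have h2 := h1.const_smul ((‖ξ‖ : ℝ) : ℂ)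
      refine h2.congr_of_eventuallyEq (Filter.Eventually.of_forall fun x => ?_)
      have : (‖ξ‖ : ℂ) ≠ 0 := by exact_mod_cast norm_ne_zero_iff.2 hξ
      simp [smul_smul, this]
  let d := Module.finrank ℂ E
  have hd : d = Module.finrank ℂ (Fin d → ℂ) := (Module.finrank_fin_fun ℂ).symm
  let e₁ : E ≃L[ℂ] Fin d → ℂ := ContinuousLinearEquiv.ofFinrankEq hd
  let e₂ : (E →L[ℂ] F) ≃L[ℂ] Fin d → F :=
    (e₁.arrowCongr (1 : F ≃L[ℂ] F)).trans (ContinuousLinearEquiv.piRing (Fin d))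
  rw [← e₂.comp_differentiableAt_iff, differentiableAt_pi]
  intro i
  exact key _

lemma holo_contDiffAt [FiniteDimensional ℂ E] [FiniteDimensional ℂ F] {Ω : Set E} (hΩ : IsOpen Ω)
    {φ : E → F} (hφ : DifferentiableOn ℂ φ Ω) {z : E} (hz : z ∈ Ω) : ContDiffAt ℂ 2 φ z := by
  have h1 := holo_fderiv hΩ hφ
  have h2 := holo_fderiv hΩ h1
  have : ContDiffOn ℂ 2 φ Ω := by
    rw [show (2 : WithTop ℕ∞) = 1 + 1 by norm_num, contDiffOn_succ_iff_fderiv_of_isOpen hΩ]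
    refine ⟨hφ, by simp, ?_⟩
    rw [show (1 : WithTop ℕ∞) = 0 + 1 by norm_num, contDiffOn_succ_iff_fderiv_of_isOpen hΩ]
    refine ⟨h1, by simp, ?_⟩
    exact contDiffOn_zero.2 h2.continuousOn
  exact this.contDiffAt (hΩ.mem_nhds hz)

end Holo


section Bridge
variable {E : Type*} [NormedAddCommGroup E] [NormedSpace ℂ E] [NormedSpace ℝ E] [IsScalarTower ℝ ℂ E]

lemma smul_decomp (c : ℂ) (x : E) : c • x = c.re • x + c.im • (I • x) := by
  rw [real_smul_eq, real_smul_eq, smul_smul, ← add_smul, Complex.re_add_im]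

lemma I_smul_I_smul (x : E) : I • (I • x) = - x := by
  rw [smul_smul, Complex.I_mul_I, neg_one_smul]

lemma I_smul_real (r : ℝ) (x : E) : I • (r • x) = r • (I • x) := by
  rw [real_smul_eq, real_smul_eq, smul_comm]

/-- Sesquilinear Hermitian form (times 4) attached to a real bilinear form. -/
def hs (D : E →L[ℝ] E →L[ℝ] ℝ) : E →ₗ[ℂ] E →ₛₗ[starRingEnd ℂ] ℂ :=
  LinearMap.mk₂'ₛₗ (RingHom.id ℂ) (starRingEnd ℂ)
    (fun ξ η => ((D ξ η + D (I • ξ) (I • η) : ℝ) : ℂ) + I * ((D ξ (I • η) - D (I • ξ) η : ℝ) : ℂ))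
    (by intro x y z; simp only [smul_add, map_add, add_apply]; push_cast; ring)
    (by
      intro c x y
      rw [smul_decomp c x]
      simp only [smul_add, map_add, I_smul_real, I_smul_I_smul, map_smul, map_neg, add_apply,
        smul_apply, neg_apply, smul_eq_mul, smul_neg, RingHom.id_apply]
      apply Complex.ext <;> simp <;> ring)
    (by intro x y z; simp only [smul_add, map_add]; push_cast; ring)
    (by
      intro c x y
      rw [smul_decomp c y]
      simp only [smul_add, map_add, I_smul_real, I_smul_I_smul, map_smul, map_neg,
        smul_eq_mul, smul_neg]
      apply Complex.ext <;> simp <;> ring)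

lemma hs_apply (D : E →L[ℝ] E →L[ℝ] ℝ) (ξ η : E) : hs D ξ η =
    ((D ξ η + D (I • ξ) (I • η) : ℝ) : ℂ) + I * ((D ξ (I • η) - D (I • ξ) η : ℝ) : ℂ) := rfl

lemma hs_re {u : E → ℝ} {z : E} (ξ η : E) : (hs (D2 u z) ξ η).re = Bv u z ξ η := by
  rw [hs_apply]; simp [Bv]

end Bridge

section Eucl
variable {n : ℕ}

lemma fderiv_ofReal {E : Type*} [NormedAddCommGroup E] [NormedSpace ℝ E] {u : E → ℝ} {z : E}
    (h : DifferentiableAt ℝ u z) (ξ : E) :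
    fderiv ℝ (fun v => ((u v : ℝ) : ℂ)) z ξ = ((fderiv ℝ u z ξ : ℝ) : ℂ) := by
  have := (Complex.ofRealCLM.hasFDerivAt.comp z h.hasFDerivAt).fderiv
  rw [show (fun v => ((u v : ℝ) : ℂ)) = Complex.ofRealCLM ∘ u from rfl, this]
  rfl

lemma single_I (i : Fin n) : EuclideanSpace.single i Complex.I = Complex.I • EuclideanSpace.single i (1:ℂ) := by
  ext k; simp [Pi.single_apply]

lemma cHess_eq {u : EuclideanSpace ℂ (Fin n) → ℝ} {z : EuclideanSpace ℂ (Fin n)}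
    (hu : ContDiffAt ℝ 2 u z) (i j : Fin n) :
    4 * cHess n u z i j = hs (D2 u z) (EuclideanSpace.single i 1) (EuclideanSpace.single j 1) := by
  have h1 : (fun w => wDzBar n j (fun v => ((u v : ℝ) : ℂ)) w) =ᶠ[nhds z] fun w =>
      (((fderiv ℝ u w (EuclideanSpace.single j 1) : ℝ) : ℂ) +
        I * ((fderiv ℝ u w (I • EuclideanSpace.single j 1) : ℝ) : ℂ)) / 2 := by
    filter_upwards [cda_ev_diff hu] with x hx
    rw [wDzBar, fderiv_ofReal hx, fderiv_ofReal hx, single_I]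
  have h2 : ∀ η, HasFDerivAt (fun w => ((fderiv ℝ u w η : ℝ) : ℂ))
      (Complex.ofRealCLM.comp ((D2 u z).flip η)) z := by
    intro η
    have h3 : HasFDerivAt (fun w => fderiv ℝ u w η) ((D2 u z).flip η) z := by
      have := (cda_fderiv_diff hu).hasFDerivAt.clm_apply (hasFDerivAt_const η z)
      have e : (D2 u z).flip η = (fderiv ℝ u z).comp (0 : EuclideanSpace ℂ (Fin n) →L[ℝ] EuclideanSpace ℂ (Fin n)) + (fderiv ℝ (fderiv ℝ u) z).flip η := by
        ext x; simp [D2]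
      rw [e]; exact this
    exact Complex.ofRealCLM.hasFDerivAt.comp z h3
  have h4 := ((h2 (EuclideanSpace.single j 1)).add
    ((h2 (I • EuclideanSpace.single j 1)).const_mul I)).mul_const (2⁻¹ : ℂ)
  have h5 : ∀ ξ, fderiv ℝ (fun w => wDzBar n j (fun v => ((u v : ℝ) : ℂ)) w) z ξ =
      (((D2 u z ξ (EuclideanSpace.single j 1) : ℝ) : ℂ) +
        I * ((D2 u z ξ (I • EuclideanSpace.single j 1) : ℝ) : ℂ)) / 2 := by
    intro ξ
    rw [h1.fderiv_eq]
    have h6 := h4.fderiv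
    simp only [div_eq_mul_inv]
    have h7 := congrArg (fun L => L ξ) h6
    refine h7.trans ?_
    simp
    ring
  rw [cHess, Matrix.of_apply, wDz, h5, h5, single_I, hs_apply]
  apply Complex.ext <;> simp <;> ring

lemma eucl_sum (w : EuclideanSpace ℂ (Fin n)) : w = ∑ i, w i • EuclideanSpace.single i (1:ℂ) := by
  ext k
  simp [Pi.single_apply]

lemma hs_sum {u : EuclideanSpace ℂ (Fin n) → ℝ} {z : EuclideanSpace ℂ (Fin n)}
    (hu : ContDiffAt ℝ 2 u z) (ξ η : EuclideanSpace ℂ (Fin n)) :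
    hs (D2 u z) ξ η = 4 * ∑ i, ∑ j, cHess n u z i j * ξ i * (starRingEnd ℂ) (η j) := by
  conv_lhs => rw [eucl_sum ξ, eucl_sum η]
  simp only [map_sum, LinearMap.sum_apply, LinearMap.map_smulₛₗ, LinearMap.smul_apply, map_smul, Finset.mul_sum]
  rw [Finset.sum_comm]
  refine Finset.sum_congr rfl fun i _ => ?_
  rw [Finset.smul_sum]
  refine Finset.sum_congr rfl fun j _ => ?_
  rw [← cHess_eq hu]
  simp only [smul_eq_mul]; ring

lemma cHessForm_re {u : EuclideanSpace ℂ (Fin n) → ℝ} {z : EuclideanSpace ℂ (Fin n)}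
    (hu : ContDiffAt ℝ 2 u z) (ξ : EuclideanSpace ℂ (Fin n)) :
    4 * (cHessForm n u z (fun i => ξ i)).re = Lv u z ξ := by
  have h1 := hs_sum hu ξ ξ
  have h2 := hs_re (u := u) (z := z) ξ ξ
  rw [h1] at h2
  rw [cHessForm, show Lv u z ξ = Bv u z ξ ξ from rfl, ← h2]
  simp

lemma cGradPair_eq {u : EuclideanSpace ℂ (Fin n) → ℝ} {z : EuclideanSpace ℂ (Fin n)}
    (hu : DifferentiableAt ℝ u z) (ξ : EuclideanSpace ℂ (Fin n)) (h1 : fderiv ℝ u z ξ = 0)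
    (h2 : fderiv ℝ u z (I • ξ) = 0) : cGradPair n u z (fun i => ξ i) = 0 := by
  have key : cGradPair n u z (fun i => ξ i) =
      (((fderiv ℝ u z ξ : ℝ) : ℂ) - I * ((fderiv ℝ u z (I • ξ) : ℝ) : ℂ)) / 2 := by
    conv_rhs => rw [eucl_sum ξ]
    rw [cGradPair, Finset.smul_sum, map_sum, map_sum]
    push_cast
    rw [Finset.mul_sum, ← Finset.sum_sub_distrib, Finset.sum_div]
    refine Finset.sum_congr rfl fun i _ => ?_
    rw [wDz, fderiv_ofReal hu, fderiv_ofReal hu, single_I, smul_decomp (ξ i)]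
    simp only [smul_add, map_add, I_smul_real, I_smul_I_smul, map_smul, map_neg, smul_neg, smul_eq_mul]
    apply Complex.ext <;> simp <;> ring
  rw [key, h1, h2]; simp

lemma eigen_lemma (hn : 0 < n) {u : EuclideanSpace ℂ (Fin n) → ℝ} {z : EuclideanSpace ℂ (Fin n)}
    (hu : ContDiffAt ℝ 2 u z) (hpsh : ∀ ξ, 0 ≤ Lv u z ξ) {d : ℝ} (hd : 0 ≤ d)
    (hdet : ‖(cHess n u z).det‖ ≤ d ^ n) :
    ∃ e : EuclideanSpace ℂ (Fin n), ‖e‖ = 1 ∧ Lv u z e ≤ 4 * d ∧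
      ∀ η, |Bv u z e η| ≤ Lv u z e * ‖η‖ := by
  set H := cHess n u z with hH
  have hherm : H.IsHermitian := by
    ext i j
    have h1 := cHess_eq hu i j
    have h2 := cHess_eq hu j i
    rw [← hH] at h1 h2
    have h3 : 4 * star (H j i) = 4 * H i j := by
      rw [h1]
      have := congrArg star h2
      rw [star_mul'] at this
      rw [show star (4:ℂ) = 4 by simp] at this
      rw [this, hs_apply, hs_apply]
      rw [D2_symm hu (EuclideanSpace.single i 1) (EuclideanSpace.single j 1),
        D2_symm hu (I • EuclideanSpace.single i 1) (I • EuclideanSpace.single j 1),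
        D2_symm hu (I • EuclideanSpace.single i 1) (EuclideanSpace.single j 1),
        D2_symm hu (EuclideanSpace.single i 1) (I • EuclideanSpace.single j 1)]
      apply Complex.ext <;> simp
    rw [Matrix.conjTranspose_apply]
    exact mul_left_cancel₀ (by norm_num) h3
  -- conjugate vector
  let cj : EuclideanSpace ℂ (Fin n) → EuclideanSpace ℂ (Fin n) :=
    fun v => WithLp.toLp 2 (fun i => star (v i))
  have hcj : ∀ v, ‖cj v‖ = ‖v‖ := fun v => by
    rw [EuclideanSpace.norm_eq, EuclideanSpace.norm_eq]
    simp [cj]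
  have hB : ∀ k η, hs (D2 u z) (cj (hherm.eigenvectorBasis k)) η =
      4 * (hherm.eigenvalues k : ℂ) * inner ℂ (hherm.eigenvectorBasis k) (cj η) := by
    intro k η
    rw [hs_sum hu]
    have he := hherm.mulVec_eigenvectorBasis k
    have h5 : ∀ j, ∑ i, H i j * star (hherm.eigenvectorBasis k i) =
        (hherm.eigenvalues k : ℂ) * star (hherm.eigenvectorBasis k j) := by
      intro j
      have h6 := congrFun he j
      rw [Matrix.mulVec, dotProduct] at h6
      have h7 := congrArg star h6
      rw [star_sum] at h7
      simp only [star_mul', Pi.smul_apply] at h7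
      rw [show star (hherm.eigenvalues k • (hherm.eigenvectorBasis k).ofLp j) =
        (hherm.eigenvalues k : ℂ) * star (hherm.eigenvectorBasis k j) by
          rw [Complex.real_smul, star_mul']; simp] at h7
      rw [← h7]
      refine Finset.sum_congr rfl fun i _ => ?_
      rw [hherm.apply]
    rw [Finset.sum_comm, mul_assoc, PiLp.inner_apply]
    congr 1
    rw [Finset.mul_sum]
    refine Finset.sum_congr rfl fun j _ => ?_
    rw [← Finset.sum_mul]
    have := h5 j
    simp only [cj]
    rw [this]
    simp
    ring
  have hLv : ∀ k, Lv u z (cj (hherm.eigenvectorBasis k)) = 4 * hherm.eigenvalues k := by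
    intro k
    have h1 := hB k (cj (hherm.eigenvectorBasis k))
    have h2 : cj (cj (hherm.eigenvectorBasis k)) = hherm.eigenvectorBasis k := by
      ext i; simp [cj]
    rw [h2, inner_self_eq_norm_sq_to_K, hherm.eigenvectorBasis.norm_eq_one] at h1
    have h3 := hs_re (u := u) (z := z) (cj (hherm.eigenvectorBasis k)) (cj (hherm.eigenvectorBasis k))
    rw [h1] at h3
    rw [show Lv u z (cj (hherm.eigenvectorBasis k)) = Bv u z (cj (hherm.eigenvectorBasis k)) (cj (hherm.eigenvectorBasis k)) from rfl, ← h3]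
    simp
  have hnn : ∀ k, 0 ≤ hherm.eigenvalues k := fun k => by
    have := hpsh (cj (hherm.eigenvectorBasis k))
    rw [hLv] at this; linarith
  have hmin : ∃ k, hherm.eigenvalues k ≤ d := by
    by_contra hcon
    push Not at hcon
    have h1 := hherm.det_eq_prod_eigenvalues
    rw [h1] at hdet
    have h2 : ‖∏ k, (hherm.eigenvalues k : ℂ)‖ = ∏ k, hherm.eigenvalues k := by
      rw [norm_prod]
      refine Finset.prod_congr rfl fun k _ => ?_
      rw [Complex.norm_real, Real.norm_of_nonneg (hnn k)]
    have h3 : d ^ n < ∏ k, hherm.eigenvalues k := by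
      rcases hd.eq_or_lt with h0 | h0
      · rw [← h0, zero_pow hn.ne']
        exact Finset.prod_pos fun k _ => h0.trans_lt (hcon k)
      · have : d ^ n = ∏ _k : Fin n, d := by simp
        rw [this]
        have hne : Nonempty (Fin n) := ⟨⟨0, hn⟩⟩
        exact Finset.prod_lt_prod_of_nonempty (fun _ _ => h0) (fun k _ => hcon k) Finset.univ_nonempty
    have : ‖∏ k, (hherm.eigenvalues k : ℂ)‖ ≤ d ^ n := hdet
    rw [h2] at this
    linarith
  obtain ⟨k, hk⟩ := hmin
  refine ⟨cj (hherm.eigenvectorBasis k), ?_, ?_, ?_⟩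
  · rw [hcj, hherm.eigenvectorBasis.norm_eq_one]
  · rw [hLv]; linarith
  · intro η
    rw [← hs_re, hB, hLv]
    refine (Complex.abs_re_le_norm _).trans ?_
    rw [norm_mul, norm_mul, Complex.norm_real, Real.norm_of_nonneg (hnn k)]
    have h1 := norm_inner_le_norm (𝕜 := ℂ) (hherm.eigenvectorBasis k) (cj η)
    rw [hherm.eigenvectorBasis.norm_eq_one, hcj, one_mul] at h1
    have : ‖(4:ℂ)‖ = 4 := by simp
    rw [this]
    have := hnn k
    gcongr

end Eucl


section MeanValue
variable {E : Type*} [NormedAddCommGroup E] [NormedSpace ℝ E]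
variable {G : Type*} [NormedAddCommGroup G] [NormedSpace ℝ G]

lemma mv1 {f : E → G} {s : Set E} (hs : Convex ℝ s) {C : ℝ} (hd : ∀ x ∈ s, DifferentiableAt ℝ f x)
    (hb : ∀ x ∈ s, ‖fderiv ℝ f x‖ ≤ C) {x y : E} (hx : x ∈ s) (hy : y ∈ s) :
    ‖f y - f x‖ ≤ C * ‖y - x‖ := hs.norm_image_sub_le_of_norm_fderiv_le hd hb hx hy

lemma taylor2 {f : E → G} {s : Set E} (hs : Convex ℝ s) {C : ℝ} (hd : ∀ x ∈ s, DifferentiableAt ℝ f x)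
    (hd2 : ∀ x ∈ s, DifferentiableAt ℝ (fderiv ℝ f) x)
    (hb : ∀ x ∈ s, ‖fderiv ℝ (fderiv ℝ f) x‖ ≤ C) {x y : E} (hx : x ∈ s) (hy : y ∈ s) :
    ‖f y - f x - fderiv ℝ f x (y - x)‖ ≤ C * ‖y - x‖ ^ 2 := by
  have hC : 0 ≤ C := le_trans (norm_nonneg (fderiv ℝ (fderiv ℝ f) x)) (hb x hx)
  have hseg : segment ℝ x y ⊆ s := hs.segment_subset hx hy
  have h := (convex_segment x y).norm_image_sub_le_of_norm_fderiv_le' (f := f) (φ := fderiv ℝ f x)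
    (C := C * ‖y - x‖) (fun u hu => hd u (hseg hu)) (fun u hu => by
      have h1 := mv1 hs hd2 hb hx (hseg hu)
      have h2 : ‖u - x‖ ≤ ‖y - x‖ := norm_sub_le_of_mem_segment hu
      exact h1.trans (by gcongr)) (left_mem_segment ℝ x y) (right_mem_segment ℝ x y)
  refine h.trans (le_of_eq ?_); ring

lemma taylor2L {f : E → G} {s : Set E} (hs : Convex ℝ s) {C : ℝ} (hC : 0 ≤ C) (hd : ∀ x ∈ s, DifferentiableAt ℝ f x)
    {x y : E} (hx : x ∈ s) (hy : y ∈ s)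
    (hb : ∀ u ∈ s, ‖fderiv ℝ f u - fderiv ℝ f x‖ ≤ C * ‖u - x‖) :
    ‖f y - f x - fderiv ℝ f x (y - x)‖ ≤ C * ‖y - x‖ ^ 2 := by
  have hseg : segment ℝ x y ⊆ s := hs.segment_subset hx hy
  have h := (convex_segment x y).norm_image_sub_le_of_norm_fderiv_le' (f := f) (φ := fderiv ℝ f x)
    (C := C * ‖y - x‖) (fun u hu => hd u (hseg hu)) (fun u hu => by
      have h1 := hb u (hseg hu)
      have h2 : ‖u - x‖ ≤ ‖y - x‖ := norm_sub_le_of_mem_segment hu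
      exact h1.trans (by gcongr)) (left_mem_segment ℝ x y) (right_mem_segment ℝ x y)
  refine h.trans (le_of_eq ?_); ring

lemma taylor3 {f : E → ℝ} {s : Set E} (hs : Convex ℝ s) {C : ℝ} (hC : 0 ≤ C) (hd : ∀ x ∈ s, ContDiffAt ℝ 3 f x)
    {x y : E} (hx : x ∈ s) (hy : y ∈ s) (hb : ∀ u ∈ s, ‖D2 f u - D2 f x‖ ≤ C * ‖u - x‖) :
    ‖f y - f x - fderiv ℝ f x (y - x) - (1/2) * D2 f x (y - x) (y - x)‖ ≤ C * ‖y - x‖ ^ 3 := by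
  have hseg : segment ℝ x y ⊆ s := hs.segment_subset hx hy
  set g : E → ℝ := fun u => f u - (1/2) * D2 f x (u - x) (u - x) with hg
  have hd' : ∀ u ∈ s, DifferentiableAt ℝ f u := fun u hu => (hd u hu).differentiableAt (by norm_num)
  have h2x : ContDiffAt ℝ 2 f x := (hd x hx).of_le (by norm_num)
  have hgd : ∀ u ∈ s, HasFDerivAt g (fderiv ℝ f u - D2 f x (u - x)) u := by
    intro u hu
    have h1 : HasFDerivAt (fun u : E => u - x) (ContinuousLinearMap.id ℝ E) u :=
      (hasFDerivAt_id u).sub_const x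
    have h2 := ((D2 f x).hasFDerivAt.comp u h1).clm_apply h1
    have h3 := (hd' u hu).hasFDerivAt.sub (h2.const_mul (1/2))
    have e : fderiv ℝ f u - D2 f x (u - x) = fderiv ℝ f u - (1/2:ℝ) • ((D2 f x (u - x)).comp (ContinuousLinearMap.id ℝ E) +
      ((D2 f x).comp (ContinuousLinearMap.id ℝ E)).flip (u - x)) := by
      ext v
      simp
      rw [D2_symm h2x v u, D2_symm h2x v x] <;> ring
    rw [e]
    exact h3
  have h := (convex_segment x y).norm_image_sub_le_of_norm_fderiv_le' (f := g) (φ := fderiv ℝ f x)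
    (C := C * ‖y - x‖ ^ 2) (fun u hu => (hgd u (hseg hu)).differentiableAt) (fun u hu => by
      rw [(hgd u (hseg hu)).fderiv]
      have h1 := taylor2L (f := fderiv ℝ f) hs hC
        (fun v hv => cda_fderiv_diff ((hd v hv).of_le (by norm_num))) hx (hseg hu) hb
      have h2 : ‖u - x‖ ≤ ‖y - x‖ := norm_sub_le_of_mem_segment hu
      have e : fderiv ℝ f u - D2 f x (u - x) - fderiv ℝ f x = fderiv ℝ f u - fderiv ℝ f x - fderiv ℝ (fderiv ℝ f) x (u - x) := by
        unfold D2; abel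
      rw [e]
      exact h1.trans (by gcongr)) (left_mem_segment ℝ x y) (right_mem_segment ℝ x y)
  have e : g y - g x - fderiv ℝ f x (y - x) = f y - f x - fderiv ℝ f x (y - x) - (1/2) * D2 f x (y - x) (y - x) := by
    simp [hg]; ring
  rw [e] at h
  refine h.trans (le_of_eq ?_); ring

end MeanValue

section Unif

lemma unif {X : Type*} [PseudoMetricSpace X] {K : Set X} (hK : IsCompact K) {Q : ℝ → X → Prop}
    (mono : ∀ C C' x, C ≤ C' → Q C x → Q C' x) (h : ∀ p ∈ K, ∃ C, ∀ᶠ x in nhds p, Q C x) :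
    ∃ C s, 1 ≤ C ∧ 0 < s ∧ s ≤ 1 ∧ ∀ p ∈ K, ∀ x ∈ ball p s, Q C x := by
  have h1 : ∃ C, ∀ᶠ x in nhdsSet K, Q C x := by
    refine hK.induction_on (p := fun S => ∃ C, ∀ᶠ x in nhdsSet S, Q C x) ⟨0, by simp⟩ ?_ ?_ ?_
    · rintro S T hST ⟨C, hC⟩
      exact ⟨C, hC.filter_mono (nhdsSet_mono hST)⟩
    · rintro S T ⟨C, hC⟩ ⟨C', hC'⟩
      refine ⟨max C C', ?_⟩
      rw [nhdsSet_union, Filter.eventually_sup]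
      exact ⟨hC.mono fun x => mono _ _ x (le_max_left _ _), hC'.mono fun x => mono _ _ x (le_max_right _ _)⟩
    · intro p hp
      obtain ⟨C, hC⟩ := h p hp
      obtain ⟨V, hV, hVo, hpV⟩ := _root_.eventually_nhds_iff.1 hC
      refine ⟨V, mem_nhdsWithin_of_mem_nhds (hVo.mem_nhds hpV), C, ?_⟩
      exact Filter.mem_of_superset (hVo.mem_nhdsSet.2 le_rfl) hV
  obtain ⟨C, hC⟩ := h1
  obtain ⟨s, hs, hsub⟩ := (Metric.hasBasis_nhdsSet_thickening hK).mem_iff.1 hC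
  refine ⟨max C 1, min s 1, le_max_right _ _, by positivity, min_le_right _ _, fun p hp x hx => ?_⟩
  refine mono _ _ x (le_max_left _ _) (hsub ?_)
  rw [Metric.mem_thickening_iff]
  exact ⟨p, hp, (mem_ball.1 hx).trans_le (min_le_left _ _)⟩

end Unif

section Loc

lemma preconn_frontier {X : Type*} [TopologicalSpace X] {s Ω : Set X} (hs : IsPreconnected s)
    (h1 : ∃ x ∈ s, x ∈ Ω) (h2 : ∃ x ∈ s, x ∉ Ω) : ∃ q ∈ s, q ∈ frontier Ω := by
  by_contra hcon
  push Not at hcon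
  have hcov : s ⊆ interior Ω ∪ (closure Ω)ᶜ := by
    intro x hx
    by_cases hxi : x ∈ interior Ω
    · exact Or.inl hxi
    · right
      intro hxc
      exact hcon x hx ⟨hxc, hxi⟩
  obtain ⟨a, ha, haΩ⟩ := h1
  obtain ⟨b, hb, hbΩ⟩ := h2
  have hA : (s ∩ interior Ω).Nonempty := by
    refine ⟨a, ha, ?_⟩
    rcases hcov ha with h | h
    · exact h
    · exact absurd (subset_closure haΩ) h
  have hB : (s ∩ (closure Ω)ᶜ).Nonempty := by
    refine ⟨b, hb, ?_⟩
    rcases hcov hb with h | h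
    · exact absurd (interior_subset h) hbΩ
    · exact h
  obtain ⟨x, _, hx1, hx2⟩ := hs _ _ isOpen_interior isClosed_closure.isOpen_compl hcov hA hB
  exact hx2 (subset_closure (interior_subset hx1))

variable {E : Type*} [NormedAddCommGroup E] [InnerProductSpace ℂ E] [NormedSpace ℝ E] [IsScalarTower ℝ ℂ E]

open scoped ContDiff

/-- Local defining function near the boundary. -/
structure LocDef (Ω : Set E) (ψ : E → ℝ) : Prop where
  op : IsOpen Ω
  cpt : IsCompact (closure Ω)
  cd : ∀ p ∈ frontier Ω, ∀ᶠ x in nhds p, ContDiffAt ℝ ∞ ψ x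
  mem : ∀ p ∈ frontier Ω, ∀ᶠ x in nhds p, (x ∈ Ω ↔ ψ x < 0)
  zero : ∀ p ∈ frontier Ω, ψ p = 0
  grad : ∀ p ∈ frontier Ω, fderiv ℝ ψ p ≠ 0

lemma LocDef.fcpt {Ω : Set E} {ψ : E → ℝ} (h : LocDef Ω ψ) : IsCompact (frontier Ω) :=
  h.cpt.of_isClosed_subset isClosed_frontier frontier_subset_closure

/-- vector dual to a real functional, complex version -/
lemma dual_vec {f : E →L[ℝ] ℝ} {C : ℝ} (hC : 0 < C) (hf : 1 ≤ C * ‖f‖) :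
    ∃ v : E, ‖v‖ ≤ 2 * C ∧ ∀ μ : ℂ, f (μ • v) = μ.re := by
  have hf0 : 0 < ‖f‖ := by
    by_contra h
    have : ‖f‖ = 0 := le_antisymm (not_lt.1 h) (norm_nonneg _)
    rw [this] at hf; linarith
  obtain ⟨x, hx⟩ : ∃ x, (‖f‖ / 2) * ‖x‖ < ‖f x‖ := by
    by_contra hcon
    push Not at hcon
    have := f.opNorm_le_bound (by positivity) hcon
    linarith
  set a : ℂ := (f x : ℂ) - I * (f (I • x) : ℂ) with ha
  have hre : ∀ μ : ℂ, f (μ • x) = (μ * a).re := by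
    intro μ
    rw [smul_decomp μ x]
    simp [ha]
  have hxa : ‖f x‖ ≤ ‖a‖ := by
    have : f x = a.re := by simp [ha]
    rw [this]; exact Complex.abs_re_le_norm a
  have ha0 : 0 < ‖a‖ := lt_of_le_of_lt (by positivity) (hx.trans_le hxa)
  refine ⟨a⁻¹ • x, ?_, ?_⟩
  · rw [norm_smul, norm_inv, inv_mul_le_iff₀ ha0]
    have h1 : ‖f‖ / 2 * ‖x‖ ≤ ‖a‖ := (hx.trans_le hxa).le
    nlinarith [norm_nonneg x]
  · intro μ
    rw [smul_smul, hre, mul_assoc, inv_mul_cancel₀ (norm_pos_iff.1 ha0), mul_one]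

lemma ev_bound {G : Type*} [NormedAddCommGroup G] {X : Type*} [TopologicalSpace X] {f : X → G} {p : X}
    (h : ContinuousAt f p) : ∀ᶠ x in nhds p, ‖f x‖ ≤ ‖f p‖ + 1 := by
  have := h.norm.eventually (Iio_mem_nhds (lt_add_one ‖f p‖))
  filter_upwards [this] with x hx using le_of_lt hx

lemma LocDef.near {Ω : Set E} {ψ : E → ℝ} (h : LocDef Ω ψ) {p : E} (hp : p ∈ frontier Ω) :
    ∃ C, ∀ᶠ x in nhds p, ∃ q ∈ frontier Ω, ‖x - q‖ ≤ C * |ψ x| := by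
  have hg := norm_pos_iff.2 (h.grad p hp)
  obtain ⟨v, hv, hv2⟩ := dual_vec (f := fderiv ℝ ψ p) (C := ‖fderiv ℝ ψ p‖⁻¹) (by positivity)
    (by rw [inv_mul_cancel₀ hg.ne'])
  have hv1 : fderiv ℝ ψ p v = 1 := by simpa using hv2 1
  have hvn : 0 < ‖v‖ := by
    rw [norm_pos_iff]; intro h0; rw [h0] at hv1; simp at hv1
  have hcd := (h.cd p hp).self_of_nhds
  have hst : HasStrictFDerivAt ψ (fderiv ℝ ψ p) p := hcd.hasStrictFDerivAt (by simp)
  have hlo := hst.isLittleO.def (c := 1 / (2 * ‖v‖)) (by positivity)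
  rw [nhds_prod_eq] at hlo
  have hmem := h.mem p hp
  obtain ⟨δ, hδ, hball⟩ : ∃ δ > 0, (∀ x ∈ ball p δ, (x ∈ Ω ↔ ψ x < 0)) ∧
      (∀ x ∈ ball p δ, ∀ y ∈ ball p δ, ‖ψ x - ψ y - fderiv ℝ ψ p (x - y)‖ ≤ 1 / (2 * ‖v‖) * ‖x - y‖) := by
    obtain ⟨A, hA, hA2⟩ := (Filter.eventually_prod_self_iff (r := fun a b => ‖ψ a - ψ b - (fderiv ℝ ψ p) (a - b)‖ ≤ 1 / (2 * ‖v‖) * ‖a - b‖)).1 hlo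
    obtain ⟨δ1, hδ1, h1⟩ := Metric.mem_nhds_iff.1 hA
    obtain ⟨δ2, hδ2, h2⟩ := Metric.eventually_nhds_iff_ball.1 hmem
    refine ⟨min δ1 δ2, by positivity, fun x hx => h2 x (ball_subset_ball (min_le_right _ _) hx), fun x hx y hy => ?_⟩
    exact hA2 x (h1 (ball_subset_ball (min_le_left _ _) hx)) y (h1 (ball_subset_ball (min_le_left _ _) hy))
  have hmove : ∀ x ∈ ball p δ, ∀ t : ℝ, x + t • v ∈ ball p δ → |ψ (x + t • v) - ψ x - t| ≤ |t| / 2 := by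
    intro x hx t hxt
    have := hball.2 _ hxt x hx
    rw [add_sub_cancel_left, map_smul, hv1, norm_smul, smul_eq_mul, mul_one] at this
    refine this.trans (le_of_eq ?_)
    rw [Real.norm_eq_abs]; field_simp
  refine ⟨4 * ‖v‖, ?_⟩
  have hψc : ContinuousAt ψ p := hcd.continuousAt
  have hsmall : ∀ᶠ x in nhds p, 4 * |ψ x| * ‖v‖ < δ / 2 := by
    have h1 : ContinuousAt (fun x => 4 * |ψ x| * ‖v‖) p := (continuousAt_const.mul hψc.abs).mul continuousAt_const
    refine h1.eventually (Iio_mem_nhds ?_)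
    simp [h.zero p hp]; positivity
  filter_upwards [hsmall, ball_mem_nhds p (half_pos hδ)] with x hx hxb
  have hxδ : x ∈ ball p δ := ball_subset_ball (by linarith) hxb
  have hin : ∀ t : ℝ, |t| ≤ 4 * |ψ x| → x + t • v ∈ ball p δ := by
    intro t ht
    rw [mem_ball, dist_eq_norm] at hxb ⊢
    calc ‖x + t • v - p‖ = ‖(x - p) + t • v‖ := by congr 1; abel
      _ ≤ ‖x - p‖ + ‖t • v‖ := norm_add_le _ _
      _ = ‖x - p‖ + |t| * ‖v‖ := by rw [norm_smul, Real.norm_eq_abs]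
      _ ≤ ‖x - p‖ + 4 * |ψ x| * ‖v‖ := by gcongr
      _ < δ := by linarith
  have hseg : ∀ t : ℝ, |t| ≤ 4 * |ψ x| → ∀ q ∈ segment ℝ x (x + t • v), ‖x - q‖ ≤ 4 * ‖v‖ * |ψ x| := by
    intro t ht q hq
    have := norm_sub_le_of_mem_segment hq
    rw [add_sub_cancel_left, norm_smul, Real.norm_eq_abs] at this
    rw [norm_sub_rev]
    calc _ ≤ _ := this
      _ ≤ 4 * |ψ x| * ‖v‖ := by gcongr
      _ = _ := by ring
  rcases lt_trichotomy (ψ x) 0 with hneg | hz | hpos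
  · have ht : |(2 * |ψ x|)| ≤ 4 * |ψ x| := by rw [abs_mul, abs_abs]; norm_num; linarith [abs_nonneg (ψ x)]
    have h1 := hmove x hxδ _ (hin _ ht)
    have hy : ¬ (x + (2 * |ψ x|) • v ∈ Ω) := by
      rw [hball.1 _ (hin _ ht)]
      rw [abs_le] at h1
      have h3 : |(2 * |ψ x|)| = 2 * |ψ x| := abs_of_nonneg (by positivity)
      rw [h3] at h1
      have : |ψ x| = - ψ x := abs_of_neg hneg
      linarith [h1.1]
    obtain ⟨q, hq1, hq2⟩ := preconn_frontier (Ω := Ω) (convex_segment x (x + (2 * |ψ x|) • v)).isPreconnected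
      ⟨x, left_mem_segment _ _ _, (hball.1 x hxδ).2 hneg⟩ ⟨_, right_mem_segment _ _ _, hy⟩
    exact ⟨q, hq2, hseg _ ht q hq1⟩
  · refine ⟨x, ?_, by simp [hz]⟩
    rw [frontier_eq_closure_inter_closure]
    refine ⟨?_, subset_closure (fun hx' => ?_)⟩
    · have hT : Filter.Tendsto (fun t : ℝ => x + (-t) • v) (nhdsWithin 0 (Set.Ioi 0)) (nhds x) := by
        have : Continuous (fun t : ℝ => x + (-t) • v) := by fun_prop
        have h2 := this.tendsto 0
        simp only [neg_zero, zero_smul, add_zero] at h2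
        exact h2.mono_left nhdsWithin_le_nhds
      refine mem_closure_of_tendsto hT ?_
      filter_upwards [hT.eventually (isOpen_ball.mem_nhds hxδ), self_mem_nhdsWithin] with t ht1 ht2
      rw [hball.1 _ ht1]
      have h1 := hmove x hxδ _ ht1
      rw [abs_le, abs_neg, abs_of_pos ht2] at h1
      have : (0:ℝ) < t := ht2
      linarith [h1.2]
    · have := (hball.1 x hxδ).1 hx'
      linarith
  · have ht : |(-(4 * |ψ x|))| ≤ 4 * |ψ x| := by rw [abs_neg, abs_mul, abs_abs]; norm_num
    have h1 := hmove x hxδ _ (hin _ ht)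
    have hy : (x + (-(4 * |ψ x|)) • v ∈ Ω) := by
      rw [hball.1 _ (hin _ ht)]
      rw [abs_le] at h1
      have h3 : |(-(4 * |ψ x|))| = 4 * |ψ x| := by rw [abs_neg]; exact abs_of_nonneg (by positivity)
      rw [h3] at h1
      have : |ψ x| = ψ x := abs_of_pos hpos
      linarith [h1.2]
    obtain ⟨q, hq1, hq2⟩ := preconn_frontier (Ω := Ω) (convex_segment x (x + (-(4 * |ψ x|)) • v)).isPreconnected
      ⟨_, right_mem_segment _ _ _, hy⟩ ⟨x, left_mem_segment _ _ _, fun hx' => by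
        have := (hball.1 x hxδ).1 hx'
        linarith⟩
    exact ⟨q, hq2, hseg _ ht q hq1⟩

end Loc


section Hor
variable {E : Type*} [NormedAddCommGroup E] [InnerProductSpace ℂ E] [NormedSpace ℝ E] [IsScalarTower ℝ ℂ E]

open scoped ContDiff

/-- squared modulus of the complex gradient pairing -/
def Qf (u : E → ℝ) (x ξ : E) : ℝ := (fderiv ℝ u x ξ) ^ 2 + (fderiv ℝ u x (I • ξ)) ^ 2

lemma Qf_nonneg (u : E → ℝ) (x ξ : E) : 0 ≤ Qf u x ξ := by unfold Qf; positivity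

lemma Qf_smul (u : E → ℝ) (x ξ : E) (c : ℝ) : Qf u x (c • ξ) = c ^ 2 * Qf u x ξ := by
  unfold Qf
  rw [I_smul_real, map_smul, map_smul, smul_eq_mul, smul_eq_mul]; ring

lemma Lv_smul (u : E → ℝ) (x ξ : E) (c : ℝ) : Lv u x (c • ξ) = c ^ 2 * Lv u x ξ := by
  unfold Lv
  rw [I_smul_real]
  simp only [map_smul, smul_eq_mul, _root_.smul_apply]; ring

lemma hor_mono {C C' L q : ℝ} {m : ℝ} (hC : 0 < C) (hCC : C ≤ C') (hq : 0 ≤ q) (hm : 0 ≤ m) (h : m ≤ C * (L + C * q)) :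
    m ≤ C' * (L + C' * q) := by
  have h1 : 0 ≤ L + C * q := by
    by_contra hcon
    push Not at hcon
    nlinarith
  have h2 : L + C * q ≤ L + C' * q := by nlinarith
  calc m ≤ C * (L + C * q) := h
    _ ≤ C' * (L + C' * q) := mul_le_mul hCC h2 h1 (hC.le.trans hCC)

lemma D2_cont {u : E → ℝ} {p : E} (h : ContDiffAt ℝ ∞ u p) : ContinuousAt (D2 u) p := by
  have h1 : ContDiffAt ℝ 1 (fderiv ℝ u) p := h.fderiv_right (by norm_cast)
  have h2 : ContDiffAt ℝ 0 (fderiv ℝ (fderiv ℝ u)) p := h1.fderiv_right (by norm_cast)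
  exact h2.continuousAt

lemma D1_cont {u : E → ℝ} {p : E} (h : ContDiffAt ℝ ∞ u p) : ContinuousAt (fderiv ℝ u) p := by
  have h1 : ContDiffAt ℝ 1 (fderiv ℝ u) p := h.fderiv_right (by norm_cast)
  exact h1.continuousAt

lemma Lv_contAt {u : E → ℝ} {p ξ : E} (h : ContDiffAt ℝ ∞ u p) :
    ContinuousAt (fun y : E × E => Lv u y.1 y.2) (p, ξ) := by
  unfold Lv
  have h1 : ContinuousAt (fun y : E × E => D2 u y.1) (p, ξ) :=
    ContinuousAt.comp (f := Prod.fst) (g := D2 u) (D2_cont h) continuousAt_fst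
  have h2 : ContinuousAt (fun y : E × E => y.2) (p, ξ) := continuousAt_snd
  exact ((h1.clm_apply h2).clm_apply h2).add ((h1.clm_apply (h2.const_smul I)).clm_apply (h2.const_smul I))

lemma Qf_contAt {u : E → ℝ} {p ξ : E} (h : ContDiffAt ℝ ∞ u p) :
    ContinuousAt (fun y : E × E => Qf u y.1 y.2) (p, ξ) := by
  unfold Qf
  have h1 : ContinuousAt (fun y : E × E => fderiv ℝ u y.1) (p, ξ) :=
    ContinuousAt.comp (f := Prod.fst) (g := fderiv ℝ u) (D1_cont h) continuousAt_fst
  have h2 : ContinuousAt (fun y : E × E => y.2) (p, ξ) := continuousAt_snd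
  exact ((h1.clm_apply h2).pow 2).add ((h1.clm_apply (h2.const_smul I)).pow 2)

lemma hor_local [FiniteDimensional ℂ E] {u : E → ℝ} {p : E} (h : ContDiffAt ℝ ∞ u p)
    (hlev : ∀ ξ : E, ξ ≠ 0 → fderiv ℝ u p ξ = 0 → fderiv ℝ u p (I • ξ) = 0 → 0 < Lv u p ξ) :
    ∃ C, 0 < C ∧ ∀ᶠ x in nhds p, ∀ ξ : E, ‖ξ‖ ^ 2 ≤ C * (Lv u x ξ + C * Qf u x ξ) := by
  have : ProperSpace E := FiniteDimensional.proper ℂ E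
  have hK : IsCompact (({p} : Set E) ×ˢ sphere (0:E) 1) := isCompact_singleton.prod (isCompact_sphere 0 1)
  obtain ⟨C, s, hC, hs, _, hQ⟩ := unif hK (Q := fun C y => 0 < C ∧ 1 ≤ C * (Lv u y.1 y.2 + C * Qf u y.1 y.2))
    (fun C C' x hCC hx => ⟨hx.1.trans_le hCC, hor_mono hx.1 hCC (Qf_nonneg _ _ _) zero_le_one hx.2⟩) (by
    rintro ⟨p', ξ⟩ ⟨hp', hξ⟩
    obtain rfl : p' = p := hp'
    have hξ1 : ‖ξ‖ = 1 := by simpa using hξ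
    have hξ0 : ξ ≠ 0 := by rintro rfl; simp at hξ1
    obtain ⟨C, hC0, hC⟩ : ∃ C, 0 < C ∧ 1 < C * (Lv u p' ξ + C * Qf u p' ξ) := by
      rcases (Qf_nonneg u p' ξ).eq_or_lt with h0 | h0
      · have hq : fderiv ℝ u p' ξ = 0 ∧ fderiv ℝ u p' (I • ξ) = 0 := by
          unfold Qf at h0
          constructor <;> nlinarith [sq_nonneg (fderiv ℝ u p' ξ), sq_nonneg (fderiv ℝ u p' (I • ξ))]
        have hL := hlev ξ hξ0 hq.1 hq.2
        refine ⟨2 / Lv u p' ξ, by positivity, ?_⟩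
        rw [← h0, mul_zero, add_zero, div_mul_cancel₀ _ hL.ne']; norm_num
      · set L := Lv u p' ξ
        set q := Qf u p' ξ
        have h1 : (|L| + 1) / q * q = |L| + 1 := div_mul_cancel₀ _ h0.ne'
        have h2 : 0 ≤ (|L| + 1) / q := by positivity
        refine ⟨(|L| + 1) / q + 2, by positivity, ?_⟩
        nlinarith [neg_abs_le L, mul_nonneg h2 h0.le]
    refine ⟨C, ?_⟩
    have hc : ContinuousAt (fun y : E × E => C * (Lv u y.1 y.2 + C * Qf u y.1 y.2)) (p', ξ) :=
      continuousAt_const.mul ((Lv_contAt h).add (continuousAt_const.mul (Qf_contAt h)))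
    filter_upwards [hc.eventually (Ioi_mem_nhds hC)] with y hy
    exact ⟨hC0, le_of_lt hy⟩)
  refine ⟨C, by linarith, ?_⟩
  filter_upwards [ball_mem_nhds p hs] with x hx ξ
  by_cases hξ : ξ = 0
  · subst hξ; simp [Lv, Qf]
  · have hn : 0 < ‖ξ‖ := norm_pos_iff.2 hξ
    have h1 := (hQ (p, (‖ξ‖)⁻¹ • ξ) ⟨rfl, by simp [norm_smul, hn.ne']⟩ (x, (‖ξ‖)⁻¹ • ξ) (by
      rw [← ball_prod_same]; exact ⟨hx, mem_ball_self hs⟩)).2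
    simp only [Lv_smul, Qf_smul] at h1
    have h2 : C * ((‖ξ‖)⁻¹ ^ 2 * Lv u x ξ + C * ((‖ξ‖)⁻¹ ^ 2 * Qf u x ξ)) * ‖ξ‖ ^ 2 = C * (Lv u x ξ + C * Qf u x ξ) := by
      field_simp
    rw [← h2]
    nlinarith [sq_nonneg ‖ξ‖]

lemma Lv_addsq {u : E → ℝ} {x : E} (hu : ContDiffAt ℝ 2 u x) (K : ℝ) (ξ : E) :
    Lv (fun y => u y + K * u y ^ 2) x ξ = (1 + 2 * K * u x) * Lv u x ξ + 2 * K * Qf u x ξ := by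
  rw [Lv_add hu (contDiffAt_const.mul (hu.pow 2)), Lv_const_mul _ (hu.pow 2), Lv_sq hu]
  unfold Qf; ring

lemma hor_alg {L q C a : ℝ} (hq : 0 ≤ q) (hC : 0 ≤ C) (ha : |a| ≤ 1 / 2) (h : 0 ≤ L + C * q) :
    (1/2) * (L + C * q) ≤ (1 + a) * L + 2 * C * q := by
  rw [abs_le] at ha
  have hCq : 0 ≤ C * q := mul_nonneg hC hq
  rcases le_total 0 L with hL | hL <;> nlinarith

/-- Replace a defining function by one which is strictly plurisubharmonic near the boundary. -/
lemma LocDef.strict [FiniteDimensional ℂ E] {Ω : Set E} {ρ : E → ℝ} (h : LocDef Ω ρ)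
    (hlev : ∀ p ∈ frontier Ω, ∀ ξ : E, ξ ≠ 0 → fderiv ℝ ρ p ξ = 0 → fderiv ℝ ρ p (I • ξ) = 0 → 0 < Lv ρ p ξ) :
    ∃ ψ : E → ℝ, LocDef Ω ψ ∧ ∀ p ∈ frontier Ω, ∃ C, 0 < C ∧ ∀ᶠ x in nhds p, ∀ ξ : E, ‖ξ‖ ^ 2 ≤ C * Lv ψ x ξ := by
  obtain ⟨C, s, hC, hs, _, hQ⟩ := unif h.fcpt (Q := fun C x => 0 < C ∧ ∀ ξ : E, ‖ξ‖ ^ 2 ≤ C * (Lv ρ x ξ + C * Qf ρ x ξ))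
    (fun C C' x hCC hx => ⟨hx.1.trans_le hCC, fun ξ => hor_mono hx.1 hCC (Qf_nonneg _ _ _) (by positivity) (hx.2 ξ)⟩)
    (fun p hp => by
      obtain ⟨C, hC, hev⟩ := hor_local (h.cd p hp).self_of_nhds (hlev p hp)
      exact ⟨C, hev.mono fun x hx => ⟨hC, hx⟩⟩)
  have hC0 : 0 < C := by linarith
  have hsm : ∀ p ∈ frontier Ω, ∀ᶠ x in nhds p, |2 * C * ρ x| ≤ 1 / 2 := by
    intro p hp
    have hc : ContinuousAt (fun x => |2 * C * ρ x|) p :=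
      (continuousAt_const.mul (h.cd p hp).self_of_nhds.continuousAt).abs
    have : |2 * C * ρ p| < 1 / 2 := by rw [h.zero p hp]; norm_num
    filter_upwards [hc.eventually (Iio_mem_nhds this)] with x hx using le_of_lt hx
  refine ⟨fun y => ρ y + C * ρ y ^ 2, ⟨h.op, h.cpt, ?_, ?_, ?_, ?_⟩, ?_⟩
  · intro p hp
    filter_upwards [h.cd p hp] with x hx
    exact hx.add (contDiffAt_const.mul (hx.pow 2))
  · intro p hp
    filter_upwards [h.mem p hp, hsm p hp] with x hx hx2
    rw [hx]
    rw [abs_le] at hx2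
    have : ρ x + C * ρ x ^ 2 = ρ x * (1 + C * ρ x) := by ring
    rw [this]
    constructor
    · intro h0; exact mul_neg_of_neg_of_pos h0 (by linarith)
    · intro h0
      by_contra hcon
      push Not at hcon
      have : 0 ≤ ρ x * (1 + C * ρ x) := mul_nonneg hcon (by linarith)
      linarith
  · intro p hp; simp [h.zero p hp]
  · intro p hp
    have hd : DifferentiableAt ℝ ρ p := (h.cd p hp).self_of_nhds.differentiableAt (by simp)
    have h1 : HasFDerivAt (fun y => ρ y + C * ρ y ^ 2) (fderiv ℝ ρ p + C • ((2 * ρ p ^ 1) • fderiv ℝ ρ p)) p := by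
      have := hd.hasFDerivAt.add ((hd.hasFDerivAt.pow 2).const_mul C)
      exact this.congr_fderiv (by ext v; simp)
    rw [h1.fderiv, h.zero p hp]
    simpa using h.grad p hp
  · intro p hp
    refine ⟨2 * C, by positivity, ?_⟩
    filter_upwards [h.cd p hp, hsm p hp, ball_mem_nhds p hs] with x hx hx2 hxs ξ
    rw [Lv_addsq (hx.of_le (by norm_cast))]
    have h1 := (hQ p hp x hxs).2 ξ
    have h2 : 0 ≤ Lv ρ x ξ + C * Qf ρ x ξ := by
      by_contra hcon
      push Not at hcon
      nlinarith [sq_nonneg ‖ξ‖]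
    have h3 := hor_alg (Qf_nonneg ρ x ξ) hC0.le hx2 h2
    nlinarith

end Hor


section Lip
variable {E : Type*} [NormedAddCommGroup E] [NormedSpace ℝ E]
variable {G : Type*} [NormedAddCommGroup G] [NormedSpace ℝ G]

lemma loc_lip {g : E → G} {p : E} (h : ContDiffAt ℝ 1 g p) :
    ∃ K δ, 0 ≤ K ∧ 0 < δ ∧ ∀ x ∈ ball p δ, ∀ y ∈ ball p δ, ‖g y - g x‖ ≤ K * ‖y - x‖ := by
  obtain ⟨K, t, ht, hK⟩ := h.exists_lipschitzOnWith
  obtain ⟨δ, hδ, hb⟩ := Metric.mem_nhds_iff.1 ht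
  refine ⟨K, δ, K.2, hδ, fun x hx y hy => ?_⟩
  have := hK.dist_le_mul y (hb hy) x (hb hx)
  rwa [dist_eq_norm, dist_eq_norm] at this

lemma loc_taylor {g : E → G} {p : E} (h : ContDiffAt ℝ 2 g p) :
    ∃ K δ, 0 ≤ K ∧ 0 < δ ∧ ∀ x ∈ ball p δ, ∃ L : E →L[ℝ] G, ∀ y ∈ ball p δ, ‖g y - g x - L (y - x)‖ ≤ K * ‖y - x‖ ^ 2 := by
  obtain ⟨K, δ, hK, hδ, hlip⟩ := loc_lip (h.fderiv_right (m := 1) (by norm_num))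
  obtain ⟨δ2, hδ2, h2⟩ := Metric.eventually_nhds_iff_ball.1 (cda_ev_diff h)
  refine ⟨K, min δ δ2, hK, by positivity, fun x hx => ⟨fderiv ℝ g x, fun y hy => ?_⟩⟩
  exact taylor2L (convex_ball p (min δ δ2)) hK (fun u hu => h2 u (ball_subset_ball (min_le_right _ _) hu)) hx hy
    (fun u hu => hlip x (ball_subset_ball (min_le_left _ _) hx) u (ball_subset_ball (min_le_left _ _) hu))

end Lip

section Transfer
variable {E : Type*} [NormedAddCommGroup E] [InnerProductSpace ℂ E] [NormedSpace ℝ E] [IsScalarTower ℝ ℂ E]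

open scoped ContDiff

lemma D2_cd {u : E → ℝ} {p : E} (h : ContDiffAt ℝ ∞ u p) : ContDiffAt ℝ 2 (D2 u) p := by
  have h1 : ContDiffAt ℝ 3 (fderiv ℝ u) p := h.fderiv_right (by norm_cast)
  exact h1.fderiv_right (by norm_num)

lemma curve_exp {u : E → ℝ} {p w ν : E} {σ : ℝ} (h : ContDiffAt ℝ ∞ u p) (h0 : u p = 0)
    (hw : fderiv ℝ u p w = 0) {ε : ℝ} (hε : 0 < ε) :
    ∀ᶠ t : ℝ in nhdsWithin 0 (Set.Ioi 0),
      |u (p + t • (w + (σ * t) • ν)) - t ^ 2 * (σ * fderiv ℝ u p ν + (1/2) * D2 u p w w)| ≤ ε * t ^ 2 := by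
  obtain ⟨K, δ, hK, hδ, hlip⟩ := loc_lip ((D2_cd h).of_le (m := 1) (by norm_num))
  obtain ⟨δ2, hδ2, hcd⟩ := Metric.eventually_nhds_iff_ball.1
    ((h.of_le (m := 3) (by norm_cast)).eventually (by simp))
  set B : ℝ → ℝ := fun t => |(1/2) * D2 u p (w + (σ * t) • ν) (w + (σ * t) • ν) - (1/2) * D2 u p w w|
    + K * (|t| * ‖w + (σ * t) • ν‖ ^ 3) with hB
  have hBc : ContinuousAt B 0 := by
    apply Continuous.continuousAt
    rw [hB]; fun_prop
  have hB0 : B 0 < ε := by simp [hB, hε]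
  have hxc : ContinuousAt (fun t : ℝ => p + t • (w + (σ * t) • ν)) 0 := by
    apply Continuous.continuousAt; fun_prop
  have hx0 : ∀ᶠ t : ℝ in nhds 0, p + t • (w + (σ * t) • ν) ∈ ball p (min δ δ2) :=
    hxc.eventually (by simp only [zero_smul, add_zero]; exact ball_mem_nhds p (lt_min hδ hδ2))
  filter_upwards [nhdsWithin_le_nhds hx0, nhdsWithin_le_nhds (hBc.eventually (Iio_mem_nhds hB0)), self_mem_nhdsWithin] with t ht hBt htp
  have htp : 0 < t := htp
  have hsub1 : ball p (min δ δ2) ⊆ ball p δ := ball_subset_ball (min_le_left _ _)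
  have hsub2 : ball p (min δ δ2) ⊆ ball p δ2 := ball_subset_ball (min_le_right _ _)
  have hp : p ∈ ball p (min δ δ2) := mem_ball_self (lt_min hδ hδ2)
  have hT := taylor3 (convex_ball p (min δ δ2)) hK (fun x hx => hcd x (hsub2 hx)) hp ht
    (fun x hx => hlip p (hsub1 hp) x (hsub1 hx))
  set y := w + (σ * t) • ν with hy
  rw [add_sub_cancel_left, h0, norm_smul, mul_pow, map_smul, map_smul, map_smul, _root_.smul_apply, smul_eq_mul, smul_eq_mul, smul_eq_mul,
    Real.norm_eq_abs, Real.norm_eq_abs] at hT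
  have hdy : fderiv ℝ u p y = σ * t * fderiv ℝ u p ν := by
    rw [hy, map_add, hw, map_smul, smul_eq_mul, zero_add]
  rw [hdy] at hT
  have hB' : B t < ε := hBt
  simp only [hB] at hB'
  rw [← hy] at hB'
  rw [abs_of_pos htp] at hT hB'
  calc _ = |(u (p + t • y) - 0 - t * (σ * t * (fderiv ℝ u p) ν) - 1 / 2 * (t * (t * (D2 u p y) y)))
        + t ^ 2 * ((1/2) * D2 u p y y - (1/2) * D2 u p w w)| := by congr 1; ring
    _ ≤ K * (t ^ 3 * ‖y‖ ^ 3) + t ^ 2 * |(1/2) * D2 u p y y - (1/2) * D2 u p w w| := by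
        refine (abs_add_le _ _).trans (add_le_add hT (le_of_eq ?_))
        rw [abs_mul, abs_of_nonneg (sq_nonneg t)]
    _ = t ^ 2 * (|(1/2) * D2 u p y y - (1/2) * D2 u p w w| + K * (t * ‖y‖ ^ 3)) := by ring
    _ ≤ t ^ 2 * ε := by gcongr
    _ = _ := by ring

lemma dir_exp {u : E → ℝ} {p w : E} (h : DifferentiableAt ℝ u p) (h0 : u p = 0) {ε : ℝ} (hε : 0 < ε) :
    ∀ᶠ t : ℝ in nhdsWithin 0 (Set.Ioi 0), |u (p + t • w) - t * fderiv ℝ u p w| ≤ ε * t := by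
  have h1 : HasDerivAt (fun t : ℝ => u (p + t • w)) (fderiv ℝ u p w) 0 := by
    have h2 : HasDerivAt (fun t : ℝ => p + t • w) w 0 := by
      simpa using ((hasDerivAt_id (0:ℝ)).smul_const w).const_add p
    have h3 : HasFDerivAt u (fderiv ℝ u p) (p + (0:ℝ) • w) := by simpa using h.hasFDerivAt
    exact h3.comp_hasDerivAt 0 h2
  have h2 := (hasDerivAt_iff_isLittleO.1 h1).def hε
  filter_upwards [nhdsWithin_le_nhds h2, self_mem_nhdsWithin] with t ht htp
  have htp : 0 < t := htp
  simpa [h0, abs_of_pos htp] using ht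

lemma tendsto_dir (p w : E) : Filter.Tendsto (fun t : ℝ => p + t • w) (nhdsWithin 0 (Set.Ioi 0)) (nhds p) := by
  have : Continuous (fun t : ℝ => p + t • w) := by fun_prop
  have h2 := this.tendsto 0
  simp only [zero_smul, add_zero] at h2
  exact h2.mono_left nhdsWithin_le_nhds

lemma levi_transfer {u v : E → ℝ} {p : E} (hu : ContDiffAt ℝ ∞ u p) (hv : ContDiffAt ℝ ∞ v p)
    (hu0 : u p = 0) (hv0 : v p = 0) (hdu : fderiv ℝ u p ≠ 0) (hdv : fderiv ℝ v p ≠ 0)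
    (hs : ∀ᶠ x in nhds p, (u x < 0 ↔ v x < 0))
    (hlev : ∀ ξ : E, ξ ≠ 0 → fderiv ℝ v p ξ = 0 → fderiv ℝ v p (I • ξ) = 0 → 0 < Lv v p ξ) :
    ∀ ξ : E, ξ ≠ 0 → fderiv ℝ u p ξ = 0 → fderiv ℝ u p (I • ξ) = 0 → 0 < Lv u p ξ := by
  have hud : DifferentiableAt ℝ u p := hu.differentiableAt (by simp)
  have hvd : DifferentiableAt ℝ v p := hv.differentiableAt (by simp)
  have stepA : ∀ w, fderiv ℝ v p w < 0 → fderiv ℝ u p w ≤ 0 := by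
    intro w hw
    by_contra hcon
    push Not at hcon
    have e1 := dir_exp (w := w) hvd hv0 (ε := - fderiv ℝ v p w / 2) (by linarith)
    have e2 := dir_exp (w := w) hud hu0 (ε := fderiv ℝ u p w / 2) (by linarith)
    obtain ⟨t, h1, h2, h3, h4⟩ := (e1.and (e2.and (((tendsto_dir p w).eventually hs).and self_mem_nhdsWithin))).exists
    have h4 : 0 < t := h4
    rw [abs_le] at h1 h2
    have h5 : v (p + t • w) < 0 := by nlinarith [h1.2]
    have h6 := h3.2 h5
    nlinarith [h2.1]
  obtain ⟨ν, -, hν⟩ := dual_vec (f := fderiv ℝ v p) (C := ‖fderiv ℝ v p‖⁻¹) (inv_pos.2 (norm_pos_iff.2 hdv))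
    (by rw [inv_mul_cancel₀ (norm_pos_iff.2 hdv).ne'])
  have hν1 : fderiv ℝ v p ν = 1 := by simpa using hν 1
  have stepB0 : ∀ w, fderiv ℝ v p w = 0 → fderiv ℝ u p w ≤ 0 := by
    intro w hw
    by_contra hcon
    push Not at hcon
    have h1 : ∀ ε : ℝ, 0 < ε → fderiv ℝ u p w ≤ ε * fderiv ℝ u p ν := by
      intro ε hε
      have := stepA (w - ε • ν) (by rw [map_sub, map_smul, hw, hν1]; simp; exact hε)
      rw [map_sub, map_smul, smul_eq_mul] at this
      linarith
    have h2 := h1 (fderiv ℝ u p w / (2 * (|fderiv ℝ u p ν| + 1))) (by positivity)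
    have h3 : fderiv ℝ u p w / (2 * (|fderiv ℝ u p ν| + 1)) * fderiv ℝ u p ν ≤ fderiv ℝ u p w / (2 * (|fderiv ℝ u p ν| + 1)) * (|fderiv ℝ u p ν| + 1) := by
      gcongr
      linarith [le_abs_self (fderiv ℝ u p ν)]
    have h4 : fderiv ℝ u p w / (2 * (|fderiv ℝ u p ν| + 1)) * (|fderiv ℝ u p ν| + 1) = fderiv ℝ u p w / 2 := by
      field_simp
    linarith
  have stepB1 : ∀ w, fderiv ℝ v p w = 0 → fderiv ℝ u p w = 0 := by
    intro w hw
    refine le_antisymm (stepB0 w hw) ?_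
    have := stepB0 (-w) (by rw [map_neg, hw, neg_zero])
    rw [map_neg] at this; linarith
  set c := fderiv ℝ u p ν with hc
  have stepB : ∀ w, fderiv ℝ u p w = c * fderiv ℝ v p w := by
    intro w
    have := stepB1 (w - (fderiv ℝ v p w) • ν) (by rw [map_sub, map_smul, hν1]; simp)
    rw [map_sub, map_smul, smul_eq_mul] at this
    linarith
  have hc0 : 0 < c := by
    have h1 : 0 ≤ c := by
      have := stepA (-ν) (by rw [map_neg, hν1]; norm_num)
      rw [map_neg] at this; linarith
    refine lt_of_le_of_ne h1 (fun h => hdu ?_)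
    ext w
    rw [stepB w, ← h]; simp
  have stepC : ∀ w, fderiv ℝ v p w = 0 → c * D2 v p w w ≤ D2 u p w w := by
    intro w hw
    by_contra hcon
    push Not at hcon
    set a := D2 u p w w with ha
    set b := D2 v p w w with hb
    -- choose the bending parameter
    set g := (c * b - a) / 8 with hg
    have hg0 : 0 < g := by rw [hg]; linarith
    set σ := - b / 2 + 2 * g / c with hσ
    have e1 := curve_exp (w := w) (ν := ν) (σ := σ) hv hv0 hw (ε := g / c) (by positivity)
    have e2 := curve_exp (w := w) (ν := ν) (σ := σ) hu hu0 (stepB1 w hw) (ε := g) hg0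
    have ht : Filter.Tendsto (fun t : ℝ => p + t • (w + (σ * t) • ν)) (nhdsWithin 0 (Set.Ioi 0)) (nhds p) := by
      have : Continuous (fun t : ℝ => p + t • (w + (σ * t) • ν)) := by fun_prop
      have h2 := this.tendsto 0
      simp only [zero_smul, add_zero] at h2
      exact h2.mono_left nhdsWithin_le_nhds
    obtain ⟨t, h1, h2, h3, h4⟩ := (e1.and (e2.and ((ht.eventually hs).and self_mem_nhdsWithin))).exists
    have h4 : 0 < t := h4
    rw [abs_le] at h1 h2
    rw [hν1, ← hb] at h1
    rw [← hc, ← ha] at h2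
    have k1 : σ * 1 + 1 / 2 * b = 2 * (g / c) := by rw [hσ]; ring
    have k2 : σ * c + 1 / 2 * a = - 2 * g := by rw [hσ, hg]; field_simp; ring
    rw [k1] at h1
    rw [k2] at h2
    have ht2 : 0 < t ^ 2 := by positivity
    have hgc : 0 < g / c := by positivity
    have h5 : ¬ (v (p + t • (w + (σ * t) • ν)) < 0) := by
      have : 0 < t ^ 2 * (g / c) := by positivity
      linarith [h1.1]
    have h6 : u (p + t • (w + (σ * t) • ν)) < 0 := by
      have : 0 < t ^ 2 * g := by positivity
      linarith [h2.2]
    exact h5 (h3.1 h6)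
  intro ξ hξ h1 h2
  have h1' : fderiv ℝ v p ξ = 0 := by
    have := stepB ξ; rw [h1] at this
    rcases mul_eq_zero.1 this.symm with h | h
    · exact absurd h hc0.ne'
    · exact h
  have h2' : fderiv ℝ v p (I • ξ) = 0 := by
    have := stepB (I • ξ); rw [h2] at this
    rcases mul_eq_zero.1 this.symm with h | h
    · exact absurd h hc0.ne'
    · exact h
  have h3 := hlev ξ hξ h1' h2'
  have h4 := stepC ξ h1'
  have h5 := stepC (I • ξ) h2'
  unfold Lv at h3 ⊢
  nlinarith

end Transfer


section Consts
variable {E : Type*} [NormedAddCommGroup E] [InnerProductSpace ℂ E] [NormedSpace ℝ E] [IsScalarTower ℝ ℂ E]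

open scoped ContDiff

/-- monotonicity in the constant -/
def Mo (P : ℝ → E → Prop) : Prop := ∀ C C' x, 0 < C → C ≤ C' → P C x → P C' x

/-- the property holds near `p` with some constant -/
def EvC (p : E) (P : ℝ → E → Prop) : Prop := ∃ C, 0 < C ∧ ∀ᶠ x in nhds p, P C x

lemma EvC.and {p : E} {P Q : ℝ → E → Prop} (hP : Mo P) (hQ : Mo Q) (h1 : EvC p P) (h2 : EvC p Q) :
    EvC p (fun C x => P C x ∧ Q C x) := by
  obtain ⟨C, hC, h1⟩ := h1
  obtain ⟨C', hC', h2⟩ := h2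
  refine ⟨max C C', lt_max_of_lt_left hC, ?_⟩
  filter_upwards [h1, h2] with x hx1 hx2
  exact ⟨hP _ _ x hC (le_max_left _ _) hx1, hQ _ _ x hC' (le_max_right _ _) hx2⟩

lemma Mo.and {P Q : ℝ → E → Prop} (hP : Mo P) (hQ : Mo Q) : Mo (fun C x => P C x ∧ Q C x) :=
  fun C C' x h0 h h1 => ⟨hP C C' x h0 h h1.1, hQ C C' x h0 h h1.2⟩

lemma ball_inv_mono {C C' : ℝ} {x : E} (h0 : 0 < C) (h : C ≤ C') : ball x (1 / C') ⊆ ball x (1 / C) :=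
  ball_subset_ball (one_div_le_one_div_of_le h0 h)

/-- pointwise facts about a strictly psh defining function -/
structure DP (Ω : Set E) (ψ : E → ℝ) (C : ℝ) (x : E) : Prop where
  cd : ContDiffAt ℝ ∞ ψ x
  mem : x ∈ Ω ↔ ψ x < 0
  d1 : ‖fderiv ℝ ψ x‖ ≤ C
  d2 : ‖D2 ψ x‖ ≤ C
  gr : 1 ≤ C * ‖fderiv ℝ ψ x‖
  lv : ∀ ξ : E, ‖ξ‖ ^ 2 ≤ C * Lv ψ x ξ
  near : ∃ q ∈ frontier Ω, ‖x - q‖ ≤ C * |ψ x|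

lemma DP.mono {Ω : Set E} {ψ : E → ℝ} {C C' : ℝ} {x : E} (h : DP Ω ψ C x) (h0 : 0 < C) (hC : C ≤ C') : DP Ω ψ C' x where
  cd := h.cd
  mem := h.mem
  d1 := h.d1.trans hC
  d2 := h.d2.trans hC
  gr := h.gr.trans (by gcongr)
  lv := fun ξ => (h.lv ξ).trans (by
    have h1 : 0 ≤ Lv ψ x ξ := by
      by_contra hcon
      push Not at hcon
      nlinarith [h.lv ξ, sq_nonneg ‖ξ‖]
    gcongr)
  near := by
    obtain ⟨q, hq, h1⟩ := h.near
    exact ⟨q, hq, h1.trans (by gcongr)⟩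

lemma ev_d1 {u : E → ℝ} {p : E} (h : ContDiffAt ℝ ∞ u p) : ∀ᶠ x in nhds p, ‖fderiv ℝ u x‖ ≤ ‖fderiv ℝ u p‖ + 1 :=
  ev_bound (D1_cont h)

lemma ev_d2 {u : E → ℝ} {p : E} (h : ContDiffAt ℝ ∞ u p) : ∀ᶠ x in nhds p, ‖D2 u x‖ ≤ ‖D2 u p‖ + 1 :=
  ev_bound (G := E →L[ℝ] E →L[ℝ] ℝ) (f := D2 u) (D2_cont h)

lemma ev_gr {u : E → ℝ} {p : E} (h : ContDiffAt ℝ ∞ u p) (h0 : fderiv ℝ u p ≠ 0) :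
    ∀ᶠ x in nhds p, 1 ≤ (2 / ‖fderiv ℝ u p‖) * ‖fderiv ℝ u x‖ := by
  have hg := norm_pos_iff.2 h0
  have hc : ContinuousAt (fun x => (2 / ‖fderiv ℝ u p‖) * ‖fderiv ℝ u x‖) p :=
    continuousAt_const.mul (D1_cont h).norm
  have : (1:ℝ) < (2 / ‖fderiv ℝ u p‖) * ‖fderiv ℝ u p‖ := by rw [div_mul_cancel₀ _ hg.ne']; norm_num
  filter_upwards [hc.eventually (Ioi_mem_nhds this)] with x hx using le_of_lt hx

lemma DP_ev {Ω : Set E} {ψ : E → ℝ} (h : LocDef Ω ψ)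
    (hlv : ∀ p ∈ frontier Ω, ∃ C, 0 < C ∧ ∀ᶠ x in nhds p, ∀ ξ : E, ‖ξ‖ ^ 2 ≤ C * Lv ψ x ξ) {p : E} (hp : p ∈ frontier Ω) :
    EvC p (fun C x => DP Ω ψ C x) := by
  have hcd := (h.cd p hp).self_of_nhds
  obtain ⟨C1, hC1, hlv⟩ := hlv p hp
  obtain ⟨C2, hnear⟩ := h.near hp
  set C := C1 + |C2| + (‖fderiv ℝ ψ p‖ + 1) + (‖D2 ψ p‖ + 1) + 2 / ‖fderiv ℝ ψ p‖ with hC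
  have k1 : 0 ≤ ‖fderiv ℝ ψ p‖ := norm_nonneg _
  have k2 : 0 ≤ ‖D2 ψ p‖ := norm_nonneg (D2 ψ p)
  have k3 : 0 ≤ 2 / ‖fderiv ℝ ψ p‖ := by positivity
  have k4 := abs_nonneg C2
  have k5 := le_abs_self C2
  refine ⟨C, by linarith, ?_⟩
  filter_upwards [h.cd p hp, h.mem p hp, ev_d1 hcd, ev_d2 hcd, ev_gr hcd (h.grad p hp), hlv, hnear] with x a1 a2 a3 a4 a5 a6 a7
  refine ⟨a1, a2, by linarith, by linarith, a5.trans ?_, fun ξ => (a6 ξ).trans ?_, ?_⟩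
  · gcongr; linarith
  · have h1 : 0 ≤ Lv ψ x ξ := by
      by_contra hcon
      push Not at hcon
      nlinarith [a6 ξ, sq_nonneg ‖ξ‖]
    gcongr; linarith
  · obtain ⟨q, hq, h1⟩ := a7
    exact ⟨q, hq, h1.trans (by gcongr; linarith)⟩

/-- pointwise facts about the defining function of the target -/
structure TP (Ω : Set E) (ρ : E → ℝ) (C : ℝ) (w : E) : Prop where
  cd : ∀ x ∈ ball w (1 / C), ContDiffAt ℝ ∞ ρ x
  d1 : ∀ x ∈ ball w (1 / C), ‖fderiv ℝ ρ x‖ ≤ C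
  d2 : ∀ x ∈ ball w (1 / C), ‖D2 ρ x‖ ≤ C
  d3 : ∀ x ∈ ball w (1 / C), ‖D2 ρ x - D2 ρ w‖ ≤ C * ‖x - w‖
  d4 : ∃ L : E →L[ℝ] (E →L[ℝ] E →L[ℝ] ℝ), ∀ x ∈ ball w (1 / C), ‖D2 ρ x - D2 ρ w - L (x - w)‖ ≤ C * ‖x - w‖ ^ 2
  ex : ∃ e, ‖e‖ ≤ C ∧ fderiv ℝ ρ w e = 1
  hor : ∀ ξ : E, ‖ξ‖ ^ 2 ≤ C * (Lv ρ w ξ + C * Qf ρ w ξ)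
  bal : w ∈ Ω → ball w (- ρ w / C) ⊆ Ω
  eig : w ∈ Ω → ∃ e, ‖e‖ = 1 ∧ Lv ρ w e ≤ C * (- ρ w) ^ 4 ∧ ∀ η, |Bv ρ w e η| ≤ Lv ρ w e * ‖η‖

lemma TP.mono {Ω : Set E} {ρ : E → ℝ} {C C' : ℝ} {x : E} (hneg : ∀ w ∈ Ω, ρ w < 0) (h : TP Ω ρ C x) (h0 : 0 < C)
    (hC : C ≤ C') : TP Ω ρ C' x where
  cd := fun y hy => h.cd y (ball_inv_mono h0 hC hy)
  d1 := fun y hy => (h.d1 y (ball_inv_mono h0 hC hy)).trans hC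
  d2 := fun y hy => (h.d2 y (ball_inv_mono h0 hC hy)).trans hC
  d3 := fun y hy => (h.d3 y (ball_inv_mono h0 hC hy)).trans (by gcongr)
  d4 := by
    obtain ⟨L, hL⟩ := h.d4
    exact ⟨L, fun y hy => (hL y (ball_inv_mono h0 hC hy)).trans (by gcongr)⟩
  ex := by
    obtain ⟨e, h1, h2⟩ := h.ex
    exact ⟨e, h1.trans hC, h2⟩
  hor := fun ξ => hor_mono h0 hC (Qf_nonneg _ _ _) (by positivity) (h.hor ξ)
  bal := fun hw => (ball_subset_ball (by
    have := hneg x hw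
    gcongr; linarith)).trans (h.bal hw)
  eig := fun hw => by
    obtain ⟨e, h1, h2, h3⟩ := h.eig hw
    have := hneg x hw
    exact ⟨e, h1, h2.trans (by
      have : 0 ≤ (- ρ x) ^ 4 := by positivity
      gcongr), h3⟩

lemma TP_ev [FiniteDimensional ℂ E] {Ω : Set E} {ρ : E → ℝ} (h : LocDef Ω ρ) (hneg : ∀ w ∈ Ω, ρ w < 0)
    (hlev : ∀ p ∈ frontier Ω, ∀ ξ : E, ξ ≠ 0 → fderiv ℝ ρ p ξ = 0 → fderiv ℝ ρ p (I • ξ) = 0 → 0 < Lv ρ p ξ)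
    {p : E} (hp : p ∈ frontier Ω)
    (heig : ∃ C, ∀ᶠ w in nhds p, w ∈ Ω → ∃ e, ‖e‖ = 1 ∧ Lv ρ w e ≤ C * (- ρ w) ^ 4 ∧ ∀ η, |Bv ρ w e η| ≤ Lv ρ w e * ‖η‖) :
    EvC p (fun C x => TP Ω ρ C x) := by
  have hcd := (h.cd p hp).self_of_nhds
  obtain ⟨C1, hC1, hhor⟩ := hor_local hcd (hlev p hp)
  obtain ⟨C2, heig⟩ := heig
  obtain ⟨K3, δ3, hK3, hδ3, hlip⟩ := loc_lip ((D2_cd hcd).of_le (m := 1) (by norm_num))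
  obtain ⟨K4, δ4, hK4, hδ4, htay⟩ := loc_taylor (D2_cd hcd)
  obtain ⟨δ5, hδ5, hcdb⟩ := Metric.eventually_nhds_iff_ball.1 (((h.cd p hp).and (h.mem p hp)).and ((ev_d1 hcd).and (ev_d2 hcd)))
  set δ := min δ3 (min δ4 δ5) with hδ
  have hδ0 : 0 < δ := by positivity
  set C := C1 + |C2| + (‖fderiv ℝ ρ p‖ + 1) + (‖D2 ρ p‖ + 1) + 4 / ‖fderiv ℝ ρ p‖ + K3 + K4 + 2 / δ with hC
  have k1 : 0 ≤ ‖fderiv ℝ ρ p‖ := norm_nonneg _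
  have k2 : 0 ≤ ‖D2 ρ p‖ := norm_nonneg (D2 ρ p)
  have k3 : 0 ≤ 4 / ‖fderiv ℝ ρ p‖ := by positivity
  have k4 := abs_nonneg C2
  have k5 := le_abs_self C2
  have k6 : 0 < 2 / δ := by positivity
  have hC0 : 0 < C := by linarith
  have hCδ : 1 / C ≤ δ / 2 := by
    have : 2 / δ ≤ C := by linarith
    rw [div_le_iff₀ hC0]
    rw [div_le_iff₀ hδ0] at this
    linarith
  refine ⟨C, hC0, ?_⟩
  have hρs : ∀ᶠ x in nhds p, |ρ x| < 1 := by
    have hc : ContinuousAt (fun x => |ρ x|) p := hcd.continuousAt.abs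
    exact hc.eventually (Iio_mem_nhds (by simp only [h.zero p hp]; norm_num))
  filter_upwards [hhor, heig, ev_gr hcd (h.grad p hp), ball_mem_nhds p (half_pos hδ0), hρs] with w a1 a2 a3 a4 a5
  have hsub : ball w (1 / C) ⊆ ball p δ := by
    intro y hy
    rw [mem_ball] at hy a4 ⊢
    linarith [dist_triangle y w p]
  have hs3 : ball p δ ⊆ ball p δ3 := ball_subset_ball (min_le_left _ _)
  have hs4 : ball p δ ⊆ ball p δ4 := ball_subset_ball ((min_le_right _ _).trans (min_le_left _ _))
  have hs5 : ball p δ ⊆ ball p δ5 := ball_subset_ball ((min_le_right _ _).trans (min_le_right _ _))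
  have hwδ : w ∈ ball p δ := ball_subset_ball (by linarith) a4
  refine ⟨fun x hx => (hcdb x (hs5 (hsub hx))).1.1, fun x hx => ((hcdb x (hs5 (hsub hx))).2.1).trans (by linarith),
    fun x hx => ((hcdb x (hs5 (hsub hx))).2.2).trans (by linarith), fun x hx => ?_, ?_, ?_, fun ξ => ?_, fun hw => ?_, fun hw => ?_⟩
  · exact (hlip w (hs3 hwδ) x (hs3 (hsub hx))).trans (by gcongr; linarith)
  · obtain ⟨L, hL⟩ := htay w (hs4 hwδ)
    exact ⟨L, fun x hx => (hL x (hs4 (hsub hx))).trans (by gcongr; linarith)⟩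
  · have hg := norm_pos_iff.2 (h.grad p hp)
    obtain ⟨v, hv, hv2⟩ := dual_vec (f := fderiv ℝ ρ w) (C := 2 / ‖fderiv ℝ ρ p‖) (by positivity) a3
    refine ⟨v, hv.trans ?_, by simpa using hv2 1⟩
    have : 2 * (2 / ‖fderiv ℝ ρ p‖) = 4 / ‖fderiv ℝ ρ p‖ := by ring
    linarith
  · exact hor_mono hC1 (by linarith) (Qf_nonneg _ _ _) (by positivity) (a1 ξ)
  · have hρw := hneg w hw
    have hb : ball w (- ρ w / C) ⊆ ball w (1 / C) := ball_subset_ball (by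
      have : - ρ w ≤ 1 := by linarith [(abs_lt.1 a5).1]
      gcongr)
    intro y hy
    have hy' := hsub (hb hy)
    rw [(hcdb y (hs5 hy')).1.2]
    have h1 := mv1 (convex_ball p δ) (f := ρ) (C := ‖fderiv ℝ ρ p‖ + 1)
      (fun x hx => (hcdb x (hs5 hx)).1.1.differentiableAt (by simp)) (fun x hx => (hcdb x (hs5 hx)).2.1) hwδ hy'
    rw [mem_ball, dist_eq_norm, lt_div_iff₀ hC0] at hy
    have h2 : (‖fderiv ℝ ρ p‖ + 1) * ‖y - w‖ ≤ ‖y - w‖ * C := by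
      rw [mul_comm]; gcongr; linarith
    have h3 := (abs_le.1 h1).2
    linarith
  · obtain ⟨e, h1, h2, h3⟩ := a2 hw
    exact ⟨e, h1, h2.trans (by
      have : 0 ≤ (- ρ w) ^ 4 := by positivity
      gcongr; linarith), h3⟩

end Consts


section SysSec
variable {E : Type*} [NormedAddCommGroup E] [InnerProductSpace ℂ E] [NormedSpace ℝ E] [IsScalarTower ℝ ℂ E]

open scoped ContDiff

/-- the pulled back function extended by zero -/
def rb (Ω : Set E) (ρ : E → ℝ) (φ : E → E) : E → ℝ := Set.indicator Ω (fun z => ρ (φ z))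

lemma rb_in {Ω : Set E} {ρ : E → ℝ} {φ : E → E} {z : E} (h : z ∈ Ω) : rb Ω ρ φ z = ρ (φ z) :=
  Set.indicator_of_mem h _

lemma rb_out {Ω : Set E} {ρ : E → ℝ} {φ : E → E} {z : E} (h : z ∉ Ω) : rb Ω ρ φ z = 0 :=
  Set.indicator_of_notMem h _

/-- all the standing data -/
structure Sys (Ω : Set E) (ψ : E → ℝ) (Ω₂ : Set E) (ρ : E → ℝ) (φ : E → E) (C s : ℝ) : Prop where
  hC : 1 ≤ C
  s0 : 0 < s
  s1 : s ≤ 1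
  op : IsOpen Ω
  cpt : IsCompact (closure Ω)
  zero : ∀ p ∈ frontier Ω, ψ p = 0
  D : ∀ p ∈ frontier Ω, ∀ x ∈ ball p s, DP Ω ψ C x
  d3 : ∀ p ∈ frontier Ω, ∀ x ∈ ball p s, ∀ y ∈ ball p s, ‖D2 ψ y - D2 ψ x‖ ≤ C * ‖y - x‖
  op2 : IsOpen Ω₂
  hol : DifferentiableOn ℂ φ Ω
  maps : ∀ z ∈ Ω, φ z ∈ Ω₂
  neg : ∀ w ∈ Ω₂, ρ w < 0
  cd2 : ∀ w ∈ Ω₂, ContDiffAt ℝ ∞ ρ w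
  psh : ∀ w ∈ Ω₂, ∀ ξ, 0 ≤ Lv ρ w ξ
  cont : Continuous (rb Ω ρ φ)
  T : ∀ p ∈ frontier Ω, ∀ z ∈ ball p s, z ∈ Ω → TP Ω₂ ρ C (φ z)

lemma Sys.mono {Ω : Set E} {ψ : E → ℝ} {Ω₂ : Set E} {ρ : E → ℝ} {φ : E → E} {C s C' s' : ℝ}
    (h : Sys Ω ψ Ω₂ ρ φ C s) (hC : C ≤ C') (hs : s' ≤ s) (hs0 : 0 < s') : Sys Ω ψ Ω₂ ρ φ C' s' where
  hC := h.hC.trans hC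
  s0 := hs0
  s1 := hs.trans h.s1
  op := h.op
  cpt := h.cpt
  zero := h.zero
  D := fun p hp x hx => (h.D p hp x (ball_subset_ball hs hx)).mono (by linarith [h.hC]) hC
  d3 := fun p hp x hx y hy => (h.d3 p hp x (ball_subset_ball hs hx) y (ball_subset_ball hs hy)).trans (by gcongr)
  op2 := h.op2
  hol := h.hol
  maps := h.maps
  neg := h.neg
  cd2 := h.cd2
  psh := h.psh
  cont := h.cont
  T := fun p hp z hz hzΩ => (h.T p hp z (ball_subset_ball hs hz) hzΩ).mono h.neg (by linarith [h.hC]) hC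

/-- properness: points near the boundary are mapped near the boundary -/
lemma proper_ev {Ω Ω₂ : Set E} {φ : E → E} (hΩ : IsOpen Ω) (hc2 : IsCompact (closure Ω₂)) (hΩ2 : IsOpen Ω₂) (hmaps : ∀ z ∈ Ω, φ z ∈ Ω₂)
    (hprop : ∀ K ⊆ Ω₂, IsCompact K → IsCompact {z ∈ Ω | φ z ∈ K}) {N : Set E} (hN : N ∈ nhdsSet (frontier Ω₂))
    {p : E} (hp : p ∈ frontier Ω) : ∀ᶠ z in nhds p, z ∈ Ω → φ z ∈ N := by
  obtain ⟨V, hVo, hV, hVN⟩ := mem_nhdsSet_iff_exists.1 hN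
  have hK : IsCompact (closure Ω₂ \ V) := hc2.diff hVo
  have hKsub : closure Ω₂ \ V ⊆ Ω₂ := by
    rintro x ⟨hx, hxV⟩
    by_contra hcon
    exact hxV (hV (by rw [hΩ2.frontier_eq]; exact ⟨hx, hcon⟩))
  have hcl := (hprop _ hKsub hK).isClosed
  have hpn : p ∉ {z ∈ Ω | φ z ∈ closure Ω₂ \ V} := by
    rintro ⟨h1, -⟩
    rw [hΩ.frontier_eq] at hp
    exact hp.2 h1
  filter_upwards [hcl.isOpen_compl.mem_nhds hpn] with z hz hzΩ
  by_contra hcon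
  exact hz ⟨hzΩ, subset_closure (hmaps z hzΩ), fun h => hcon (hVN h)⟩

lemma Sys.exists [FiniteDimensional ℂ E] {Ω : Set E} {ψ : E → ℝ} {Ω₂ : Set E} {ρ : E → ℝ} {φ : E → E}
    (h1 : LocDef Ω ψ) (hlv : ∀ p ∈ frontier Ω, ∃ C, 0 < C ∧ ∀ᶠ x in nhds p, ∀ ξ : E, ‖ξ‖ ^ 2 ≤ C * Lv ψ x ξ)
    (h2 : LocDef Ω₂ ρ) (hneg : ∀ w ∈ Ω₂, ρ w < 0) (hcd2 : ∀ w ∈ Ω₂, ContDiffAt ℝ ∞ ρ w)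
    (hpsh : ∀ w ∈ Ω₂, ∀ ξ, 0 ≤ Lv ρ w ξ)
    (hlev : ∀ p ∈ frontier Ω₂, ∀ ξ : E, ξ ≠ 0 → fderiv ℝ ρ p ξ = 0 → fderiv ℝ ρ p (I • ξ) = 0 → 0 < Lv ρ p ξ)
    (heig : ∀ p ∈ frontier Ω₂, ∃ C, ∀ᶠ w in nhds p, w ∈ Ω₂ → ∃ e, ‖e‖ = 1 ∧ Lv ρ w e ≤ C * (- ρ w) ^ 4 ∧
      ∀ η, |Bv ρ w e η| ≤ Lv ρ w e * ‖η‖)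
    (hol : DifferentiableOn ℂ φ Ω) (hmaps : ∀ z ∈ Ω, φ z ∈ Ω₂)
    (hprop : ∀ K ⊆ Ω₂, IsCompact K → IsCompact {z ∈ Ω | φ z ∈ K}) :
    ∃ C s, Sys Ω ψ Ω₂ ρ φ C s := by
  obtain ⟨C1, s1, hC1, hs1, hs1', hD⟩ := unif h1.fcpt (Q := fun C x => 0 < C ∧ DP Ω ψ C x)
    (fun C C' x hCC hx => ⟨hx.1.trans_le hCC, hx.2.mono hx.1 hCC⟩)
    (fun p hp => by
      obtain ⟨C, hC, h⟩ := DP_ev h1 hlv hp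
      exact ⟨C, h.mono fun x hx => ⟨hC, hx⟩⟩)
  obtain ⟨C2, s2, hC2, hs2, hs2', hT⟩ := unif h2.fcpt (Q := fun C x => 0 < C ∧ TP Ω₂ ρ C x)
    (fun C C' x hCC hx => ⟨hx.1.trans_le hCC, hx.2.mono hneg hx.1 hCC⟩)
    (fun p hp => by
      obtain ⟨C, hC, h⟩ := TP_ev h2 hneg hlev hp (heig p hp)
      exact ⟨C, h.mono fun x hx => ⟨hC, hx⟩⟩)
  obtain ⟨C3, s3, hC3, hs3, hs3', hL⟩ := unif h1.fcpt (Q := fun C x => 0 < C ∧ ∀ y ∈ ball x (1 / C), ‖D2 ψ y - D2 ψ x‖ ≤ C * ‖y - x‖)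
    (fun C C' x hCC hx => ⟨hx.1.trans_le hCC, fun y hy => (hx.2 y (ball_inv_mono hx.1 hCC hy)).trans (by gcongr)⟩)
    (fun p hp => by
      obtain ⟨K, δ, hK, hδ, hl⟩ := loc_lip ((D2_cd (h1.cd p hp).self_of_nhds).of_le (m := 1) (by norm_num))
      refine ⟨K + 2 / δ, ?_⟩
      have hp2 : 0 < 2 / δ := by positivity
      filter_upwards [ball_mem_nhds p (half_pos hδ)] with x hx
      refine ⟨by linarith, fun y hy => (hl x (ball_subset_ball (by linarith) hx) y ?_).trans (by gcongr; linarith)⟩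
      have hle : 1 / (K + 2 / δ) ≤ δ / 2 := by
        rw [div_le_iff₀ (by linarith)]
        have : δ / 2 * (2 / δ) = 1 := by field_simp
        nlinarith [mul_nonneg hδ.le hK]
      rw [mem_ball] at hx hy ⊢
      linarith [dist_triangle y x p])
  have hT' : {x | 0 < C2 ∧ TP Ω₂ ρ C2 x} ∈ nhdsSet (frontier Ω₂) := by
    rw [mem_nhdsSet_iff_forall]
    intro p hp
    exact Filter.mem_of_superset (ball_mem_nhds p hs2) (fun x hx => hT p hp x hx)
  obtain ⟨-, s4, -, hs4, hs4', hM⟩ := unif h1.fcpt (Q := fun C z => z ∈ Ω → φ z ∈ {x | 0 < C2 ∧ TP Ω₂ ρ C2 x})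
    (fun C C' x hCC hx => hx) (fun p hp => ⟨0, proper_ev h1.op h2.cpt h2.op hmaps hprop hT' hp⟩)
  set C := C1 + C2 + C3 with hC
  set s := min s1 (min (1 / (2 * C)) (min s3 s4)) with hs
  have hC0 : 0 < C := by linarith
  have a1 : s ≤ s1 := min_le_left _ _
  have a2 : s ≤ 1 / (2 * C) := (min_le_right _ _).trans (min_le_left _ _)
  have a3 : s ≤ s3 := (min_le_right _ _).trans ((min_le_right _ _).trans (min_le_left _ _))
  have a4 : s ≤ s4 := (min_le_right _ _).trans ((min_le_right _ _).trans (min_le_right _ _))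
  refine ⟨C, s, by linarith, by positivity, a1.trans hs1', h1.op, h1.cpt, h1.zero, ?_, ?_, h2.op, hol, hmaps, hneg, hcd2, hpsh, ?_, ?_⟩
  · intro p hp x hx
    exact (hD p hp x (ball_subset_ball a1 hx)).2.mono (by linarith) (by linarith)
  · intro p hp x hx y hy
    have h3 := (hL p hp x (ball_subset_ball a3 hx)).2 y ?_
    · exact h3.trans (by gcongr; linarith)
    · rw [mem_ball] at hx hy ⊢
      have : 2 * s ≤ 1 / C3 := by
        calc 2 * s ≤ 2 * (1 / (2 * C)) := by gcongr
          _ = 1 / C := by field_simp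
          _ ≤ 1 / C3 := one_div_le_one_div_of_le (by linarith) (by linarith)
      linarith [dist_triangle y p x, dist_comm p x]
  · rw [continuous_iff_continuousAt]
    intro z
    by_cases hz : z ∈ Ω
    · have hc : ContinuousAt (fun z => ρ (φ z)) z :=
        ContinuousAt.comp (g := ρ) (hcd2 _ (hmaps z hz)).continuousAt (hol.differentiableAt (h1.op.mem_nhds hz)).continuousAt
      refine hc.congr ?_
      filter_upwards [h1.op.mem_nhds hz] with x hx
      exact (rb_in hx).symm
    · by_cases hzc : z ∈ closure Ω
      · have hzf : z ∈ frontier Ω := by rw [h1.op.frontier_eq]; exact ⟨hzc, hz⟩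
        rw [ContinuousAt, rb_out hz, Metric.tendsto_nhds]
        intro ε hε
        have hN : {x | |ρ x| < ε} ∈ nhdsSet (frontier Ω₂) := by
          rw [mem_nhdsSet_iff_forall]
          intro p hp
          have hc : ContinuousAt (fun x => |ρ x|) p := (h2.cd p hp).self_of_nhds.continuousAt.abs
          exact hc.eventually (Iio_mem_nhds (by simp only [h2.zero p hp]; simpa using hε))
        filter_upwards [proper_ev h1.op h2.cpt h2.op hmaps hprop hN hzf] with x hx
        rw [Real.dist_eq, sub_zero]
        by_cases hxΩ : x ∈ Ω
        · rw [rb_in hxΩ]; exact hx hxΩ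
        · rw [rb_out hxΩ]; simpa using hε
      · have : (fun _ => (0:ℝ)) =ᶠ[nhds z] rb Ω ρ φ := by
          filter_upwards [isClosed_closure.isOpen_compl.mem_nhds hzc] with x hx
          exact (rb_out (fun h => hx (subset_closure h))).symm
        exact continuousAt_const.congr this
  · intro p hp z hz hzΩ
    exact (hM p hp z (ball_subset_ball a4 hz) hzΩ).2.mono hneg (by linarith) (by linarith)

end SysSec


section Collar
variable {E : Type*} [NormedAddCommGroup E] [InnerProductSpace ℂ E] [NormedSpace ℝ E] [IsScalarTower ℝ ℂ E]
variable [FiniteDimensional ℂ E]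
variable {Ω : Set E} {ψ : E → ℝ} {Ω₂ : Set E} {ρ : E → ℝ} {φ : E → E} {C s : ℝ}

open scoped ContDiff

lemma Sys.fcpt (h : Sys Ω ψ Ω₂ ρ φ C s) : IsCompact (frontier Ω) :=
  h.cpt.of_isClosed_subset isClosed_frontier frontier_subset_closure

lemma Sys.C0 (h : Sys Ω ψ Ω₂ ρ φ C s) : 0 < C := by linarith [h.hC]

lemma Sys.rb_neg (h : Sys Ω ψ Ω₂ ρ φ C s) {z : E} (hz : z ∈ Ω) : rb Ω ρ φ z < 0 := by
  rw [rb_in hz]; exact h.neg _ (h.maps z hz)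

lemma Sys.rb_nonpos (h : Sys Ω ψ Ω₂ ρ φ C s) (z : E) : rb Ω ρ φ z ≤ 0 := by
  by_cases hz : z ∈ Ω
  · exact (h.rb_neg hz).le
  · rw [rb_out hz]

lemma Sys.notMem (h : Sys Ω ψ Ω₂ ρ φ C s) {p : E} (hp : p ∈ frontier Ω) : p ∉ Ω := by
  rw [h.op.frontier_eq] at hp; exact hp.2

lemma Sys.rb_small (h : Sys Ω ψ Ω₂ ρ φ C s) {ε : ℝ} (hε : 0 < ε) :
    ∃ s', 0 < s' ∧ s' ≤ s ∧ ∀ p ∈ frontier Ω, ∀ z ∈ ball p s', |rb Ω ρ φ z| ≤ ε := by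
  obtain ⟨-, s', -, hs', -, hQ⟩ := unif h.fcpt (Q := fun _ z => |rb Ω ρ φ z| ≤ ε) (fun _ _ _ _ h => h)
    (fun p hp => ⟨0, by
      have hc : ContinuousAt (fun z => |rb Ω ρ φ z|) p := h.cont.continuousAt.abs
      refine (hc.eventually (eventually_lt_nhds (b := ε) ?_)).mono fun x hx => le_of_lt hx
      simp only [rb_out (h.notMem hp)]; simpa using hε⟩)
  exact ⟨min s s', lt_min h.s0 hs', min_le_left _ _, fun p hp z hz => hQ p hp z (ball_subset_ball (min_le_right _ _) hz)⟩

lemma Sys.psi_lip (h : Sys Ω ψ Ω₂ ρ φ C s) {p : E} (hp : p ∈ frontier Ω) {x y : E} (hx : x ∈ ball p s) (hy : y ∈ ball p s) :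
    |ψ y - ψ x| ≤ C * ‖y - x‖ :=
  mv1 (convex_ball p s) (fun z hz => (h.D p hp z hz).cd.differentiableAt (by simp)) (fun z hz => (h.D p hp z hz).d1) hx hy

lemma Sys.psi_le (h : Sys Ω ψ Ω₂ ρ φ C s) {p : E} (hp : p ∈ frontier Ω) {x : E} (hx : x ∈ ball p s) :
    |ψ x| ≤ C * ‖x - p‖ := by
  have := h.psi_lip hp (mem_ball_self h.s0) hx
  rwa [h.zero p hp, sub_zero] at this

lemma Sys.rb_ev (h : Sys Ω ψ Ω₂ ρ φ C s) {z : E} (hz : z ∈ Ω) : rb Ω ρ φ =ᶠ[nhds z] fun x => ρ (φ x) := by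
  filter_upwards [h.op.mem_nhds hz] with x hx using rb_in hx

lemma Sys.phi_d (h : Sys Ω ψ Ω₂ ρ φ C s) {z : E} (hz : z ∈ Ω) : DifferentiableAt ℂ φ z :=
  h.hol.differentiableAt (h.op.mem_nhds hz)

lemma Sys.phi_ev (h : Sys Ω ψ Ω₂ ρ φ C s) {z : E} (hz : z ∈ Ω) : ∀ᶠ x in nhds z, DifferentiableAt ℂ φ x := by
  filter_upwards [h.op.mem_nhds hz] with x hx using h.phi_d hx

lemma Sys.phi_d2 (h : Sys Ω ψ Ω₂ ρ φ C s) {z : E} (hz : z ∈ Ω) : DifferentiableAt ℂ (fderiv ℂ φ) z :=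
  (holo_fderiv h.op h.hol).differentiableAt (h.op.mem_nhds hz)

lemma Sys.phi_cd (h : Sys Ω ψ Ω₂ ρ φ C s) {z : E} (hz : z ∈ Ω) : ContDiffAt ℝ 2 φ z :=
  (holo_contDiffAt h.op h.hol hz).restrict_scalars ℝ

lemma Sys.rho_cd (h : Sys Ω ψ Ω₂ ρ φ C s) {z : E} (hz : z ∈ Ω) : ContDiffAt ℝ 2 ρ (φ z) :=
  (h.cd2 _ (h.maps z hz)).of_le (WithTop.coe_le_coe.2 le_top)

lemma Sys.psi_cd (h : Sys Ω ψ Ω₂ ρ φ C s) {p : E} (hp : p ∈ frontier Ω) {x : E} (hx : x ∈ ball p s) : ContDiffAt ℝ 2 ψ x :=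
  (h.D p hp x hx).cd.of_le (WithTop.coe_le_coe.2 le_top)

lemma Sys.r_cd (h : Sys Ω ψ Ω₂ ρ φ C s) {z : E} (hz : z ∈ Ω) : ContDiffAt ℝ 2 (rb Ω ρ φ) z :=
  ContDiffAt.congr_of_eventuallyEq (ContDiffAt.comp z (h.rho_cd hz) (h.phi_cd hz)) (h.rb_ev hz)

lemma Sys.Lv_rb (h : Sys Ω ψ Ω₂ ρ φ C s) {z : E} (hz : z ∈ Ω) (ξ : E) :
    Lv (rb Ω ρ φ) z ξ = Lv ρ (φ z) (fderiv ℂ φ z ξ) := by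
  rw [Lv_congr (h.rb_ev hz), Lv_comp_holo (h.rho_cd hz) (h.phi_cd hz) (h.phi_ev hz) (h.phi_d2 hz)]

lemma Sys.fd_rb (h : Sys Ω ψ Ω₂ ρ φ C s) {z : E} (hz : z ∈ Ω) (ξ : E) :
    fderiv ℝ (rb Ω ρ φ) z ξ = fderiv ℝ ρ (φ z) (fderiv ℂ φ z ξ) := by
  rw [(h.rb_ev hz).fderiv_eq, fderiv_fun_comp z ((h.rho_cd hz).differentiableAt (by norm_num)) ((h.phi_cd hz).differentiableAt (by norm_num)),
    fderiv_real_eq (h.phi_d hz)]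
  rfl

lemma Sys.Qf_rb (h : Sys Ω ψ Ω₂ ρ φ C s) {z : E} (hz : z ∈ Ω) (ξ : E) :
    Qf (rb Ω ρ φ) z ξ = Qf ρ (φ z) (fderiv ℂ φ z ξ) := by
  unfold Qf; rw [h.fd_rb hz, h.fd_rb hz, map_smul]

lemma Sys.Lv_rb_nonneg (h : Sys Ω ψ Ω₂ ρ φ C s) {z : E} (hz : z ∈ Ω) (ξ : E) : 0 ≤ Lv (rb Ω ρ φ) z ξ := by
  rw [h.Lv_rb hz]; exact h.psh _ (h.maps z hz) _

/-- either the differential has a kernel or it is onto -/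
lemma ker_or_surj (T : E →L[ℂ] E) : (∃ ξ, ξ ≠ 0 ∧ T ξ = 0) ∨ ∀ e, ∃ ξ, T ξ = e := by
  by_cases hi : Function.Injective (T : E →ₗ[ℂ] E)
  · right
    exact LinearMap.injective_iff_surjective.1 hi
  · left
    rw [← LinearMap.ker_eq_bot, Submodule.eq_bot_iff] at hi
    push Not at hi
    obtain ⟨ξ, h1, h2⟩ := hi
    exact ⟨ξ, h2, h1⟩

lemma Sys.collar (h : Sys Ω ψ Ω₂ ρ φ C s) {σ : ℝ} (hσ : σ < s) {Φ : E → ℝ}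
    (hc : ∀ p ∈ frontier Ω, ContinuousOn Φ (ball p s))
    (h0 : ∀ p ∈ frontier Ω, Φ p ≤ 0)
    (h1 : ∀ p ∈ frontier Ω, ∀ x ∈ ball p s, x ∈ Ω → infDist x (frontier Ω) = σ → Φ x ≤ 0)
    (h2 : ∀ p ∈ frontier Ω, ∀ x ∈ ball p s, x ∈ Ω → dist x p < σ → ContDiffAt ℝ 2 Φ x ∧ ∃ ξ, 0 < Lv Φ x ξ) :
    ∀ p ∈ frontier Ω, ∀ x ∈ ball p σ, x ∈ Ω → Φ x ≤ 0 := by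
  intro p hp x hx hxΩ
  have hne : (frontier Ω).Nonempty := ⟨p, hp⟩
  set K : Set E := {x ∈ closure Ω | infDist x (frontier Ω) ≤ σ} with hK
  have hKc : IsCompact K := by
    refine h.cpt.of_isClosed_subset ?_ (fun x hx => hx.1)
    exact isClosed_closure.inter (isClosed_le (continuous_infDist_pt _) continuous_const)
  have hfind : ∀ y ∈ K, ∃ q ∈ frontier Ω, infDist y (frontier Ω) = dist y q := fun y hy =>
    h.fcpt.exists_infDist_eq_dist hne y
  have hball : ∀ y ∈ K, ∃ q ∈ frontier Ω, y ∈ ball q s ∧ infDist y (frontier Ω) = dist y q := by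
    intro y hy
    obtain ⟨q, hq, h3⟩ := hfind y hy
    exact ⟨q, hq, by rw [mem_ball, ← h3]; exact hy.2.trans_lt hσ, h3⟩
  refine max_principle hKc (Φ := Φ) ?_ ?_ x ⟨subset_closure hxΩ, ?_⟩
  · intro y hy
    obtain ⟨q, hq, h3, -⟩ := hball y hy
    exact ((hc q hq).continuousAt (isOpen_ball.mem_nhds h3)).continuousWithinAt
  · intro y hy
    by_cases hyΩ : y ∈ Ω
    · obtain ⟨q, hq, h3, h4⟩ := hball y hy
      rcases hy.2.lt_or_eq with h5 | h5
      · right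
        refine ⟨?_, h2 q hq y h3 hyΩ (h4 ▸ h5)⟩
        filter_upwards [h.op.mem_nhds hyΩ, (continuous_infDist_pt (frontier Ω)).continuousAt.eventually (Iio_mem_nhds h5)] with x h6 h7
        exact ⟨subset_closure h6, le_of_lt h7⟩
      · left; exact h1 q hq y h3 hyΩ h5
    · left
      exact h0 y (by rw [h.op.frontier_eq]; exact ⟨hy.1, hyΩ⟩)
  · exact (infDist_le_dist_of_mem hp).trans hx.le

lemma Sys.cmpA (h : Sys Ω ψ Ω₂ ρ φ C s) :
    ∃ K s', 1 ≤ K ∧ 0 < s' ∧ s' ≤ s ∧ ∀ p ∈ frontier Ω, ∀ z ∈ ball p s', z ∈ Ω → - rb Ω ρ φ z ≤ K * (- ψ z) := by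
  have hC0 := h.C0
  have hC := h.hC
  set K := 3 * C ^ 3 with hK
  have hK1 : 1 ≤ K := by
    have : 1 ≤ C ^ 3 := one_le_pow₀ hC
    linarith
  obtain ⟨s2, hs2, hs2s, hsm⟩ := h.rb_small (ε := 1 / (2 * K)) (by positivity)
  set σ := s2 / 2 with hσ
  set ε := σ / (2 * C) with hε
  have hσ0 : 0 < σ := by positivity
  have hε0 : 0 < ε := by positivity
  have h' := h.mono le_rfl hs2s hs2
  have habs : ∀ p ∈ frontier Ω, ∀ z ∈ ball p s2, 0 ≤ - rb Ω ρ φ z ∧ 2 * K * (- rb Ω ρ φ z) ≤ 1 := by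
    intro p hp z hz
    have h1 := h.rb_nonpos z
    have h2 := hsm p hp z hz
    rw [abs_of_nonpos h1, le_div_iff₀ (by positivity)] at h2
    exact ⟨by linarith, by linarith⟩
  have key := h'.collar (σ := σ) (by linarith) (Φ := fun x => ψ x + (-ε) * (rb Ω ρ φ x + (-K) * rb Ω ρ φ x ^ 2)) ?_ ?_ ?_ ?_
  · refine ⟨max 1 (1 / ε), σ, le_max_left _ _, hσ0, by linarith, fun p hp z hz hzΩ => ?_⟩
    have h1 := key p hp z hz hzΩ
    have h2 := (h.rb_neg hzΩ)
    have h3 : ε * (- rb Ω ρ φ z) ≤ - ψ z := by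
      have : 0 ≤ ε * (K * rb Ω ρ φ z ^ 2) := by positivity
      nlinarith
    have h4 : - rb Ω ρ φ z ≤ 1 / ε * (- ψ z) := by
      rw [one_div_mul_eq_div, le_div_iff₀ hε0]; linarith
    have h5 : 0 ≤ - ψ z := by
      have : 0 ≤ ε * (- rb Ω ρ φ z) := by apply mul_nonneg hε0.le; linarith
      linarith
    exact h4.trans (by gcongr; exact le_max_right _ _)
  · intro p hp x hx
    exact (((h'.psi_cd hp hx).continuousAt).add (continuousAt_const.mul ((h.cont.add (continuous_const.mul (h.cont.pow 2))).continuousAt))).continuousWithinAt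
  · intro p hp
    simp only [h.zero p hp, rb_out (h.notMem hp)]; simp
  · intro p hp x hx hxΩ hd
    obtain ⟨q, hq, h3⟩ := (h'.D p hp x hx).near
    have h4 : σ ≤ C * |ψ x| := by rw [← hd]; exact (infDist_le_dist_of_mem hq).trans (by rwa [dist_eq_norm])
    have h5 := (h'.D p hp x hx).mem.1 hxΩ
    rw [abs_of_neg h5] at h4
    obtain ⟨h6, h7⟩ := habs p hp x hx
    have h8 : ε * C * 2 = σ := by rw [hε]; field_simp
    have h9 : (- rb Ω ρ φ x) + K * (- rb Ω ρ φ x) ^ 2 ≤ 2 := by nlinarith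
    have h10 : 2 * ε ≤ - ψ x := by
      rw [← h8] at h4
      have : C * (2 * ε) ≤ C * (- ψ x) := by linarith
      exact le_of_mul_le_mul_left this hC0
    nlinarith
  · intro p hp x hx hxΩ _
    have hr := h.r_cd hxΩ
    have hψ := h'.psi_cd hp hx
    have hr2 : ContDiffAt ℝ 2 (fun x => rb Ω ρ φ x + (-K) * rb Ω ρ φ x ^ 2) x := hr.add (contDiffAt_const.mul (hr.pow 2))
    refine ⟨hψ.add (contDiffAt_const.mul hr2), ?_⟩
    have hform : ∀ ξ, Lv (fun x => ψ x + (-ε) * (rb Ω ρ φ x + (-K) * rb Ω ρ φ x ^ 2)) x ξ =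
        Lv ψ x ξ + (-ε) * ((1 + 2 * (-K) * rb Ω ρ φ x) * Lv ρ (φ x) (fderiv ℂ φ x ξ) + 2 * (-K) * Qf ρ (φ x) (fderiv ℂ φ x ξ)) := by
      intro ξ
      rw [Lv_add hψ (contDiffAt_const.mul hr2), Lv_const_mul _ hr2, Lv_addsq hr, h.Lv_rb hxΩ, h.Qf_rb hxΩ]
    have hlv := (h'.D p hp x hx).lv
    rcases ker_or_surj (fderiv ℂ φ x) with ⟨ξ, hξ, hk⟩ | hsurj
    · refine ⟨ξ, ?_⟩
      rw [hform, hk]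
      have h1 : Lv ρ (φ x) 0 = 0 := by unfold Lv; simp
      have h2 : Qf ρ (φ x) 0 = 0 := by unfold Qf; simp
      rw [h1, h2]
      have := hlv ξ
      have h3 := norm_pos_iff.2 hξ
      simp only [mul_zero, add_zero]
      by_contra hcon
      push Not at hcon
      nlinarith [sq_pos_of_pos h3]
    · have hTP := h'.T p hp x hx hxΩ
      obtain ⟨e, he, he1⟩ := hTP.ex
      obtain ⟨ξ, hξ⟩ := hsurj e
      refine ⟨ξ, ?_⟩
      rw [hform, hξ]
      have h1 := (abs_le.1 (Lv_le (hTP.d2 _ (mem_ball_self (by positivity))) e)).2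
      have h1' : Lv ρ (φ x) e ≤ 2 * C ^ 3 := h1.trans (by
        calc 2 * C * ‖e‖ ^ 2 ≤ 2 * C * C ^ 2 := by gcongr
          _ = _ := by ring)
      have h2 : 1 ≤ Qf ρ (φ x) e := by unfold Qf; rw [he1]; nlinarith [sq_nonneg (fderiv ℝ ρ (φ x) (I • e))]
      have h3 : 0 ≤ Lv ψ x ξ := by
        by_contra hcon
        push Not at hcon
        nlinarith [hlv ξ, sq_nonneg ‖ξ‖]
      have h4 := h.psh _ (h.maps x hxΩ) e
      obtain ⟨h6, h7⟩ := habs p hp x hx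
      have h8 : (1 + 2 * (-K) * rb Ω ρ φ x) * Lv ρ (φ x) e ≤ 2 * (2 * C ^ 3) := by
        apply mul_le_mul (by linarith) h1' h4 (by norm_num)
      have h9 : 2 * K ≤ 2 * K * Qf ρ (φ x) e := by nlinarith
      have h10 : (1 + 2 * (-K) * rb Ω ρ φ x) * Lv ρ (φ x) e + 2 * (-K) * Qf ρ (φ x) e < 0 := by
        have : 0 < C ^ 3 := by positivity
        linarith
      nlinarith

lemma Sys.cmpB (h : Sys Ω ψ Ω₂ ρ φ C s) :
    ∃ K s', 1 ≤ K ∧ 0 < s' ∧ s' ≤ s ∧ ∀ p ∈ frontier Ω, ∀ z ∈ ball p s', z ∈ Ω → - ψ z ≤ K * (- rb Ω ρ φ z) := by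
  have hC0 := h.C0
  have hC := h.hC
  set K := 9 * C ^ 3 with hK
  have hC3 : 1 ≤ C ^ 3 := one_le_pow₀ hC
  have hK1 : 1 ≤ K := by linarith
  set s2 := min s (1 / (2 * K * C)) with hs2d
  have hs2 : 0 < s2 := lt_min h.s0 (by positivity)
  have hs2s : s2 ≤ s := min_le_left _ _
  set σ := s2 / 2 with hσ
  have hσ0 : 0 < σ := by positivity
  have h' := h.mono le_rfl hs2s hs2
  have habs : ∀ p ∈ frontier Ω, ∀ z ∈ ball p s2, 2 * K * |ψ z| ≤ 1 := by
    intro p hp z hz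
    have h1 := h'.psi_le hp hz
    have h2 : ‖z - p‖ ≤ 1 / (2 * K * C) := by rw [← dist_eq_norm]; exact hz.le.trans (min_le_right _ _)
    calc 2 * K * |ψ z| ≤ 2 * K * (C * (1 / (2 * K * C))) := by gcongr; exact h1.trans (by gcongr)
      _ = 1 := by field_simp
  obtain ⟨c1, hc1, hc1'⟩ : ∃ c1, 0 < c1 ∧ ∀ x ∈ Ω, infDist x (frontier Ω) = σ → rb Ω ρ φ x ≤ - c1 := by
    have hcpt : IsCompact {x ∈ closure Ω | infDist x (frontier Ω) = σ} := by
      refine h.cpt.of_isClosed_subset ?_ (fun x hx => hx.1)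
      exact isClosed_closure.inter (isClosed_eq (continuous_infDist_pt _) continuous_const)
    rcases Set.eq_empty_or_nonempty {x ∈ closure Ω | infDist x (frontier Ω) = σ} with he | hne
    · refine ⟨1, one_pos, fun x hx hd => ?_⟩
      exact absurd (show x ∈ {x ∈ closure Ω | infDist x (frontier Ω) = σ} from ⟨subset_closure hx, hd⟩) (by rw [he]; simp)
    · obtain ⟨m, hm, hmax⟩ := hcpt.exists_isMaxOn hne h.cont.continuousOn
      refine ⟨- rb Ω ρ φ m, ?_, fun x hx hd => ?_⟩
      · have : m ∈ Ω := by
          by_contra hcon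
          have hmf : m ∈ frontier Ω := by rw [h.op.frontier_eq]; exact ⟨hm.1, hcon⟩
          have := hm.2
          rw [infDist_zero_of_mem hmf] at this
          linarith
        linarith [h.rb_neg this]
      · rw [neg_neg]; exact hmax (show x ∈ {x ∈ closure Ω | infDist x (frontier Ω) = σ} from ⟨subset_closure hx, hd⟩)
  set ε := c1 / 2 with hε
  have hε0 : 0 < ε := by positivity
  have key := h'.collar (σ := σ) (by linarith) (Φ := fun x => rb Ω ρ φ x + (-ε) * (ψ x + (-K) * ψ x ^ 2)) ?_ ?_ ?_ ?_
  · refine ⟨max 1 (1 / ε), σ, le_max_left _ _, hσ0, by linarith, fun p hp z hz hzΩ => ?_⟩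
    have h1 := key p hp z hz hzΩ
    have h2 := (h.rb_neg hzΩ)
    have h3 : ε * (- ψ z) ≤ - rb Ω ρ φ z := by
      have : 0 ≤ ε * (K * ψ z ^ 2) := by positivity
      nlinarith
    have h4 : - ψ z ≤ 1 / ε * (- rb Ω ρ φ z) := by
      rw [one_div_mul_eq_div, le_div_iff₀ hε0]; linarith
    have h5 : 0 ≤ - rb Ω ρ φ z := by linarith
    exact h4.trans (by gcongr; exact le_max_right _ _)
  · intro p hp x hx
    have := (h'.psi_cd hp hx).continuousAt
    exact ((h.cont.continuousAt).add (continuousAt_const.mul (this.add (continuousAt_const.mul (this.pow 2))))).continuousWithinAt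
  · intro p hp
    simp only [h.zero p hp, rb_out (h.notMem hp)]; simp
  · intro p hp x hx hxΩ hd
    have h5 := (h'.D p hp x hx).mem.1 hxΩ
    have h6 := habs p hp x hx
    rw [abs_of_neg h5] at h6
    have h7 := hc1' x hxΩ hd
    have h9 : (- ψ x) + K * (- ψ x) ^ 2 ≤ 2 := by nlinarith
    nlinarith
  · intro p hp x hx hxΩ _
    have hr := h.r_cd hxΩ
    have hψ := h'.psi_cd hp hx
    have hr2 : ContDiffAt ℝ 2 (fun x => ψ x + (-K) * ψ x ^ 2) x := hψ.add (contDiffAt_const.mul (hψ.pow 2))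
    refine ⟨hr.add (contDiffAt_const.mul hr2), ?_⟩
    obtain ⟨ξ, hξ, hξ1⟩ := dual_vec hC0 (h'.D p hp x hx).gr
    refine ⟨ξ, ?_⟩
    rw [Lv_add hr (contDiffAt_const.mul hr2), Lv_const_mul _ hr2, Lv_addsq hψ]
    have h0 := h.Lv_rb_nonneg hxΩ ξ
    have h1 := (abs_le.1 (Lv_le (h'.D p hp x hx).d2 ξ)).2
    have h1' : Lv ψ x ξ ≤ 8 * C ^ 3 := h1.trans (by
      calc 2 * C * ‖ξ‖ ^ 2 ≤ 2 * C * (2 * C) ^ 2 := by gcongr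
        _ = _ := by ring)
    have h2 : 1 ≤ Qf ψ x ξ := by
      unfold Qf
      have h3 := hξ1 1
      simp only [one_smul, one_re] at h3
      rw [h3]; nlinarith [sq_nonneg (fderiv ℝ ψ x (I • ξ))]
    have h4 : 0 ≤ Lv ψ x ξ := by
      by_contra hcon
      push Not at hcon
      nlinarith [(h'.D p hp x hx).lv ξ, sq_nonneg ‖ξ‖]
    have h5 := (h'.D p hp x hx).mem.1 hxΩ
    have h6 := habs p hp x hx
    rw [abs_of_neg h5] at h6
    have h8 : (1 + 2 * (-K) * ψ x) * Lv ψ x ξ ≤ 2 * (8 * C ^ 3) := by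
      apply mul_le_mul (by linarith) h1' h4 (by norm_num)
    have h9 : 2 * K ≤ 2 * K * Qf ψ x ξ := by nlinarith
    have h10 : (1 + 2 * (-K) * ψ x) * Lv ψ x ξ + 2 * (-K) * Qf ψ x ξ < 0 := by linarith
    nlinarith

end Collar


section Sys2Sec
variable {E : Type*} [NormedAddCommGroup E] [InnerProductSpace ℂ E] [NormedSpace ℝ E] [IsScalarTower ℝ ℂ E]

open scoped ContDiff

/-- the standing data together with the comparison of the two defining functions -/
structure Sys2 (Ω : Set E) (ψ : E → ℝ) (Ω₂ : Set E) (ρ : E → ℝ) (φ : E → E) (C s : ℝ) : Prop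
    extends Sys Ω ψ Ω₂ ρ φ C s where
  up : ∀ p ∈ frontier Ω, ∀ z ∈ ball p s, z ∈ Ω → - rb Ω ρ φ z ≤ C * (- ψ z)
  lo : ∀ p ∈ frontier Ω, ∀ z ∈ ball p s, z ∈ Ω → - ψ z ≤ C * (- rb Ω ρ φ z)

variable [FiniteDimensional ℂ E]
variable {Ω : Set E} {ψ : E → ℝ} {Ω₂ : Set E} {ρ : E → ℝ} {φ : E → E} {C s : ℝ}

lemma Sys.psi_neg (h : Sys Ω ψ Ω₂ ρ φ C s) {p z : E} (hp : p ∈ frontier Ω) (hz : z ∈ ball p s) (hzΩ : z ∈ Ω) : 0 < - ψ z := by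
  have := (h.D p hp z hz).mem.1 hzΩ
  linarith

lemma Sys2.mono {C' s' : ℝ} (h : Sys2 Ω ψ Ω₂ ρ φ C s) (hC : C ≤ C') (hs : s' ≤ s) (hs0 : 0 < s') :
    Sys2 Ω ψ Ω₂ ρ φ C' s' where
  toSys := h.toSys.mono hC hs hs0
  up := fun p hp z hz hzΩ => (h.up p hp z (ball_subset_ball hs hz) hzΩ).trans (by
    have := h.psi_neg hp (ball_subset_ball hs hz) hzΩ
    gcongr)
  lo := fun p hp z hz hzΩ => (h.lo p hp z (ball_subset_ball hs hz) hzΩ).trans (by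
    have := h.rb_neg hzΩ
    gcongr; linarith)

lemma Sys.exists2 (h : Sys Ω ψ Ω₂ ρ φ C s) : ∃ C' s', Sys2 Ω ψ Ω₂ ρ φ C' s' := by
  obtain ⟨K1, s1, hK1, hs1, hs1s, hA⟩ := h.cmpA
  obtain ⟨K2, s2, hK2, hs2, hs2s, hB⟩ := h.cmpB
  have hC := h.hC
  have a1 : min s1 s2 ≤ s1 := min_le_left _ _
  have a2 : min s1 s2 ≤ s2 := min_le_right _ _
  refine ⟨C + K1 + K2, min s1 s2, h.mono (by linarith) (a1.trans hs1s) (lt_min hs1 hs2), ?_, ?_⟩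
  · intro p hp z hz hzΩ
    have h1 := hA p hp z (ball_subset_ball a1 hz) hzΩ
    have h2 := h.psi_neg hp (ball_subset_ball (a1.trans hs1s) hz) hzΩ
    exact h1.trans (by gcongr; linarith)
  · intro p hp z hz hzΩ
    have h1 := hB p hp z (ball_subset_ball a2 hz) hzΩ
    have h2 := h.rb_neg hzΩ
    exact h1.trans (by gcongr <;> linarith)

/-- points deep in the domain -/
lemma Sys.deep (h : Sys Ω ψ Ω₂ ρ φ C s) {p z x : E} (hp : p ∈ frontier Ω) (hz : z ∈ ball p (s / 2)) (hzΩ : z ∈ Ω)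
    (hx : ‖x - z‖ ≤ - ψ z / (2 * C)) : x ∈ ball p s ∧ x ∈ Ω ∧ 2 * ψ z ≤ ψ x ∧ ψ x ≤ ψ z / 2 := by
  have hC := h.C0
  have hs := h.s0
  have hzs : z ∈ ball p s := ball_subset_ball (by linarith) hz
  have ht := h.psi_neg hp hzs hzΩ
  have h1 := h.psi_le hp hzs
  rw [abs_of_neg (by linarith)] at h1
  have hzp : ‖z - p‖ < s / 2 := by rw [← dist_eq_norm]; exact hz
  have h2 : - ψ z / (2 * C) ≤ ‖z - p‖ / 2 := by
    rw [div_le_iff₀ (by positivity)]; nlinarith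
  have hxs : x ∈ ball p s := by
    rw [mem_ball, dist_eq_norm]
    have : x - p = (x - z) + (z - p) := by abel
    rw [this]
    refine (norm_add_le _ _).trans_lt ?_
    linarith
  have h3 := abs_le.1 (h.psi_lip hp hzs hxs)
  have h4 : C * ‖x - z‖ ≤ - ψ z / 2 := by
    calc C * ‖x - z‖ ≤ C * (- ψ z / (2 * C)) := by gcongr
      _ = _ := by field_simp
  refine ⟨hxs, (h.D p hp x hxs).mem.2 (by linarith [h3.2]), by linarith [h3.1], by linarith [h3.2]⟩

/-- the Levi form along an analytic disc -/
lemma Lv_line {F : Type*} [NormedAddCommGroup F] [InnerProductSpace ℂ F] [NormedSpace ℝ F] [IsScalarTower ℝ ℂ F] [CompleteSpace F]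
    {g : ℂ → F} {U : Set ℂ} (hU : IsOpen U) (hg : DifferentiableOn ℂ g U) {ζ : ℂ} (hζ : ζ ∈ U) {u : F → ℝ}
    (hu : ContDiffAt ℝ 2 u (g ζ)) : Lv (fun ζ => u (g ζ)) ζ 1 = Lv u (g ζ) (deriv g ζ) := by
  obtain ⟨h1, h2, h3⟩ := holo1_facts hU hg hζ
  rw [Lv_comp_holo hu h1 h2 h3, fderiv_apply_one_eq_deriv]

lemma Sys2.dphi (h : Sys2 Ω ψ Ω₂ ρ φ C s) :
    ∃ K s', 1 ≤ K ∧ 0 < s' ∧ s' ≤ s ∧ ∀ p ∈ frontier Ω, ∀ z ∈ ball p s', z ∈ Ω → ‖fderiv ℂ φ z‖ ≤ K / √(- ψ z) := by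
  have : CompleteSpace E := FiniteDimensional.complete ℂ E
  have hC0 := h.C0
  have hC := h.hC
  obtain ⟨s2, hs2, hs2s, hsm⟩ := h.rb_small (ε := 1 / C) (by positivity)
  have h' := h.mono le_rfl hs2s hs2
  refine ⟨32 * C ^ 4, s2 / 2, ?_, by positivity, by linarith, ?_⟩
  · have : 1 ≤ C ^ 4 := one_le_pow₀ hC
    linarith
  intro p hp z hz hzΩ
  have hz2 : z ∈ ball p s2 := ball_subset_ball (by linarith) hz
  set t := - ψ z with ht
  have ht0 : 0 < t := h'.psi_neg hp hz2 hzΩ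
  have hst : 0 < √t := Real.sqrt_pos.2 ht0
  refine ContinuousLinearMap.opNorm_le_of_unit_norm (by positivity) fun ξ hξ => ?_
  set R := t / (2 * C) with hR
  have hR0 : 0 < R := by positivity
  set U : Set ℂ := {ζ : ℂ | z + ζ • ξ ∈ Ω} with hU
  have hUo : IsOpen U := line_isOpen h.op z ξ
  have hdeep : ∀ ζ ∈ closedBall (0:ℂ) R, z + ζ • ξ ∈ ball p s2 ∧ z + ζ • ξ ∈ Ω := by
    intro ζ hζ
    have h1 : z + ζ • ξ ∈ closedBall z R := line_mem hξ.le (by simpa using hζ)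
    have := h'.deep hp hz hzΩ (x := z + ζ • ξ) (by rw [← dist_eq_norm]; exact h1)
    exact ⟨this.1, this.2.1⟩
  have hsub : closedBall (0:ℂ) R ⊆ U := fun ζ hζ => (hdeep ζ hζ).2
  have hgd := line_diffOn h.op h.hol z ξ
  set g : ℂ → E := fun ζ => φ (z + ζ • ξ) with hg
  have hkap : ∀ x ∈ ball p s2, x ∈ Ω → C * (- ρ (φ x)) ≤ 1 := by
    intro x hx hxΩ
    have h1 := hsm p hp x hx
    rw [rb_in hxΩ, abs_of_neg (h.neg _ (h.maps x hxΩ)), le_div_iff₀ hC0] at h1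
    linarith
  have hu : ∀ x ∈ Ω, ContDiffAt ℝ 2 (fun w => ρ w + (C / 4) * ρ w ^ 2) (φ x) := fun x hx =>
    (h.rho_cd hx).add (contDiffAt_const.mul ((h.rho_cd hx).pow 2))
  have hdg : ∀ ζ, deriv (fun ζ => g ζ - g 0) ζ = deriv g ζ := fun ζ => by simp
  have key := disc_lemma (g := fun ζ => g ζ - g 0) (V := fun ζ => ρ (g ζ) + (C / 4) * ρ (g ζ) ^ 2) (R := R) (c := 1 / (8 * C)) (M := 0)
    hUo hsub hR0 (by positivity) (hgd.sub_const _) (by simp) ?_ ?_ ?_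
  · rw [hdg, show deriv g 0 = fderiv ℂ φ z ξ by
      have := line_deriv (φ := φ) (z := z) (ξ := ξ) (ζ := 0) (by simpa using h.phi_d hzΩ)
      simpa using this] at key
    have h1 : 0 - (ρ (g 0) + (C / 4) * ρ (g 0) ^ 2) ≤ C * t := by
      have h2 := h'.up p hp z hz2 hzΩ
      rw [rb_in hzΩ] at h2
      have h3 : g 0 = φ z := by simp [hg]
      rw [h3]
      have : 0 ≤ (C / 4) * ρ (φ z) ^ 2 := by positivity
      linarith
    have h4 := key.trans h1
    rw [le_div_iff₀ hst]
    have h5 : (‖fderiv ℂ φ z ξ‖ * √t) ^ 2 ≤ 32 * C ^ 4 := by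
      rw [mul_pow, Real.sq_sqrt ht0.le]
      have h6 : 1 / (8 * C) * ‖fderiv ℂ φ z ξ‖ ^ 2 * R ^ 2 = (‖fderiv ℂ φ z ξ‖ ^ 2 * t) * (t / (32 * C ^ 3)) := by
        rw [hR]; field_simp; ring
      rw [h6] at h4
      have h7 : C * t = (32 * C ^ 4) * (t / (32 * C ^ 3)) := by field_simp
      rw [h7] at h4
      exact le_of_mul_le_mul_right h4 (by positivity)
    have h8 : 1 ≤ 32 * C ^ 4 := by
      have : 1 ≤ C ^ 4 := one_le_pow₀ hC
      linarith
    nlinarith [mul_nonneg (norm_nonneg (fderiv ℂ φ z ξ)) hst.le]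
  · intro ζ hζ
    exact ContDiffAt.comp (g := fun w => ρ w + (C / 4) * ρ w ^ 2) ζ (hu _ (hdeep ζ hζ).2) (holo1_facts hUo hgd (hsub hζ)).1
  · intro ζ hζ
    obtain ⟨h1, h2⟩ := hdeep ζ hζ
    rw [hdg, Lv_line hUo hgd (hsub hζ) (u := fun w => ρ w + (C / 4) * ρ w ^ 2) (hu _ h2), Lv_addsq (h.rho_cd h2)]
    have h3 := (h'.T p hp _ h1 h2).hor (deriv g ζ)
    have h4 := hkap _ h1 h2
    have h5 := h.psh _ (h.maps _ h2) (deriv g ζ)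
    have h6 := Qf_nonneg ρ (φ (z + ζ • ξ)) (deriv g ζ)
    change ‖deriv g ζ‖ ^ 2 ≤ C * (Lv ρ (g ζ) (deriv g ζ) + C * Qf ρ (g ζ) (deriv g ζ)) at h3
    change 0 ≤ Lv ρ (g ζ) (deriv g ζ) at h5
    change C * (- ρ (g ζ)) ≤ 1 at h4
    change 0 ≤ Qf ρ (g ζ) (deriv g ζ) at h6
    have h7 : 4 * (1 / (8 * C)) * ‖deriv g ζ‖ ^ 2 ≤ 4 * (1 / (8 * C)) * (C * (Lv ρ (g ζ) (deriv g ζ) + C * Qf ρ (g ζ) (deriv g ζ))) := by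
      gcongr
    have h8 : 4 * (1 / (8 * C)) * (C * (Lv ρ (g ζ) (deriv g ζ) + C * Qf ρ (g ζ) (deriv g ζ))) = (1/2) * (Lv ρ (g ζ) (deriv g ζ) + C * Qf ρ (g ζ) (deriv g ζ)) := by
      field_simp; ring
    rw [h8] at h7
    refine h7.trans ?_
    nlinarith
  · intro ζ hζ
    obtain ⟨h1, h2⟩ := hdeep ζ hζ
    have h4 := hkap _ h1 h2
    have h5 := h.neg _ (h.maps _ h2)
    change C * (- ρ (g ζ)) ≤ 1 at h4
    change ρ (g ζ) < 0 at h5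
    nlinarith

end Sys2Sec


section Sys3Sec
variable {E : Type*} [NormedAddCommGroup E] [InnerProductSpace ℂ E] [NormedSpace ℝ E] [IsScalarTower ℝ ℂ E]

open scoped ContDiff

/-- the standing data together with the first order estimates -/
structure Sys3 (Ω : Set E) (ψ : E → ℝ) (Ω₂ : Set E) (ρ : E → ℝ) (φ : E → E) (C s : ℝ) : Prop
    extends Sys2 Ω ψ Ω₂ ρ φ C s where
  dphi : ∀ p ∈ frontier Ω, ∀ z ∈ ball p s, z ∈ Ω → ‖fderiv ℂ φ z‖ ≤ C / √(- ψ z)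
  dphi2 : ∀ p ∈ frontier Ω, ∀ z ∈ ball p s, z ∈ Ω → ∀ x, ‖x - z‖ ≤ - ψ z / C →
    x ∈ Ω ∧ ‖fderiv ℂ φ x - fderiv ℂ φ z‖ ≤ C / (√(- ψ z) * (- ψ z)) * ‖x - z‖ ∧ ‖φ x - φ z‖ ≤ C / √(- ψ z) * ‖x - z‖
  dr : ∀ p ∈ frontier Ω, ∀ z ∈ ball p s, z ∈ Ω → ‖fderiv ℝ (rb Ω ρ φ) z‖ ≤ C
  lip : ∀ p ∈ frontier Ω, ∀ x ∈ ball p s, ∀ y ∈ ball p s, |rb Ω ρ φ y - rb Ω ρ φ x| ≤ C * ‖y - x‖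

variable [FiniteDimensional ℂ E]
variable {Ω : Set E} {ψ : E → ℝ} {Ω₂ : Set E} {ρ : E → ℝ} {φ : E → E} {C s : ℝ}

lemma Sys3.mono {C' s' : ℝ} (h : Sys3 Ω ψ Ω₂ ρ φ C s) (hC : C ≤ C') (hs : s' ≤ s) (hs0 : 0 < s') :
    Sys3 Ω ψ Ω₂ ρ φ C' s' where
  toSys2 := h.toSys2.mono hC hs hs0
  dphi := fun p hp z hz hzΩ => (h.dphi p hp z (ball_subset_ball hs hz) hzΩ).trans (by gcongr)
  dphi2 := fun p hp z hz hzΩ x hx => by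
    have h0 := h.C0
    have h1 := h.psi_neg hp (ball_subset_ball hs hz) hzΩ
    have h2 := h.dphi2 p hp z (ball_subset_ball hs hz) hzΩ x (hx.trans (by gcongr))
    exact ⟨h2.1, h2.2.1.trans (by gcongr), h2.2.2.trans (by gcongr)⟩
  dr := fun p hp z hz hzΩ => (h.dr p hp z (ball_subset_ball hs hz) hzΩ).trans hC
  lip := fun p hp x hx y hy => (h.lip p hp x (ball_subset_ball hs hx) y (ball_subset_ball hs hy)).trans (by gcongr)

lemma Sys2.dphi_near (h : Sys2 Ω ψ Ω₂ ρ φ C s)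
    (hd : ∀ p ∈ frontier Ω, ∀ z ∈ ball p s, z ∈ Ω → ‖fderiv ℂ φ z‖ ≤ C / √(- ψ z)) {p z x : E} (hp : p ∈ frontier Ω)
    (hz : z ∈ ball p (s / 2)) (hzΩ : z ∈ Ω)
    (hx : ‖x - z‖ ≤ - ψ z / (2 * C)) : x ∈ Ω ∧ ‖fderiv ℂ φ x‖ ≤ 2 * C / √(- ψ z) := by
  have hC := h.C0
  have hs := h.s0
  obtain ⟨h1, h2, h3, h4⟩ := h.deep hp hz hzΩ hx
  refine ⟨h2, (hd p hp x h1 h2).trans ?_⟩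
  have ht := h.psi_neg hp (ball_subset_ball (by linarith) hz) hzΩ
  rw [div_le_div_iff₀ (Real.sqrt_pos.2 (by linarith)) (Real.sqrt_pos.2 ht)]
  have h5 : √(- ψ z) ≤ 2 * √(- ψ x) := by
    rw [Real.sqrt_le_left (by positivity), mul_pow, Real.sq_sqrt (by linarith)]
    linarith
  nlinarith

lemma Sys2.dphi2 (h : Sys2 Ω ψ Ω₂ ρ φ C s)
    (hd : ∀ p ∈ frontier Ω, ∀ z ∈ ball p s, z ∈ Ω → ‖fderiv ℂ φ z‖ ≤ C / √(- ψ z)) {p z x : E} (hp : p ∈ frontier Ω)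
    (hz : z ∈ ball p (s / 2)) (hzΩ : z ∈ Ω)
    (hx : ‖x - z‖ ≤ - ψ z / (4 * C)) : x ∈ Ω ∧
      ‖fderiv ℂ φ x - fderiv ℂ φ z‖ ≤ 8 * C ^ 2 / (√(- ψ z) * (- ψ z)) * ‖x - z‖ ∧
      ‖φ x - φ z‖ ≤ 2 * C / √(- ψ z) * ‖x - z‖ := by
  have : CompleteSpace E := FiniteDimensional.complete ℂ E
  have hC := h.C0
  have hs := h.s0
  have ht := h.psi_neg hp (ball_subset_ball (by linarith) hz) hzΩ
  set t := - ψ z with htd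
  have hst := Real.sqrt_pos.2 ht
  have hR : 0 < t / (4 * C) := by positivity
  have hsum : t / (4 * C) + t / (4 * C) = t / (2 * C) := by field_simp; norm_num
  have hin : ∀ u ∈ closedBall z (t / (4 * C)), ∀ y ∈ closedBall u (t / (4 * C)), y ∈ Ω ∧ ‖fderiv ℂ φ y‖ ≤ 2 * C / √t := by
    intro u hu y hy
    refine h.dphi_near hd hp hz hzΩ ?_
    rw [mem_closedBall] at hu hy
    rw [← dist_eq_norm]
    linarith [dist_triangle y u z]
  have hz' : z ∈ closedBall z (t / (4 * C)) := mem_closedBall_self hR.le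
  have hx' : x ∈ closedBall z (t / (4 * C)) := by rw [mem_closedBall, dist_eq_norm]; exact hx
  have hself : ∀ u ∈ closedBall z (t / (4 * C)), u ∈ Ω ∧ ‖fderiv ℂ φ u‖ ≤ 2 * C / √t := fun u hu => hin u hu u (mem_closedBall_self hR.le)
  refine ⟨(hself x hx').1, ?_, ?_⟩
  · refine (convex_closedBall z (t / (4 * C))).norm_image_sub_le_of_norm_fderiv_le (𝕜 := ℂ) (fun u hu => h.phi_d2 (hself u hu).1) (fun u hu => ?_) hz' hx'
    have h1 := cauchy_fderiv h.op (holo_fderiv h.op h.hol) hR (by positivity) (fun y hy => (hin u hu y hy).1) (fun y hy => (hin u hu y hy).2)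
    refine h1.trans (le_of_eq ?_)
    field_simp; ring
  · exact (convex_closedBall z (t / (4 * C))).norm_image_sub_le_of_norm_fderiv_le (𝕜 := ℂ) (fun u hu => h.phi_d (hself u hu).1) (fun u hu => (hself u hu).2) hz' hx'

/-- the complex linear functional with given real part -/
lemma exists_cfun (f : E →L[ℝ] ℝ) : ∃ l : E →L[ℂ] ℂ, ∀ x, (l x).re = f x :=
  ⟨StrongDual.extendRCLike (𝕜 := ℂ) f, fun x => StrongDual.re_extendRCLike_apply (𝕜 := ℂ) f x⟩

lemma Sys2.dr (h : Sys2 Ω ψ Ω₂ ρ φ C s) (hsC : s ≤ 1 / C ^ 3)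
    (hd : ∀ p ∈ frontier Ω, ∀ z ∈ ball p s, z ∈ Ω → ‖fderiv ℂ φ z‖ ≤ C / √(- ψ z)) {p z : E} (hp : p ∈ frontier Ω)
    (hz : z ∈ ball p (s / 2)) (hzΩ : z ∈ Ω) : ‖fderiv ℝ (rb Ω ρ φ) z‖ ≤ 32 * C ^ 2 := by
  have hC := h.C0
  have hs := h.s0
  have hzs : z ∈ ball p s := ball_subset_ball (by linarith) hz
  have ht := h.psi_neg hp hzs hzΩ
  have htle : - ψ z ≤ 1 / C ^ 2 := by
    have h1 := h.psi_le hp hzs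
    rw [abs_of_neg (by linarith)] at h1
    have h2 : ‖z - p‖ ≤ 1 / C ^ 3 := by rw [← dist_eq_norm]; exact hzs.le.trans hsC
    calc - ψ z ≤ C * (1 / C ^ 3) := h1.trans (by gcongr)
      _ = 1 / C ^ 2 := by field_simp
  set t := - ψ z with htd
  have hst := Real.sqrt_pos.2 ht
  have hst1 : √t ≤ 1 / C := by
    rw [Real.sqrt_le_left (by positivity)]; rw [div_pow, one_pow]; exact htle
  refine ContinuousLinearMap.opNorm_le_of_unit_norm (by positivity) fun ξ hξ => ?_
  obtain ⟨l, hl⟩ := exists_cfun (fderiv ℝ ρ (φ z))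
  set R := t / (4 * C) with hR
  have hR0 : 0 < R := by positivity
  have hTP := h.T p hp z hzs hzΩ
  have hpt : ∀ ζ ∈ ball (0:ℂ) R, z + ζ • ξ ∈ Ω ∧ ‖φ (z + ζ • ξ) - φ z‖ ≤ √t / 2 := by
    intro ζ hζ
    have hn : ‖ζ‖ < R := by simpa using hζ
    have h1 : ‖(z + ζ • ξ) - z‖ ≤ R := by
      rw [← dist_eq_norm]; exact line_mem hξ.le hn.le
    have h2 := h.dphi2 hd hp hz hzΩ h1
    refine ⟨h2.1, h2.2.2.trans ?_⟩
    calc 2 * C / √t * ‖(z + ζ • ξ) - z‖ ≤ 2 * C / √t * R := by gcongr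
      _ = (t / √t) / 2 := by rw [hR]; field_simp; ring
      _ = √t / 2 := by rw [Real.div_sqrt]
  have hG : DifferentiableOn ℂ (fun ζ : ℂ => l (φ (z + ζ • ξ) - φ z)) (ball 0 R) := by
    intro ζ hζ
    have h1 := line_diffOn h.op h.hol z ξ
    exact (l.differentiableAt.comp_differentiableWithinAt (x := ζ)  ((h1 ζ (hpt ζ hζ).1).sub_const (φ z))).mono (fun ζ' hζ' => (hpt ζ' hζ').1)
  have key := (bc1 (M := 2 * C * t) hR0 (by positivity) hG (by simp) ?_).1
  · have hder : deriv (fun ζ : ℂ => l (φ (z + ζ • ξ) - φ z)) 0 = l (fderiv ℂ φ z ξ) := by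
      have h1 : HasDerivAt (fun ζ : ℂ => φ (z + ζ • ξ)) (fderiv ℂ φ z ξ) 0 := by
        have h2 : HasFDerivAt φ (fderiv ℂ φ z) (z + (0:ℂ) • ξ) := by simpa using (h.phi_d hzΩ).hasFDerivAt
        exact h2.comp_hasDerivAt 0 (line_hasDerivAt z ξ 0)
      exact (l.hasFDerivAt.comp_hasDerivAt (0:ℂ) (h1.sub_const (φ z))).deriv
    rw [hder] at key
    rw [h.fd_rb hzΩ, ← hl, Real.norm_eq_abs]
    refine (Complex.abs_re_le_norm _).trans (key.trans (le_of_eq ?_))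
    rw [hR]; field_simp; ring
  · intro ζ hζ
    rw [hl]
    obtain ⟨h1, h2⟩ := hpt ζ hζ
    have hball : φ (z + ζ • ξ) ∈ ball (φ z) (1 / C) := by
      rw [mem_ball, dist_eq_norm]
      have : 0 < 1 / C := by positivity
      linarith
    have h3 := taylor2 (f := ρ) (convex_ball (φ z) (1 / C)) (fun x hx => (hTP.cd x hx).differentiableAt (by simp))
      (fun x hx => cda_fderiv_diff ((hTP.cd x hx).of_le (WithTop.coe_le_coe.2 le_top))) (fun x hx => hTP.d2 x hx) (mem_ball_self (by positivity)) hball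
    rw [Real.norm_eq_abs] at h3
    have h4 := (abs_le.1 h3).1
    have h5 := h.neg _ (h.maps _ h1)
    have h6 := h.up p hp z hzs hzΩ
    rw [rb_in hzΩ] at h6
    have h7 : C * ‖φ (z + ζ • ξ) - φ z‖ ^ 2 ≤ C * (√t / 2) ^ 2 := by gcongr
    rw [div_pow, Real.sq_sqrt ht.le] at h7
    have h8 : 0 < C * t := by positivity
    linarith

lemma Sys2.lip (h : Sys2 Ω ψ Ω₂ ρ φ C s)
    (hd : ∀ p ∈ frontier Ω, ∀ z ∈ ball p s, z ∈ Ω → ‖fderiv ℝ (rb Ω ρ φ) z‖ ≤ C) {p x y : E} (hp : p ∈ frontier Ω)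
    (hx : x ∈ ball p s) (hy : y ∈ ball p s) : |rb Ω ρ φ y - rb Ω ρ φ x| ≤ C ^ 2 * ‖y - x‖ := by
  have hC := h.C0
  have hC1 := h.hC
  have hseg : segment ℝ x y ⊆ ball p s := (convex_ball p s).segment_subset hx hy
  by_cases hsub : segment ℝ x y ⊆ Ω
  · have h1 := mv1 (f := rb Ω ρ φ) (convex_segment x y) (fun u hu => (h.r_cd (hsub hu)).differentiableAt (by norm_num))
      (fun u hu => hd p hp u (hseg hu) (hsub hu)) (left_mem_segment ℝ x y) (right_mem_segment ℝ x y)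
    rw [Real.norm_eq_abs] at h1
    refine h1.trans ?_
    gcongr
    nlinarith
  · rw [Set.not_subset] at hsub
    obtain ⟨u, hu, huΩ⟩ := hsub
    have hus := hseg hu
    have hψu : 0 ≤ ψ u := by
      by_contra hcon
      exact huΩ ((h.D p hp u hus).mem.2 (not_le.1 hcon))
    have hb : ∀ v ∈ ball p s, |rb Ω ρ φ v| ≤ C ^ 2 * dist v u := by
      intro v hv
      by_cases hvΩ : v ∈ Ω
      · have h1 := h.up p hp v hv hvΩ
        rw [abs_of_neg (h.rb_neg hvΩ)]
        have h2 := (abs_le.1 (h.psi_lip hp hus hv)).1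
        rw [dist_eq_norm]
        nlinarith
      · rw [rb_out hvΩ, abs_zero]; positivity
    have h1 := hb x hx
    have h2 := hb y hy
    have h3 : dist x u + dist u y = dist x y := dist_add_dist_of_mem_segment hu
    rw [← dist_eq_norm, dist_comm y x, ← h3, dist_comm u y]
    refine (abs_sub _ _).trans ?_
    linarith

lemma Sys2.exists3 (h : Sys2 Ω ψ Ω₂ ρ φ C s) : ∃ C' s', Sys3 Ω ψ Ω₂ ρ φ C' s' := by
  obtain ⟨K1, s1, hK1, hs1, hs1s, hd⟩ := h.dphi
  have hC1 := h.hC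
  have hC0 := h.C0
  set D := C + K1 with hD
  have hD1 : 1 ≤ D := by linarith
  set s2 := min s1 (1 / D ^ 3) with hs2
  have hs20 : 0 < s2 := lt_min hs1 (by positivity)
  have h1 : Sys2 Ω ψ Ω₂ ρ φ D s2 := h.mono (by linarith) ((min_le_left _ _).trans hs1s) hs20
  have hd1 : ∀ p ∈ frontier Ω, ∀ z ∈ ball p s2, z ∈ Ω → ‖fderiv ℂ φ z‖ ≤ D / √(- ψ z) := fun p hp z hz hzΩ =>
    (hd p hp z (ball_subset_ball (min_le_left _ _) hz) hzΩ).trans (by gcongr; linarith)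
  set D2 := 32 * D ^ 2 with hD2
  have hD12 : D ≤ D2 := by nlinarith
  have h2 : Sys2 Ω ψ Ω₂ ρ φ D2 (s2 / 2) := h1.mono hD12 (by linarith) (by linarith)
  have hdr : ∀ p ∈ frontier Ω, ∀ z ∈ ball p (s2 / 2), z ∈ Ω → ‖fderiv ℝ (rb Ω ρ φ) z‖ ≤ D2 := fun p hp z hz hzΩ =>
    h1.dr (min_le_right _ _) hd1 hp hz hzΩ
  have hD21 : 1 ≤ D2 := hD1.trans hD12
  have hD22 : D2 ≤ D2 ^ 2 := by nlinarith
  refine ⟨D2 ^ 2, s2 / 2, h2.mono hD22 le_rfl (by linarith), ?_, ?_, ?_, ?_⟩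
  · intro p hp z hz hzΩ
    exact (hd1 p hp z (ball_subset_ball (by linarith) hz) hzΩ).trans (by gcongr; linarith)
  · intro p hp z hz hzΩ x hx
    have ht := h2.psi_neg hp hz hzΩ
    obtain ⟨a1, a2, a3⟩ := h1.dphi2 hd1 hp hz hzΩ (x := x) (hx.trans (by gcongr; nlinarith))
    exact ⟨a1, a2.trans (by gcongr; nlinarith), a3.trans (by gcongr; nlinarith)⟩
  · intro p hp z hz hzΩ
    exact (hdr p hp z hz hzΩ).trans hD22
  · intro p hp x hx y hy
    exact h2.lip hdr hp hx hy

end Sys3Sec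


section Perturb
variable {E : Type*} [NormedAddCommGroup E] [InnerProductSpace ℂ E] [NormedSpace ℝ E] [IsScalarTower ℝ ℂ E]
variable [FiniteDimensional ℂ E]
variable {Ω : Set E} {ψ : E → ℝ} {Ω₂ : Set E} {ρ : E → ℝ} {φ : E → E} {C s : ℝ}

open scoped ContDiff

/-- a nonnegative function with a second order expansion cannot drop fast -/
lemma f_lower {f0 f1 f2 l lam D a C : ℝ} (hD : 0 < D) (ha : 0 < a) (hC : 0 ≤ C) (h0 : f0 = lam)
    (hf2 : 0 ≤ f2) (h1 : |f1 - f0 - l| ≤ C * D ^ 2) (h2 : |f2 - f0 - (a / D) * l| ≤ C * a ^ 2) :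
    lam - lam * D / a - C * a * D - C * D ^ 2 ≤ f1 := by
  have h3 := (abs_le.1 h1).1
  have h4 := (abs_le.1 h2).2
  have h5 : - lam - C * a ^ 2 ≤ (a / D) * l := by linarith
  have h6 : (D / a) * (- lam - C * a ^ 2) ≤ l := by
    have : (D / a) * ((a / D) * l) = l := by field_simp
    rw [← this]
    gcongr
  have h7 : (D / a) * (- lam - C * a ^ 2) = - (lam * D / a) - C * a * D := by field_simp
  linarith

lemma lv_bilin_le (M : E →L[ℝ] E →L[ℝ] ℝ) (e : E) (he : ‖e‖ = 1) : |M e e + M (I • e) (I • e)| ≤ 2 * ‖M‖ := by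
  have hI : ‖I • e‖ = 1 := by rw [norm_smul, he]; simp
  have h1 : |M e e| ≤ ‖M‖ := by simpa [he] using M.le_opNorm₂ e e
  have h2 : |M (I • e) (I • e)| ≤ ‖M‖ := by
    have := M.le_opNorm₂ (I • e) (I • e)
    rw [hI] at this
    simpa using this
  refine (abs_add_le _ _).trans ?_
  linarith

lemma TP.lower {w w' : E} (h : TP Ω₂ ρ C w) (hC : 1 ≤ C) (hw : w ∈ Ω₂) (hpsh : ∀ w ∈ Ω₂, ∀ ξ, 0 ≤ Lv ρ w ξ)
    {e : E} (he : ‖e‖ = 1) {D a : ℝ} (hD : 0 < D) (ha : 0 < a) (haC : a < 1 / C) (hDC : D < 1 / C)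
    (haρ : a < - ρ w / C) (hw' : ‖w' - w‖ ≤ D) :
    Lv ρ w e - Lv ρ w e * D / a - 2 * C * a * D - 2 * C * D ^ 2 ≤ Lv ρ w' e := by
  obtain ⟨L, hL⟩ := h.d4
  have hexp : ∀ x ∈ ball w (1 / C), |Lv ρ x e - Lv ρ w e - (L (x - w) e e + L (x - w) (I • e) (I • e))| ≤ 2 * C * ‖x - w‖ ^ 2 := by
    intro x hx
    have h1 := lv_bilin_le (D2 ρ x - D2 ρ w - L (x - w)) e he
    have h2 : 2 * ‖D2 ρ x - D2 ρ w - L (x - w)‖ ≤ 2 * C * ‖x - w‖ ^ 2 := by linarith [hL x hx]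
    refine le_trans (le_of_eq ?_) (h1.trans h2)
    unfold Lv
    simp only [sub_apply]
    congr 1; ring
  have hx2 : ‖(w + (a / D) • (w' - w)) - w‖ ≤ a := by
    rw [add_sub_cancel_left, norm_smul, Real.norm_of_nonneg (by positivity)]
    calc a / D * ‖w' - w‖ ≤ a / D * D := by gcongr
      _ = a := by field_simp
  refine f_lower (f0 := Lv ρ w e) (f2 := Lv ρ (w + (a / D) • (w' - w)) e)
    (l := L (w' - w) e e + L (w' - w) (I • e) (I • e)) hD ha (by linarith) rfl ?_ ?_ ?_
  · refine hpsh _ (h.bal hw ?_) e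
    rw [mem_ball, dist_eq_norm]; linarith
  · refine (hexp w' (by rw [mem_ball, dist_eq_norm]; linarith)).trans ?_
    gcongr
  · have h3 := hexp (w + (a / D) • (w' - w)) (by rw [mem_ball, dist_eq_norm]; linarith)
    have h4 : L ((w + (a / D) • (w' - w)) - w) = (a / D) • L (w' - w) := by
      rw [add_sub_cancel_left, map_smul]
    rw [h4] at h3
    simp only [smul_apply, smul_eq_mul] at h3
    rw [mul_add]
    refine h3.trans ?_
    gcongr

/-- the direction of the small eigenvalue upstairs -/
lemma Sys3.small_dir (h : Sys3 Ω ψ Ω₂ ρ φ C s) {p z : E} (hp : p ∈ frontier Ω) (hz : z ∈ ball p s) (hzΩ : z ∈ Ω) :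
    (∃ ξ, ξ ≠ 0 ∧ fderiv ℂ φ z ξ = 0) ∨ ∃ ξ e, fderiv ℂ φ z ξ = e ∧ ‖e‖ = 1 ∧ √(- ψ z) ≤ C * ‖ξ‖ ∧
      Lv ρ (φ z) e ≤ C ^ 5 * (- ψ z) ^ 4 ∧ ∀ η, |Bv ρ (φ z) e η| ≤ Lv ρ (φ z) e * ‖η‖ := by
  rcases ker_or_surj (fderiv ℂ φ z) with hk | hsurj
  · exact Or.inl hk
  · right
    obtain ⟨e, he, hl, hB⟩ := (h.T p hp z hz hzΩ).eig (h.maps z hzΩ)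
    obtain ⟨ξ, hξ⟩ := hsurj e
    have ht := h.psi_neg hp hz hzΩ
    have hC := h.C0
    refine ⟨ξ, e, hξ, he, ?_, hl.trans ?_, hB⟩
    · have h1 := (fderiv ℂ φ z).le_opNorm ξ
      rw [hξ, he] at h1
      have h2 := h1.trans (mul_le_mul_of_nonneg_right (h.dphi p hp z hz hzΩ) (norm_nonneg ξ))
      rw [div_mul_eq_mul_div, le_div_iff₀ (Real.sqrt_pos.2 ht)] at h2
      linarith
    · have h3 := h.up p hp z hz hzΩ
      rw [rb_in hzΩ] at h3
      have h4 := h.neg _ (h.maps z hzΩ)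
      calc C * (- ρ (φ z)) ^ 4 ≤ C * (C * (- ψ z)) ^ 4 := by gcongr; linarith
        _ = _ := by ring

lemma Sys3.lam (h : Sys3 Ω ψ Ω₂ ρ φ C s) {p z : E} (hp : p ∈ frontier Ω) (hz : z ∈ ball p s) (hzΩ : z ∈ Ω) :
    ∃ ξ, ξ ≠ 0 ∧ Lv (rb Ω ρ φ) z ξ ≤ C ^ 7 * (- ψ z) ^ 3 * ‖ξ‖ ^ 2 := by
  have ht := h.psi_neg hp hz hzΩ
  have hC := h.C0
  have hst := Real.sqrt_pos.2 ht
  rcases h.small_dir hp hz hzΩ with ⟨ξ, hξ, hk⟩ | ⟨ξ, e, hξ, he, hN, hl, -⟩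
  · refine ⟨ξ, hξ, ?_⟩
    rw [h.Lv_rb hzΩ, hk]
    have : Lv ρ (φ z) 0 = 0 := by unfold Lv; simp
    rw [this]; positivity
  · refine ⟨ξ, ?_, ?_⟩
    · rintro rfl
      rw [norm_zero, mul_zero] at hN
      linarith
    · rw [h.Lv_rb hzΩ, hξ]
      have h1 : - ψ z ≤ (C * ‖ξ‖) ^ 2 := by
        rw [← Real.sq_sqrt ht.le]; gcongr
      calc _ ≤ C ^ 5 * (- ψ z) ^ 4 := hl
        _ = C ^ 5 * (- ψ z) ^ 3 * (- ψ z) := by ring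
        _ ≤ C ^ 5 * (- ψ z) ^ 3 * (C * ‖ξ‖) ^ 2 := by gcongr
        _ = _ := by ring

/-- numerical core of the perturbation lemma -/
lemma numE {C q h N lam D f B X : ℝ} (hC : 1 ≤ C) (hq : 0 < q) (hq1 : 24 * C ^ 16 * q ≤ 1) (hh : 0 < h) (hN : q ≤ C * N)
    (hlam0 : 0 ≤ lam) (hlam : lam ≤ C ^ 5 * q ^ 8) (hh6 : h ≤ C ^ 8 * q ^ 6) (hD : D = C ^ 2 * h / q)
    (hf : lam - lam * D / q ^ 4 - 2 * C * q ^ 4 * D - 2 * C * D ^ 2 ≤ f)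
    (hB : |B| ≤ (lam + 2 * C * D) * (3 * (D / q ^ 2) * N)) (hX : h * N ^ 2 / C ≤ X) : 0 < f + 2 * B + X - lam := by
  have hC0 : 0 < C := by linarith
  have hN0 : 0 < N := by
    by_contra hcon
    push Not at hcon
    nlinarith
  have hq2 : q ≤ 1 := by
    have : 1 ≤ C ^ 16 := one_le_pow₀ hC
    nlinarith
  have hD0 : 0 < D := by rw [hD]; positivity
  have hDq : D * q = C ^ 2 * h := by rw [hD]; field_simp
  have hD5 : D ≤ C ^ 10 * q ^ 5 := by
    rw [hD, div_le_iff₀ hq]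
    calc C ^ 2 * h ≤ C ^ 2 * (C ^ 8 * q ^ 6) := by gcongr
      _ = _ := by ring
  have p5 : C ^ 5 ≤ C ^ 11 := pow_le_pow_right₀ hC (by norm_num)
  have p1 : C ≤ C ^ 11 := le_self_pow₀ hC (by norm_num)
  have hX2 : 0 < h * N ^ 2 := by positivity
  -- first error
  have e1 : lam * D / q ^ 4 + 2 * C * q ^ 4 * D + 2 * C * D ^ 2 ≤ 5 * C ^ 15 * q * (h * N ^ 2) := by
    have a1 : lam * D / q ^ 4 ≤ C ^ 11 * (q ^ 4 * D) := by
      rw [div_le_iff₀ (by positivity)]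
      calc lam * D ≤ (C ^ 5 * q ^ 8) * D := by gcongr
        _ ≤ (C ^ 11 * q ^ 8) * D := by gcongr
        _ = _ := by ring
    have a2 : 2 * C * q ^ 4 * D ≤ 2 * C ^ 11 * (q ^ 4 * D) := by
      calc 2 * C * q ^ 4 * D ≤ 2 * C ^ 11 * q ^ 4 * D := by gcongr
        _ = _ := by ring
    have a3 : 2 * C * D ^ 2 ≤ 2 * C ^ 11 * (q ^ 4 * D) := by
      calc 2 * C * D ^ 2 = 2 * C * D * D := by ring
        _ ≤ 2 * C * (C ^ 10 * q ^ 5) * D := by gcongr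
        _ ≤ 2 * C * (C ^ 10 * q ^ 4) * D := by
          gcongr 2 * C * (C ^ 10 * ?_) * D
          exact pow_le_pow_of_le_one hq.le hq2 (by norm_num)
        _ = _ := by ring
    have a4 : q ^ 4 * D ≤ C ^ 4 * q * (h * N ^ 2) := by
      calc q ^ 4 * D = q * q ^ 2 * (D * q) := by ring
        _ = q * q ^ 2 * (C ^ 2 * h) := by rw [hDq]
        _ ≤ q * (C * N) ^ 2 * (C ^ 2 * h) := by gcongr
        _ = _ := by ring
    have a5 : 5 * C ^ 11 * (q ^ 4 * D) ≤ 5 * C ^ 11 * (C ^ 4 * q * (h * N ^ 2)) := by gcongr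
    calc _ ≤ 5 * C ^ 11 * (q ^ 4 * D) := by linarith
      _ ≤ _ := a5
      _ = _ := by ring
  have e2 : 2 * |B| ≤ 18 * C ^ 14 * q * (h * N ^ 2) := by
    have b1 : lam + 2 * C * D ≤ 3 * C ^ 11 * q ^ 5 := by
      have c1 : lam ≤ C ^ 11 * q ^ 5 := by
        calc lam ≤ C ^ 5 * q ^ 8 := hlam
          _ ≤ C ^ 11 * q ^ 5 := by
            gcongr ?_ * ?_
            exact pow_le_pow_of_le_one hq.le hq2 (by norm_num)
      have c2 : 2 * C * D ≤ 2 * C ^ 11 * q ^ 5 := by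
        calc 2 * C * D ≤ 2 * C * (C ^ 10 * q ^ 5) := by gcongr
          _ = _ := by ring
      linarith
    calc 2 * |B| ≤ 2 * ((lam + 2 * C * D) * (3 * (D / q ^ 2) * N)) := by gcongr
      _ ≤ 2 * ((3 * C ^ 11 * q ^ 5) * (3 * (D / q ^ 2) * N)) := by gcongr
      _ = 18 * C ^ 11 * q ^ 2 * (D * q) * N := by field_simp; ring
      _ = 18 * C ^ 13 * h * N * q * q := by rw [hDq]; ring
      _ ≤ 18 * C ^ 13 * h * N * q * (C * N) := by gcongr
      _ = _ := by ring
  have e3 : 18 * C ^ 14 * q * (h * N ^ 2) ≤ 18 * C ^ 15 * q * (h * N ^ 2) := by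
    have : C ^ 14 ≤ C ^ 15 := pow_le_pow_right₀ hC (by norm_num)
    gcongr
  have e4 : 24 * C ^ 15 * q * (h * N ^ 2) ≤ h * N ^ 2 / C := by
    rw [le_div_iff₀ hC0]
    calc 24 * C ^ 15 * q * (h * N ^ 2) * C = 24 * C ^ 16 * q * (h * N ^ 2) := by ring
      _ ≤ 1 * (h * N ^ 2) := by gcongr
      _ = _ := one_mul _
  have e5 : 0 < C ^ 15 * q * (h * N ^ 2) := by positivity
  have := neg_abs_le B
  linarith

set_option maxHeartbeats 1000000 in
lemma Sys3.lemE (h : Sys3 Ω ψ Ω₂ ρ φ C s) {p z z' : E} {S : E →L[ℂ] E} {d : ℝ} (hp : p ∈ frontier Ω) (hz : z ∈ ball p s) (hzΩ : z ∈ Ω)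
    (hz' : z' ∈ Ω) (hd : 0 < d) (hzz : ‖z' - z‖ ≤ C * d) (hS : ‖S - 1‖ ≤ C * d) (hq1 : 24 * C ^ 16 * √(- ψ z) ≤ 1) :
    ∃ ξ, 0 < Lv (rb Ω ρ φ) z' (S ξ) + d * Lv ψ z ξ - Lv (rb Ω ρ φ) z ξ := by
  have ht := h.psi_neg hp hz hzΩ
  have hC := h.C0
  have hC1 := h.hC
  have hlv := (h.D p hp z hz).lv
  set q := √(- ψ z) with hqd
  have hq : 0 < q := Real.sqrt_pos.2 ht
  have hqt : - ψ z = q ^ 2 := (Real.sq_sqrt ht.le).symm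
  rcases h.small_dir hp hz hzΩ with ⟨ξ, hξ, hk⟩ | ⟨ξ, e, hξ, he, hN, hl, hB⟩
  · refine ⟨ξ, ?_⟩
    have h1 := h.Lv_rb_nonneg hz' (S ξ)
    have h2 : Lv (rb Ω ρ φ) z ξ = 0 := by
      rw [h.Lv_rb hzΩ, hk]; unfold Lv; simp
    have h3 : 0 < Lv ψ z ξ := by
      have h3 := norm_pos_iff.2 hξ
      by_contra hcon
      push Not at hcon
      nlinarith [sq_pos_of_pos h3, hlv ξ]
    have := mul_pos hd h3
    linarith
  · refine ⟨ξ, ?_⟩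
    have hL : ‖ξ‖ ^ 2 / C ≤ Lv ψ z ξ := by rw [div_le_iff₀ hC]; linarith [hlv ξ]
    have hX : d * ‖ξ‖ ^ 2 / C ≤ d * Lv ψ z ξ := by
      calc d * ‖ξ‖ ^ 2 / C = d * (‖ξ‖ ^ 2 / C) := by ring
        _ ≤ _ := by gcongr
    rw [h.Lv_rb hzΩ, hξ]
    set lam := Lv ρ (φ z) e with hlam
    have hlam0 : 0 ≤ lam := h.psh _ (h.maps z hzΩ) e
    have h0 := h.Lv_rb_nonneg hz' (S ξ)
    by_cases hcase : lam < d * ‖ξ‖ ^ 2 / C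
    · linarith
    push Not at hcase
    have hqle : q ≤ 1 := by
      have : 1 ≤ C ^ 16 := one_le_pow₀ hC1
      nlinarith
    have hCq : C ^ 16 * q < 1 := by
      have : 0 < C ^ 16 * q := by positivity
      linarith
    rw [hqt] at hl
    have hl' : lam ≤ C ^ 5 * q ^ 8 := by rw [show C ^ 5 * q ^ 8 = C ^ 5 * (q ^ 2) ^ 4 by ring]; exact hl
    have hd6 : d ≤ C ^ 8 * q ^ 6 := by
      have h1 : d * ‖ξ‖ ^ 2 ≤ C ^ 6 * q ^ 8 := by
        rw [div_le_iff₀ hC] at hcase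
        calc d * ‖ξ‖ ^ 2 ≤ lam * C := hcase
          _ ≤ C ^ 5 * q ^ 8 * C := by gcongr
          _ = _ := by ring
      have h2 : d * q ^ 2 ≤ C ^ 8 * q ^ 6 * q ^ 2 := by
        calc d * q ^ 2 ≤ d * (C * ‖ξ‖) ^ 2 := by gcongr
          _ = C ^ 2 * (d * ‖ξ‖ ^ 2) := by ring
          _ ≤ C ^ 2 * (C ^ 6 * q ^ 8) := by gcongr
          _ = _ := by ring
      exact le_of_mul_le_mul_right h2 (by positivity)
    -- powers of q against powers of C
    have hpow : ∀ m k : ℕ, m ≤ 16 → 1 ≤ k → C ^ m * q ^ k < 1 := by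
      intro m k hm hk
      calc C ^ m * q ^ k ≤ C ^ 16 * q ^ 1 :=
            mul_le_mul (pow_le_pow_right₀ hC1 hm) (pow_le_pow_of_le_one hq.le hqle hk) (by positivity) (by positivity)
        _ < 1 := by rw [pow_one]; exact hCq
    set D := C ^ 2 * d / q with hD
    have hD0 : 0 < D := by positivity
    have hD5 : D ≤ C ^ 10 * q ^ 5 := by
      rw [hD, div_le_iff₀ hq]
      calc C ^ 2 * d ≤ C ^ 2 * (C ^ 8 * q ^ 6) := by gcongr
        _ = _ := by ring
    have hDC : D < 1 / C := by
      rw [lt_div_iff₀ hC]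
      calc D * C ≤ C ^ 10 * q ^ 5 * C := by gcongr
        _ = C ^ 11 * q ^ 5 := by ring
        _ < 1 := hpow 11 5 (by norm_num) (by norm_num)
    have hCd : C * d ≤ q ^ 2 / C := by
      rw [le_div_iff₀ hC]
      calc C * d * C ≤ C * (C ^ 8 * q ^ 6) * C := by gcongr
        _ = (C ^ 10 * q ^ 4) * q ^ 2 := by ring
        _ ≤ 1 * q ^ 2 := by gcongr; exact (hpow 10 4 (by norm_num) (by norm_num)).le
        _ = _ := one_mul _
    have hCd1 : C * d ≤ 1 := hCd.trans (by
      rw [div_le_iff₀ hC]; nlinarith)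
    obtain ⟨-, hp1, hp2⟩ := h.dphi2 p hp z hz hzΩ z' (by rw [hqt]; exact hzz.trans hCd)
    have hp0 := h.dphi p hp z hz hzΩ
    rw [← hqd] at hp0 hp1 hp2
    rw [hqt] at hp1
    have hTP := h.T p hp z hz hzΩ
    have hw' : ‖φ z' - φ z‖ ≤ D := by
      calc ‖φ z' - φ z‖ ≤ C / q * (C * d) := hp2.trans (by gcongr)
        _ = D := by rw [hD]; ring
    have hρ : q ^ 2 / C ≤ - ρ (φ z) := by
      have := h.lo p hp z hz hzΩ
      rw [rb_in hzΩ, hqt] at this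
      rw [div_le_iff₀ hC]; linarith
    have hq4 : q ^ 4 < 1 / C := by
      rw [lt_div_iff₀ hC]
      have := hpow 1 4 (by norm_num) (by norm_num)
      linarith
    have hq4' : q ^ 4 < - ρ (φ z) / C := by
      rw [lt_div_iff₀ hC]
      refine lt_of_lt_of_le ?_ hρ
      rw [lt_div_iff₀ hC]
      calc q ^ 4 * C * C = (C ^ 2 * q ^ 2) * q ^ 2 := by ring
        _ < 1 * q ^ 2 := by gcongr; exact hpow 2 2 (by norm_num) (by norm_num)
        _ = q ^ 2 := one_mul _
    have hf := hTP.lower hC1 (h.maps z hzΩ) h.psh he hD0 (by positivity : 0 < q ^ 4) hq4 hDC hq4' hw'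
    set ε := fderiv ℂ φ z' (S ξ) - e with hε
    have hεn : ‖ε‖ ≤ 3 * (D / q ^ 2) * ‖ξ‖ := by
      have h1 : ε = (fderiv ℂ φ z' - fderiv ℂ φ z) (ξ + (S - 1) ξ) + fderiv ℂ φ z ((S - 1) ξ) := by
        rw [hε, ← hξ]; simp
      have h2 : ‖(S - 1) ξ‖ ≤ C * d * ‖ξ‖ := (S - 1).le_of_opNorm_le hS ξ
      have h3 : ‖ξ + (S - 1) ξ‖ ≤ 2 * ‖ξ‖ := by
        refine (norm_add_le _ _).trans ?_
        have : C * d * ‖ξ‖ ≤ 1 * ‖ξ‖ := by gcongr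
        linarith
      have h4 : ‖(fderiv ℂ φ z' - fderiv ℂ φ z) (ξ + (S - 1) ξ)‖ ≤ (C / (q * q ^ 2) * (C * d)) * (2 * ‖ξ‖) := by
        refine ((fderiv ℂ φ z' - fderiv ℂ φ z).le_of_opNorm_le hp1 _).trans ?_
        gcongr
      have h5 : ‖fderiv ℂ φ z ((S - 1) ξ)‖ ≤ (C / q) * (C * d * ‖ξ‖) := by
        refine ((fderiv ℂ φ z).le_of_opNorm_le hp0 _).trans ?_
        gcongr
      have h6 : (C / (q * q ^ 2) * (C * d)) * (2 * ‖ξ‖) = 2 * (D / q ^ 2) * ‖ξ‖ := by rw [hD]; field_simp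
      have h7 : (C / q) * (C * d * ‖ξ‖) ≤ (D / q ^ 2) * ‖ξ‖ := by
        have : (C / q) * (C * d * ‖ξ‖) = D * ‖ξ‖ := by rw [hD]; field_simp
        rw [this]
        gcongr
        rw [le_div_iff₀ (by positivity)]
        have : q ^ 2 ≤ 1 := pow_le_one₀ hq.le hqle
        nlinarith
      rw [h1]
      refine (norm_add_le _ _).trans ?_
      linarith
    have hBw : |Bv ρ (φ z') e ε| ≤ (lam + 2 * C * D) * (3 * (D / q ^ 2) * ‖ξ‖) := by
      have hb : φ z' ∈ ball (φ z) (1 / C) := by rw [mem_ball, dist_eq_norm]; linarith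
      have h1 := Bv_sub_le ((hTP.d3 _ hb).trans (by gcongr : C * ‖φ z' - φ z‖ ≤ C * D)) e ε
      rw [he, mul_one] at h1
      have h2 := hB ε
      have h3 : |Bv ρ (φ z') e ε| ≤ (lam + 2 * C * D) * ‖ε‖ := by
        have := abs_sub_abs_le_abs_sub (Bv ρ (φ z') e ε) (Bv ρ (φ z) e ε)
        linarith
      exact h3.trans (by gcongr)
    have hnum := numE hC1 hq hq1 hd hN hlam0 hl' hd6 hD hf hBw hX
    have hLz' : Lv (rb Ω ρ φ) z' (S ξ) = Lv ρ (φ z') e + 2 * Bv ρ (φ z') e ε + Lv ρ (φ z') ε := by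
      rw [h.Lv_rb hz', ← Lv_add_vec (h.rho_cd hz')]
      congr 1
      rw [hε]; abel
    have h9 := h.psh _ (h.maps z' hz') ε
    rw [hLz']
    linarith

end Perturb


section ShiftSec
variable {E : Type*} [NormedAddCommGroup E] [InnerProductSpace ℂ E] [NormedSpace ℝ E] [IsScalarTower ℝ ℂ E]

open scoped ContDiff

variable [FiniteDimensional ℂ E]
variable {Ω : Set E} {ψ : E → ℝ} {Ω₂ : Set E} {ρ : E → ℝ} {φ : E → E} {C s : ℝ}

lemma cfun_norm {f : E →L[ℝ] ℝ} {l : E →L[ℂ] ℂ} (hl : ∀ x, (l x).re = f x) (x : E) : ‖l x‖ ≤ ‖f‖ * ‖x‖ := by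
  by_cases h0 : l x = 0
  · rw [h0, norm_zero]; positivity
  have hn : 0 < ‖l x‖ := norm_pos_iff.2 h0
  have h1 := hl ((starRingEnd ℂ (l x)) • x)
  rw [map_smul, smul_eq_mul, Complex.conj_mul', ← Complex.ofReal_pow, Complex.ofReal_re] at h1
  have h2 := (le_abs_self _).trans (f.le_opNorm ((starRingEnd ℂ (l x)) • x))
  rw [← h1, norm_smul, RCLike.norm_conj] at h2
  nlinarith

lemma psi_nonpos (h : Sys Ω ψ Ω₂ ρ φ C s) {p z : E} (hp : p ∈ frontier Ω) (hz : z ∈ ball p s) (hzc : z ∈ closure Ω) : ψ z ≤ 0 := by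
  by_cases hzΩ : z ∈ Ω
  · exact ((h.D p hp z hz).mem.1 hzΩ).le
  · exact (h.zero z (by rw [h.op.frontier_eq]; exact ⟨hzc, hzΩ⟩)).le

/-- real linear multiplication by `I` -/
def Jm (E : Type*) [NormedAddCommGroup E] [InnerProductSpace ℂ E] [NormedSpace ℝ E] [IsScalarTower ℝ ℂ E] : E →L[ℝ] E :=
  (I • (ContinuousLinearMap.id ℂ E)).restrictScalars ℝ

lemma Jm_apply (x : E) : Jm E x = I • x := by simp [Jm]

lemma Sys.kappa (h : Sys Ω ψ Ω₂ ρ φ C s) {p : E} (hp : p ∈ frontier Ω) :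
    ∃ κ : E → ℝ, ContDiff ℝ 2 κ ∧ (∀ z ξ, Lv κ z ξ = 0) ∧
      (∀ z ∈ closure Ω, z ∈ ball p s → 8 * C ^ 2 * ‖z - p‖ ≤ 1 → ‖z - p‖ ^ 2 ≤ 8 * C * κ z) ∧
      (∀ z, ‖z - p‖ ≤ 1 → |κ z| ≤ 2 * C * ‖z - p‖) := by
  have hC := h.C0
  have hpB : p ∈ ball p s := mem_ball_self h.s0
  have hP := h.D p hp p hpB
  set B := D2 ψ p - (D2 ψ p).bilinearComp (Jm E) (Jm E) with hB
  have hBa : ∀ ξ η, B ξ η = D2 ψ p ξ η - D2 ψ p (I • ξ) (I • η) := fun ξ η => by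
    simp [hB, Jm_apply]
  set f := fderiv ℝ ψ p with hf
  have cB : ContDiff ℝ 2 (fun z => B (z - p) (z - p)) :=
    (B.contDiff.comp (contDiff_id.sub contDiff_const)).clm_apply (contDiff_id.sub contDiff_const)
  have cf : ContDiff ℝ 2 (fun z : E => f z) := f.contDiff
  refine ⟨fun z => (-1 : ℝ) * (f z + ((1/4 : ℝ) * B (z - p) (z - p) + (- f p))), ?_, ?_, ?_, ?_⟩
  · fun_prop
  · intro z ξ
    rw [Lv_const_mul _ (by fun_prop), Lv_add (by fun_prop) (by fun_prop), Lv_add (by fun_prop) (by fun_prop),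
      Lv_const_mul _ (by fun_prop), Lv_shift_bilin, Lv_clm, Lv_const, hBa, hBa, I_smul_I_smul]
    simp
  · intro z hzc hzb hsm
    have ht := taylor3 (convex_ball p s) hC.le (fun x hx => (h.D p hp x hx).cd.of_le (WithTop.coe_le_coe.2 le_top)) hpB hzb
      (fun u hu => h.d3 p hp p hpB u hu)
    rw [h.zero p hp, sub_zero, ← hf, Real.norm_eq_abs] at ht
    have h0 := psi_nonpos h hp hzb hzc
    have hl := hP.lv (z - p)
    have ht' := (abs_le.1 ht).1
    simp only
    rw [hBa]
    have e : f z = f (z - p) + f p := by rw [map_sub]; ring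
    have hL : Lv ψ p (z - p) = D2 ψ p (z - p) (z - p) + D2 ψ p (I • (z - p)) (I • (z - p)) := rfl
    rw [hL] at hl
    rw [e]
    have h3 : C * (C * ‖z - p‖ ^ 3) * 8 ≤ ‖z - p‖ ^ 2 := by
      calc C * (C * ‖z - p‖ ^ 3) * 8 = (8 * C ^ 2 * ‖z - p‖) * ‖z - p‖ ^ 2 := by ring
        _ ≤ 1 * ‖z - p‖ ^ 2 := by gcongr
        _ = _ := one_mul _
    have h4 := mul_le_mul_of_nonneg_left ht' hC.le
    have h5 := mul_nonpos_of_nonneg_of_nonpos hC.le h0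
    nlinarith
  · intro z hz1
    have e : f z = f (z - p) + f p := by rw [map_sub]; ring
    have a1 : |f (z - p)| ≤ C * ‖z - p‖ := (f.le_opNorm _).trans (by gcongr; exact hP.d1)
    have b : ∀ ξ : E, ‖ξ‖ ≤ 1 → |D2 ψ p ξ ξ| ≤ C * ‖ξ‖ := fun ξ hξ => by
      calc |D2 ψ p ξ ξ| ≤ ‖D2 ψ p‖ * ‖ξ‖ * ‖ξ‖ := (D2 ψ p).le_opNorm₂ ξ ξ
        _ ≤ C * ‖ξ‖ * 1 := by gcongr; exact hP.d2
        _ = _ := mul_one _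
    have a2 := b _ hz1
    have a3 := b (I • (z - p)) (by rwa [normI])
    rw [normI] at a3
    simp only
    rw [hBa, e]
    rw [abs_le] at *
    have := mul_nonneg hC.le (norm_nonneg (z - p))
    constructor <;> linarith [a1.1, a1.2, a2.1, a2.2, a3.1, a3.2]

set_option maxHeartbeats 1000000 in
lemma Sys.shift (h : Sys Ω ψ Ω₂ ρ φ C s) {p p' : E} (hp : p ∈ frontier Ω) (hp' : p' ∈ frontier Ω)
    (hh : 8 * C ^ 2 * ‖p' - p‖ ≤ s) :
    ∃ S : E →L[ℂ] E, ‖S - 1‖ ≤ 2 * C ^ 2 * ‖p' - p‖ ∧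
      ∀ z, z ∈ ball p (s / 2) → p' + S (z - p) ∈ ball p s ∧ ψ (p' + S (z - p)) ≤ ψ z + 9 * C ^ 3 * ‖p' - p‖ * ‖z - p‖ ^ 2 := by
  have hC := h.C0
  have hC1 := h.hC
  have hs0 := h.s0
  have hs1 := h.s1
  have hpB : p ∈ ball p s := mem_ball_self h.s0
  set d := ‖p' - p‖ with hd
  have hd0 : 0 ≤ d := norm_nonneg _
  have hC2 : 1 ≤ C ^ 2 := one_le_pow₀ hC1
  have hds : d ≤ s / 8 := by nlinarith
  have hp'B : p' ∈ ball p s := by rw [mem_ball, dist_eq_norm]; linarith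
  have hP := h.D p hp p hpB
  have hP' := h.D p hp p' hp'B
  have hdd : ‖fderiv ℝ ψ p' - fderiv ℝ ψ p‖ ≤ C * d :=
    mv1 (f := fderiv ℝ ψ) (convex_ball p s) (fun x hx => cda_fderiv_diff (h.psi_cd hp hx)) (fun x hx => (h.D p hp x hx).d2) hpB hp'B
  obtain ⟨A, hA⟩ := exists_cfun (fderiv ℝ ψ p' - fderiv ℝ ψ p)
  have hAn : ∀ x, ‖A x‖ ≤ C * d * ‖x‖ := fun x => (cfun_norm hA x).trans (by gcongr)
  obtain ⟨ν, hν, hν2⟩ := dual_vec hC hP'.gr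
  set N : E →L[ℂ] E := - A.smulRight ν with hN
  have hNn : ∀ x, ‖N x‖ ≤ 2 * C ^ 2 * d * ‖x‖ := fun x => by
    have : N x = - (A x • ν) := by simp [hN]
    rw [this, norm_neg, norm_smul]
    calc ‖A x‖ * ‖ν‖ ≤ (C * d * ‖x‖) * (2 * C) := by gcongr; exact hAn x
      _ = _ := by ring
  have h1d : 2 * C ^ 2 * d ≤ 1 / 4 := by linarith
  have hSe : ∀ x, (1 + N) x = x + N x := fun x => by simp
  have hSn : ∀ x, ‖(1 + N) x‖ ≤ 5 / 4 * ‖x‖ := fun x => by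
    rw [hSe]
    have := norm_add_le x (N x)
    have := hNn x
    have : 2 * C ^ 2 * d * ‖x‖ ≤ 1 / 4 * ‖x‖ := by gcongr
    linarith
  set T : E → E := fun z => p' + (1 + N) (z - p) with hT
  have hTs : ∀ z ∈ ball p (s / 2), T z ∈ ball p s := fun z hz => by
    rw [mem_ball, dist_eq_norm] at hz ⊢
    have e : T z - p = (p' - p) + (1 + N) (z - p) := by simp only [hT]; abel
    rw [e]
    have := norm_add_le (p' - p) ((1 + N) (z - p))
    have := hSn (z - p)
    linarith
  have hTz : ∀ z ∈ ball p (s / 2), ‖T z - z‖ ≤ 3 * C ^ 2 * d := fun z hz => by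
    rw [mem_ball, dist_eq_norm] at hz
    have e : T z - z = (p' - p) + N (z - p) := by simp only [hT, hSe]; abel
    rw [e]
    have a1 := norm_add_le (p' - p) (N (z - p))
    have a2 := hNn (z - p)
    have a3 : 2 * C ^ 2 * d * ‖z - p‖ ≤ 2 * C ^ 2 * d * 1 := by gcongr; linarith
    nlinarith
  set Sr : E →L[ℝ] E := (1 + N).restrictScalars ℝ with hSr
  have hTd : ∀ z, HasFDerivAt T Sr z := fun z => by
    have : HasFDerivAt (fun z => p' + Sr (z - p)) Sr z := by
      have := (Sr.hasFDerivAt (x := z - p)).comp z ((hasFDerivAt_id z).sub_const p)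
      simpa using this.const_add p'
    exact this
  have hTf : ∀ z, fderiv ℝ T z = Sr := fun z => (hTd z).fderiv
  have hTc : ContDiff ℝ 2 T := by
    have : ContDiff ℝ 2 (fun z => p' + Sr (z - p)) := contDiff_const.add (Sr.contDiff.comp (contDiff_id.sub contDiff_const))
    exact this
  have hT2 : ∀ z, D2 T z = 0 := fun z => by
    unfold D2
    rw [show fderiv ℝ T = fun _ => Sr from funext hTf]; simp
  refine ⟨1 + N, ?_, fun z hz => ⟨hTs z hz, ?_⟩⟩
  · rw [add_sub_cancel_left]
    exact N.opNorm_le_bound (by positivity) hNn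
  set g : E → ℝ := fun z => ψ (T z) + (-1) * ψ z with hg
  have hb2 : ball p (s / 2) ⊆ ball p s := ball_subset_ball (by linarith)
  have hcT : ∀ x ∈ ball p (s / 2), ContDiffAt ℝ 2 (fun z => ψ (T z)) x := fun x hx =>
    ContDiffAt.comp x (h.psi_cd hp (hTs x hx)) hTc.contDiffAt
  have hcm : ∀ x ∈ ball p (s / 2), ContDiffAt ℝ 2 (fun z => (-1) * ψ z) x := fun x hx =>
    contDiffAt_const.mul (h.psi_cd hp (hb2 hx))
  have hgc : ∀ x ∈ ball p (s / 2), ContDiffAt ℝ 2 g x := fun x hx => (hcT x hx).add (hcm x hx)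
  have hpB2 : p ∈ ball p (s / 2) := mem_ball_self (by linarith)
  have hTp : T p = p' := by simp [hT]
  have hg0 : g p = 0 := by simp only [hg, hTp, h.zero p hp, h.zero p' hp']; ring
  have hg1 : ∀ v, fderiv ℝ g p v = 0 := fun v => by
    have a1 : HasFDerivAt ψ (fderiv ℝ ψ p') (T p) := by
      rw [hTp]; exact (h.psi_cd hp hp'B).differentiableAt (by norm_num) |>.hasFDerivAt
    have a2 := a1.comp p (hTd p)
    have a3 := ((h.psi_cd hp hpB).differentiableAt (by norm_num)).hasFDerivAt.const_mul (-1)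
    have a4 : fderiv ℝ g p = _ := (a2.add a3).fderiv
    have e1 : Sr v = v - A v • ν := by
      change (1 + N) v = _
      rw [hSe]; simp [hN, sub_eq_add_neg]
    have e2 := hA v
    rw [a4]
    simp only [add_apply, ContinuousLinearMap.comp_apply, ContinuousLinearMap.coe_smul', Pi.smul_apply, smul_eq_mul, e1, map_sub, hν2, e2, _root_.sub_apply]
    ring
  have hg2 : ∀ x ∈ ball p (s / 2), ‖fderiv ℝ (fderiv ℝ g) x‖ ≤ 9 * C ^ 3 * d := fun x hx => by
    have : ‖D2 g x‖ ≤ 9 * C ^ 3 * d := by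
      refine ContinuousLinearMap.opNorm_le_bound₂ _ (by positivity) fun ξ η => ?_
      have e : D2 g x ξ η = D2 ψ (T x) (Sr ξ) (Sr η) - D2 ψ x ξ η := by
        rw [hg, D2_add (hcT x hx) (hcm x hx), D2_const_mul _ (h.psi_cd hp (hb2 hx))]
        simp only [add_apply, ContinuousLinearMap.coe_smul', Pi.smul_apply, smul_eq_mul]
        rw [D2_comp (h.psi_cd hp (hTs x hx)) hTc.contDiffAt, hT2, hTf]
        simp
        ring
      have eS : ∀ v, Sr v = v + N v := fun v => hSe v
      have e' : D2 g x ξ η = D2 ψ (T x) (N ξ) (Sr η) + D2 ψ (T x) ξ (N η) + (D2 ψ (T x) - D2 ψ x) ξ η := by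
        rw [e, eS ξ, map_add, add_apply]
        nth_rewrite 1 [eS η]
        rw [map_add, _root_.sub_apply, _root_.sub_apply]; ring
      have hd2 := (h.D p hp _ (hTs x hx)).d2
      have b1 : ‖D2 ψ (T x) (N ξ) (Sr η)‖ ≤ C * (2 * C ^ 2 * d * ‖ξ‖) * (5 / 4 * ‖η‖) :=
        ((D2 ψ (T x)).le_opNorm₂ _ _).trans (by gcongr; exact hNn ξ; exact hSn η)
      have b2 : ‖D2 ψ (T x) ξ (N η)‖ ≤ C * ‖ξ‖ * (2 * C ^ 2 * d * ‖η‖) :=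
        ((D2 ψ (T x)).le_opNorm₂ _ _).trans (by gcongr; exact hNn η)
      have b3 : ‖(D2 ψ (T x) - D2 ψ x) ξ η‖ ≤ C * (3 * C ^ 2 * d) * ‖ξ‖ * ‖η‖ :=
        ((D2 ψ (T x) - D2 ψ x).le_opNorm₂ _ _).trans (by
          gcongr
          exact (h.d3 p hp x (hb2 hx) _ (hTs x hx)).trans (by gcongr; exact hTz x hx))
      rw [e']
      have b4 := norm_add₃_le (a := D2 ψ (T x) (N ξ) (Sr η)) (b := D2 ψ (T x) ξ (N η)) (c := (D2 ψ (T x) - D2 ψ x) ξ η)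
      have b5 : 0 ≤ C ^ 3 * d * ‖ξ‖ * ‖η‖ := by positivity
      nlinarith
    exact this
  have := taylor2 (convex_ball p (s / 2)) (fun x hx => (hgc x hx).differentiableAt (by norm_num))
    (fun x hx => cda_fderiv_diff (hgc x hx)) hg2 hpB2 hz
  rw [hg0, hg1, sub_zero, sub_zero] at this
  have := (le_abs_self _).trans this
  simp only [hg] at this
  linarith

end ShiftSec


section MSec
variable {E : Type*} [NormedAddCommGroup E] [InnerProductSpace ℂ E] [NormedSpace ℝ E] [IsScalarTower ℝ ℂ E]

open scoped ContDiff

variable [FiniteDimensional ℂ E]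
variable {Ω : Set E} {ψ : E → ℝ} {Ω₂ : Set E} {ρ : E → ℝ} {φ : E → E} {C s : ℝ}

lemma Lv_affine {u : E → ℝ} {S : E →L[ℂ] E} {p p' z : E} (hu : ContDiffAt ℝ 2 u (p' + S (z - p))) (ξ : E) :
    Lv (fun x => u (p' + S (x - p))) z ξ = Lv u (p' + S (z - p)) (S ξ) := by
  have hd : ∀ x, HasFDerivAt (fun x => p' + S (x - p)) S x := fun x => by
    have := (S.hasFDerivAt (x := x - p)).comp x ((hasFDerivAt_id x).sub_const p)
    simpa using this.const_add p'
  have hf : fderiv ℂ (fun x => p' + S (x - p)) = fun _ => S := funext fun x => (hd x).fderiv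
  have hr : ContDiffAt ℝ 2 (fun x => p' + S (x - p)) z := by
    have : ContDiff ℝ 2 (fun z => p' + (S.restrictScalars ℝ) (z - p)) :=
      contDiff_const.add ((S.restrictScalars ℝ).contDiff.comp (contDiff_id.sub contDiff_const))
    exact this.contDiffAt
  have := Lv_comp_holo (u := u) (T := fun x => p' + S (x - p)) (z := z) hu hr
    (Filter.Eventually.of_forall fun x => (hd x).differentiableAt) (by rw [hf]; exact differentiableAt_const _) ξ
  rw [this, hf]

set_option maxHeartbeats 1000000 in
lemma Sys3.M1 (h : Sys3 Ω ψ Ω₂ ρ φ C s) :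
    ∃ K σ, 1 ≤ K ∧ 0 < σ ∧ σ ≤ s ∧ ∀ p ∈ frontier Ω, ∀ p' ∈ frontier Ω, ‖p' - p‖ ≤ σ → ∀ z ∈ closure Ω, ‖z - p‖ ≤ σ →
      rb Ω ρ φ (z + (p' - p)) ≤ rb Ω ρ φ z + K * ‖p' - p‖ * ‖z - p‖ := by
  have hC := h.C0
  have hC1 := h.hC
  have hs0 := h.s0
  have hs1 := h.s1
  have hCC : C ≤ 3 * C ^ 2 := by nlinarith
  have hC2 : 1 ≤ C ^ 2 := one_le_pow₀ hC1
  have h' := h.mono hCC le_rfl hs0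
  obtain ⟨a, ha⟩ : ∃ a, a = 24 * (3 * C ^ 2) ^ 16 := ⟨_, rfl⟩
  have ha1 : 1 ≤ a := by
    have : 1 ≤ (3 * C ^ 2) ^ 16 := one_le_pow₀ (by linarith)
    linarith
  have ha0 : 0 < a := by linarith
  obtain ⟨σ, hσ⟩ : ∃ σ, σ = s / (8 * C ^ 2 * a ^ 2) := ⟨_, rfl⟩
  have hσ0 : 0 < σ := by rw [hσ]; positivity
  have hσe : σ * (8 * C ^ 2 * a ^ 2) = s := by rw [hσ]; field_simp
  have ha2 : 1 ≤ a ^ 2 := one_le_pow₀ ha1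
  have hσ8 : 8 * C ^ 2 * σ ≤ s := by
    calc 8 * C ^ 2 * σ = σ * (8 * C ^ 2 * 1) := by ring
      _ ≤ σ * (8 * C ^ 2 * a ^ 2) := by gcongr
      _ = s := hσe
  have hσs : σ ≤ s / 8 := by nlinarith
  have hσa : a * √(C * σ) ≤ 1 := by
    rw [← le_div_iff₀' ha0, Real.sqrt_le_left (by positivity), div_pow, one_pow, le_div_iff₀ (by positivity)]
    nlinarith
  obtain ⟨C₂, hC₂⟩ : ∃ C₂, C₂ = 24 * C ^ 4 / σ ^ 2 + 72 * C ^ 5 := ⟨_, rfl⟩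
  have hC₂0 : 0 < C₂ := by rw [hC₂]; positivity
  have hC₂a : 72 * C ^ 5 ≤ C₂ := by rw [hC₂]; linarith [show 0 ≤ 24 * C ^ 4 / σ ^ 2 by positivity]
  have hC₂b : 24 * C ^ 4 ≤ C₂ * σ ^ 2 := by
    have : 24 * C ^ 4 / σ ^ 2 ≤ C₂ := by rw [hC₂]; linarith [show 0 ≤ 72 * C ^ 5 by positivity]
    rwa [div_le_iff₀ (by positivity)] at this
  refine ⟨2 * C * C₂ + C + 2 * C ^ 3, σ, by nlinarith [show 0 < C * C₂ by positivity, show 0 < C ^ 3 by positivity], hσ0, by linarith, ?_⟩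
  intro p hp p' hp' hh z hzc hz
  rcases (norm_nonneg (p' - p)).eq_or_lt with h0 | hd0
  · have : p' - p = 0 := norm_eq_zero.1 h0.symm
    rw [this]; simp
  obtain ⟨S, hS, hST⟩ := h.shift hp hp' (le_trans (by gcongr) hσ8)
  obtain ⟨κ, hκc, hκL, hκlo, hκup⟩ := h.kappa hp
  set d := ‖p' - p‖ with hd
  have key : ∀ x, x ∈ closedBall p σ → x ∈ ball p (s / 2) ∧ x ∈ ball p s ∧ ‖x - p‖ ≤ σ ∧ 8 * C ^ 2 * ‖x - p‖ ≤ 1 ∧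
      ‖p' + S (x - p) - x‖ ≤ 3 * C ^ 2 * d ∧ ‖p' + S (x - p) - (x + (p' - p))‖ ≤ 2 * C ^ 2 * d * ‖x - p‖ := by
    intro x hx
    rw [mem_closedBall, dist_eq_norm] at hx
    have e : p' + S (x - p) - (x + (p' - p)) = (S - 1) (x - p) := by simp; abel
    have b : ‖p' + S (x - p) - (x + (p' - p))‖ ≤ 2 * C ^ 2 * d * ‖x - p‖ := by
      rw [e]; exact ((S - 1).le_opNorm _).trans (by gcongr)
    have e2 : p' + S (x - p) - x = (p' + S (x - p) - (x + (p' - p))) + (p' - p) := by abel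
    refine ⟨by rw [mem_ball, dist_eq_norm]; linarith, by rw [mem_ball, dist_eq_norm]; linarith, hx, ?_, ?_, b⟩
    · have : 8 * C ^ 2 * ‖x - p‖ ≤ 8 * C ^ 2 * σ := by gcongr
      linarith
    · rw [e2]
      have b1 := norm_add_le (p' + S (x - p) - (x + (p' - p))) (p' - p)
      have b2 : 2 * C ^ 2 * d * ‖x - p‖ ≤ 2 * C ^ 2 * d * 1 := by gcongr; linarith
      nlinarith
  have hmain : ∀ x ∈ closure Ω ∩ closedBall p σ,
      (rb Ω ρ φ (p' + S (x - p)) + ((- (C₂ * d)) * κ x + (d * ψ x + (-1) * rb Ω ρ φ x))) ≤ 0 := by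
    have hTcont : Continuous (fun x => p' + S (x - p)) := by fun_prop
    refine max_principle ?_ ?_ ?_
    · have := FiniteDimensional.proper ℂ E
      exact h.cpt.inter_right isClosed_closedBall
    · refine ContinuousOn.add (h.cont.comp hTcont).continuousOn (ContinuousOn.add
        (continuous_const.mul hκc.continuous).continuousOn (ContinuousOn.add ?_ (continuous_const.mul h.cont).continuousOn))
      exact continuousOn_const.mul fun x hx => (h.psi_cd hp (key x hx.2).2.1).continuousAt.continuousWithinAt
    · rintro x ⟨hxc, hxb⟩
      obtain ⟨k1, k2, k3, k4, k5, k6⟩ := key x hxb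
      obtain ⟨kT, kψ⟩ := hST x k1
      have klo := hκlo x hxc k2 k4
      have kr := h.rb_nonpos (p' + S (x - p))
      have kκ : 0 ≤ κ x := by
        have := (sq_nonneg ‖x - p‖).trans klo
        by_contra hc
        push Not at hc
        nlinarith
      have kψ0 := psi_nonpos h.toSys hp k2 hxc
      by_cases hxΩ : x ∈ Ω
      swap
      · left
        have hf : x ∈ frontier Ω := by rw [h.op.frontier_eq]; exact ⟨hxc, hxΩ⟩
        rw [rb_out hxΩ, h.zero x hf]
        have : 0 ≤ C₂ * d * κ x := by positivity
        linarith
      by_cases hTΩ : p' + S (x - p) ∈ Ω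
      swap
      · left
        have a1 : 0 ≤ ψ (p' + S (x - p)) := by
          by_contra hc
          exact hTΩ ((h.D p hp _ kT).mem.2 (not_le.1 hc))
        have a2 := h.up p hp x k2 hxΩ
        rw [rb_out hTΩ]
        have a3 : - rb Ω ρ φ x ≤ C * (9 * C ^ 3 * d * ‖x - p‖ ^ 2) := a2.trans (by gcongr; linarith)
        have a4 : C * (9 * C ^ 3 * d * ‖x - p‖ ^ 2) ≤ C * (9 * C ^ 3 * d * (8 * C * κ x)) := by gcongr
        have a5 : 72 * C ^ 5 * (d * κ x) ≤ C₂ * (d * κ x) := by gcongr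
        have a6 : d * ψ x ≤ 0 := mul_nonpos_of_nonneg_of_nonpos hd0.le kψ0
        nlinarith
      by_cases hbd : x ∈ ball p σ
      swap
      · left
        have b1 : ‖x - p‖ = σ := by
          rw [mem_ball, dist_eq_norm, not_lt] at hbd
          exact le_antisymm k3 hbd
        have b2 := (le_abs_self _).trans (h.lip p hp x k2 _ kT)
        have b3 : C * ‖p' + S (x - p) - x‖ ≤ C * (3 * C ^ 2 * d) := by gcongr
        rw [b1] at klo
        have b4 : C₂ * σ ^ 2 ≤ C₂ * (8 * C * κ x) := by gcongr
        have b5 : 3 * C ^ 3 ≤ C₂ * κ x := by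
          have : 8 * C * (3 * C ^ 3) ≤ 8 * C * (C₂ * κ x) := by nlinarith
          exact le_of_mul_le_mul_left this (by positivity)
        have b6 : d * (3 * C ^ 3) ≤ d * (C₂ * κ x) := by gcongr
        have a6 : d * ψ x ≤ 0 := mul_nonpos_of_nonneg_of_nonpos hd0.le kψ0
        nlinarith
      right
      have hq : 24 * (3 * C ^ 2) ^ 16 * √(- ψ x) ≤ 1 := by
        rw [← ha]
        refine le_trans ?_ hσa
        gcongr
        have := (neg_le_abs _).trans (h.psi_le hp k2)
        exact this.trans (by gcongr)
      obtain ⟨ξ, hξ⟩ := h'.lemE (S := S) hp k2 hxΩ hTΩ hd0 k5 (hS.trans (by gcongr; norm_num)) hq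
      have c1 : ContDiffAt ℝ 2 (fun x => rb Ω ρ φ (p' + S (x - p))) x := by
        have : ContDiff ℝ 2 (fun z => p' + (S.restrictScalars ℝ) (z - p)) :=
          contDiff_const.add ((S.restrictScalars ℝ).contDiff.comp (contDiff_id.sub contDiff_const))
        exact ContDiffAt.comp x (h.r_cd hTΩ) this.contDiffAt
      have c2 := h.psi_cd hp k2
      have c3 := h.r_cd hxΩ
      have c4 : ContDiffAt ℝ 2 κ x := hκc.contDiffAt
      have c5 : ContDiffAt ℝ 2 (fun x => (- (C₂ * d)) * κ x) x := contDiffAt_const.mul c4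
      have c6 : ContDiffAt ℝ 2 (fun x => d * ψ x) x := contDiffAt_const.mul c2
      have c7 : ContDiffAt ℝ 2 (fun x => (-1) * rb Ω ρ φ x) x := contDiffAt_const.mul c3
      refine ⟨Filter.inter_mem (Filter.mem_of_superset (h.op.mem_nhds hxΩ) subset_closure)
        (Filter.mem_of_superset (isOpen_ball.mem_nhds hbd) ball_subset_closedBall), c1.add (c5.add (c6.add c7)), ξ, ?_⟩
      rw [Lv_add c1 (c5.add (c6.add c7)), Lv_add c5 (c6.add c7), Lv_add c6 c7, Lv_const_mul _ c4, Lv_const_mul _ c2,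
        Lv_const_mul _ c3, hκL, Lv_affine (h.r_cd hTΩ)]
      linarith
  have hzb : z ∈ closedBall p σ := by rwa [mem_closedBall, dist_eq_norm]
  have hm := hmain z ⟨hzc, hzb⟩
  obtain ⟨k1, k2, k3, k4, k5, k6⟩ := key z hzb
  have m1 := (le_abs_self _).trans (hκup z (by linarith))
  have m2 := (neg_le_abs _).trans (h.psi_le hp k2)
  have hzp : z + (p' - p) ∈ ball p s := by
    rw [mem_ball, dist_eq_norm, show z + (p' - p) - p = (z - p) + (p' - p) by abel]
    have := norm_add_le (z - p) (p' - p)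
    linarith
  have m3 := (neg_le_abs _).trans (h.lip p hp _ hzp _ (hST z k1).1)
  have m4 : C * ‖p' + S (z - p) - (z + (p' - p))‖ ≤ C * (2 * C ^ 2 * d * ‖z - p‖) := by gcongr
  have m5 : C₂ * d * κ z ≤ C₂ * d * (2 * C * ‖z - p‖) := by gcongr
  have m6 : d * (- ψ z) ≤ d * (C * ‖z - p‖) := by gcongr
  nlinarith

end MSec


section Sys4Sec
variable {E : Type*} [NormedAddCommGroup E] [InnerProductSpace ℂ E] [NormedSpace ℝ E] [IsScalarTower ℝ ℂ E]

open scoped ContDiff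

/-- the standing data together with the boundary translation estimate -/
structure Sys4 (Ω : Set E) (ψ : E → ℝ) (Ω₂ : Set E) (ρ : E → ℝ) (φ : E → E) (C s : ℝ) : Prop
    extends Sys3 Ω ψ Ω₂ ρ φ C s where
  m1 : ∀ p ∈ frontier Ω, ∀ p' ∈ frontier Ω, ‖p' - p‖ ≤ s → ∀ z ∈ closure Ω, ‖z - p‖ ≤ s →
      rb Ω ρ φ (z + (p' - p)) ≤ rb Ω ρ φ z + C * ‖p' - p‖ * ‖z - p‖

/-- the standing data together with the translation estimate in the interior -/
structure Sys5 (Ω : Set E) (ψ : E → ℝ) (Ω₂ : Set E) (ρ : E → ℝ) (φ : E → E) (C s : ℝ) : Prop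
    extends Sys3 Ω ψ Ω₂ ρ φ C s where
  m2 : ∀ p ∈ frontier Ω, ∀ z1 ∈ ball p s, ∀ z ∈ ball p s, z1 ∈ Ω → z ∈ closure Ω →
      rb Ω ρ φ z1 ≤ rb Ω ρ φ z + C * (|ψ z - ψ z1| + (- ψ z1) * ‖z - z1‖)

variable [FiniteDimensional ℂ E]
variable {Ω : Set E} {ψ : E → ℝ} {Ω₂ : Set E} {ρ : E → ℝ} {φ : E → E} {C s : ℝ}

lemma Sys3.exists4 (h : Sys3 Ω ψ Ω₂ ρ φ C s) : ∃ C' s', Sys4 Ω ψ Ω₂ ρ φ C' s' := by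
  obtain ⟨K, σ, hK, hσ, hσs, H⟩ := h.M1
  refine ⟨max C K, σ, { toSys3 := h.mono (le_max_left _ _) hσs hσ, m1 := fun p hp p' hp' hh z hz hzp => ?_ }⟩
  refine (H p hp p' hp' hh z hz hzp).trans ?_
  gcongr
  exact le_max_right _ _

set_option maxHeartbeats 1000000 in
lemma Sys4.M2 (h : Sys4 Ω ψ Ω₂ ρ φ C s) {p z1 z : E} (hp : p ∈ frontier Ω) (hz1 : z1 ∈ ball p (s / (16 * C ^ 2)))
    (hz : z ∈ ball p (s / (16 * C ^ 2))) (hz1Ω : z1 ∈ Ω) (hzc : z ∈ closure Ω) :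
    rb Ω ρ φ z1 ≤ rb Ω ρ φ z + 5 * C ^ 5 * (|ψ z - ψ z1| + (- ψ z1) * ‖z - z1‖) := by
  have hC := h.C0
  have hC1 := h.hC
  have hs0 := h.s0
  have hs1 := h.s1
  obtain ⟨σ, hσ⟩ : ∃ σ, σ = s / (16 * C ^ 2) := ⟨_, rfl⟩
  rw [← hσ] at hz1 hz
  have hσ0 : 0 < σ := by rw [hσ]; positivity
  have hσe : C ^ 2 * σ = s / 16 := by rw [hσ]; field_simp
  have hC2 : 1 ≤ C ^ 2 := one_le_pow₀ hC1
  have hC12 : C ≤ C ^ 2 := by nlinarith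
  have hσ1 : σ ≤ s / 16 := by nlinarith
  have hσC : C * σ ≤ s / 16 := by nlinarith
  have hz1s : z1 ∈ ball p s := ball_subset_ball (by linarith) hz1
  have hzs : z ∈ ball p s := ball_subset_ball (by linarith) hz
  rw [mem_ball, dist_eq_norm] at hz1 hz
  have ht := h.psi_neg hp hz1s hz1Ω
  obtain ⟨τ, hτ⟩ : ∃ τ, τ = - ψ z1 := ⟨_, rfl⟩
  rw [← hτ] at ht ⊢
  have hτσ : τ ≤ C * σ := by
    have := (neg_le_abs _).trans (h.psi_le hp hz1s)
    rw [hτ]; exact this.trans (by gcongr)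
  obtain ⟨q1, hq1, hq1n⟩ := (h.D p hp z1 hz1s).near
  rw [abs_of_neg (by linarith), ← hτ] at hq1n
  have hq1n' : ‖z1 - q1‖ ≤ s / 16 := by
    have : C * τ ≤ C * (C * σ) := by gcongr
    nlinarith
  obtain ⟨L, hL⟩ : ∃ L, L = ‖z - z1‖ := ⟨_, rfl⟩
  have hL0 : 0 ≤ L := by rw [hL]; positivity
  have hLσ : L ≤ 2 * σ := by
    rw [hL, show z - z1 = (z - p) - (z1 - p) by abel]
    have := norm_sub_le (z - p) (z1 - p)
    linarith
  have hq1p : ‖q1 - p‖ ≤ s / 8 := by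
    rw [show q1 - p = (z1 - p) - (z1 - q1) by abel]
    have := norm_sub_le (z1 - p) (z1 - q1)
    linarith
  have hq1s : q1 ∈ ball p s := by rw [mem_ball, dist_eq_norm]; linarith
  obtain ⟨x, hx⟩ : ∃ x, x = q1 + (z - z1) := ⟨_, rfl⟩
  have hxq : ‖x - q1‖ = L := by rw [hx, hL]; simp
  have hxs : x ∈ ball p s := by
    rw [mem_ball, dist_eq_norm, show x - p = (x - q1) + (q1 - p) by abel]
    have := norm_add_le (x - q1) (q1 - p)
    linarith
  obtain ⟨w, hw⟩ : ∃ w, w = |ψ x| := ⟨_, rfl⟩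
  have hw0 : 0 ≤ w := by rw [hw]; positivity
  have hwL : w ≤ C * L := by
    have := h.psi_lip hp hq1s hxs
    rwa [h.zero q1 hq1, sub_zero, hxq, ← hw] at this
  obtain ⟨p', hp', hp'n⟩ := (h.D p hp x hxs).near
  rw [← hw] at hp'n
  have hCw : C * w ≤ s / 8 := by
    have : C * w ≤ C * (C * (2 * σ)) := by gcongr; exact hwL.trans (by gcongr)
    nlinarith
  have hw1 : w ≤ 1 := by nlinarith
  have hxp' : ‖x - p'‖ ≤ s / 8 := hp'n.trans hCw
  have n1 : ‖q1 - p'‖ ≤ L + C * w := by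
    rw [show q1 - p' = - (x - q1) + (x - p') by abel]
    have := norm_add_le (- (x - q1)) (x - p')
    rw [norm_neg] at this
    linarith
  have n2 : ‖z - p'‖ ≤ C * τ + C * w := by
    rw [show z - p' = (z1 - q1) + (x - p') by rw [hx]; abel]
    have := norm_add_le (z1 - q1) (x - p')
    linarith
  have hCτ : C * τ ≤ s / 16 := by
    have : C * τ ≤ C * (C * σ) := by gcongr
    nlinarith
  have m := h.m1 p' hp' q1 hq1 (by linarith) z hzc (by linarith)
  rw [show z + (q1 - p') = z1 + (x - p') by rw [hx]; abel] at m
  have hzz : z1 + (x - p') ∈ ball p s := by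
    rw [mem_ball, dist_eq_norm, show z1 + (x - p') - p = (z1 - p) + (x - p') by abel]
    have := norm_add_le (z1 - p) (x - p')
    linarith
  have m2 := (neg_le_abs _).trans (h.lip p hp z1 hz1s _ hzz)
  rw [add_sub_cancel_left] at m2
  have m3 : C * ‖x - p'‖ ≤ C * (C * w) := by gcongr
  have m4 : C * ‖q1 - p'‖ * ‖z - p'‖ ≤ C * (L + C * w) * (C * τ + C * w) := by gcongr
  -- comparison of the defining function
  have hD : w ≤ |ψ z - ψ z1| + C * (C * τ) * L := by
    have hsub : ∀ y ∈ ball p (s / 2), y + (q1 - z1) ∈ ball p s ∧ y ∈ ball p s := fun y hy => by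
      refine ⟨?_, ball_subset_ball (by linarith) hy⟩
      rw [mem_ball, dist_eq_norm] at hy ⊢
      rw [show y + (q1 - z1) - p = (y - p) - (z1 - q1) by abel]
      have := norm_sub_le (y - p) (z1 - q1)
      linarith
    have hdiff : ∀ y ∈ ball p (s / 2), HasFDerivAt (fun y => ψ (y + (q1 - z1)) - ψ y) (fderiv ℝ ψ (y + (q1 - z1)) - fderiv ℝ ψ y) y := by
      intro y hy
      have a1 := ((h.psi_cd hp (hsub y hy).1).differentiableAt (by norm_num)).hasFDerivAt
      have a2 := ((h.psi_cd hp (hsub y hy).2).differentiableAt (by norm_num)).hasFDerivAt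
      have a3 := (a1.comp y ((hasFDerivAt_id y).add_const (q1 - z1))).sub a2
      rw [ContinuousLinearMap.comp_id] at a3
      exact a3
    have := mv1 (f := fun y => ψ (y + (q1 - z1)) - ψ y) (convex_ball p (s / 2)) (C := C * (C * τ)) (fun y hy => (hdiff y hy).differentiableAt)
      (fun y hy => by
        rw [(hdiff y hy).fderiv]
        have := mv1 (f := fderiv ℝ ψ) (convex_ball p s) (fun x hx => cda_fderiv_diff (h.psi_cd hp hx)) (fun x hx => (h.D p hp x hx).d2)
          (hsub y hy).2 (hsub y hy).1
        refine this.trans ?_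
        rw [add_sub_cancel_left, norm_sub_rev]
        gcongr) (x := z1) (y := z)
      (by rw [mem_ball, dist_eq_norm]; linarith) (by rw [mem_ball, dist_eq_norm]; linarith)
    rw [show z + (q1 - z1) = x by rw [hx]; abel, show z1 + (q1 - z1) = q1 by abel, h.zero q1 hq1, ← hL, Real.norm_eq_abs] at this
    rw [hw]
    have e : ψ x = (ψ x - ψ z - (0 - ψ z1)) + (ψ z - ψ z1) := by ring
    rw [e]
    have := abs_add_le (ψ x - ψ z - (0 - ψ z1)) (ψ z - ψ z1)
    linarith
  rw [← hL]
  set Δ := |ψ z - ψ z1| with hΔ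
  have hΔ0 : 0 ≤ Δ := abs_nonneg _
  have hτ1 : τ ≤ 1 := by linarith
  have hL1 : L ≤ 1 := by linarith
  have f1 : L * w ≤ w := mul_le_of_le_one_left hw0 hL1
  have f2 : w * τ ≤ w := mul_le_of_le_one_right hw0 hτ1
  have f3 : w * w ≤ w := mul_le_of_le_one_right hw0 hw1
  have g1 : C * (L + C * w) * (C * τ + C * w) + C * (C * w) ≤ C ^ 2 * (τ * L) + (C ^ 2 * w + C ^ 3 * w + C ^ 3 * w + C ^ 2 * w) := by
    have e : C * (L + C * w) * (C * τ + C * w) + C * (C * w) = C ^ 2 * (τ * L) + (C ^ 2 * (L * w) + C ^ 3 * (w * τ) + C ^ 3 * (w * w) + C ^ 2 * w) := by ring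
    rw [e]; gcongr
  have c23 : C ^ 2 ≤ C ^ 3 := pow_le_pow_right₀ hC1 (by norm_num)
  have c25 : C ^ 2 ≤ C ^ 5 := pow_le_pow_right₀ hC1 (by norm_num)
  have c35 : C ^ 3 ≤ C ^ 5 := pow_le_pow_right₀ hC1 (by norm_num)
  have g2 : C ^ 2 * w + C ^ 3 * w + C ^ 3 * w + C ^ 2 * w ≤ 4 * C ^ 3 * w := by nlinarith
  have g3 : 4 * C ^ 3 * w ≤ 4 * C ^ 3 * (Δ + C * (C * τ) * L) := by gcongr
  have g4 : 4 * C ^ 3 * (Δ + C * (C * τ) * L) = 4 * C ^ 3 * Δ + 4 * C ^ 5 * (τ * L) := by ring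
  have g5 : C ^ 2 * (τ * L) ≤ C ^ 5 * (τ * L) := by gcongr
  have g6 : C ^ 3 * Δ ≤ C ^ 5 * Δ := by gcongr
  have g7 : 0 ≤ C ^ 5 * Δ := by positivity
  nlinarith

lemma Sys4.exists5 (h : Sys4 Ω ψ Ω₂ ρ φ C s) : ∃ C' s', Sys5 Ω ψ Ω₂ ρ φ C' s' := by
  have hC := h.C0
  have hC1 := h.hC
  have hs0 := h.s0
  have c5 : 1 ≤ C ^ 4 := one_le_pow₀ hC1
  have c2 : 1 ≤ C ^ 2 := one_le_pow₀ hC1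
  refine ⟨5 * C ^ 5, s / (16 * C ^ 2), { toSys3 := h.toSys3.mono (by nlinarith) (div_le_self hs0.le (by linarith)) (by positivity), m2 := ?_ }⟩
  intro p hp z1 hz1 z hz h1 h2
  exact h.M2 hp hz1 hz h1 h2

lemma Sys5.mono {C' s' : ℝ} (h : Sys5 Ω ψ Ω₂ ρ φ C s) (hC : C ≤ C') (hs : s' ≤ s) (hs0 : 0 < s') :
    Sys5 Ω ψ Ω₂ ρ φ C' s' where
  toSys3 := h.toSys3.mono hC hs hs0
  m2 := fun p hp z1 hz1 z hz h1 h2 => (h.m2 p hp z1 (ball_subset_ball hs hz1) z (ball_subset_ball hs hz) h1 h2).trans (by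
    have := h.psi_neg hp (ball_subset_ball hs hz1) h1
    gcongr)

end Sys4Sec


section NSec
variable {E : Type*} [NormedAddCommGroup E] [InnerProductSpace ℂ E] [NormedSpace ℝ E] [IsScalarTower ℝ ℂ E]

open scoped ContDiff

variable [FiniteDimensional ℂ E]
variable {Ω : Set E} {ψ : E → ℝ} {Ω₂ : Set E} {ρ : E → ℝ} {φ : E → E} {C s : ℝ}

set_option maxHeartbeats 1000000 in
lemma Sys5.N (h : Sys5 Ω ψ Ω₂ ρ φ C s) {p z1 : E} (hp : p ∈ frontier Ω) (hz1 : z1 ∈ ball p (s / 4)) (hz1Ω : z1 ∈ Ω) {τ : ℝ}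
    (hτ : τ = - ψ z1) (hsm : 256 * C ^ 9 * τ ≤ s ^ 2) :
    ∃ α, 0 ≤ α ∧ α ≤ C ∧ ∀ z ∈ closure Ω, - τ ≤ ψ z → ‖z - z1‖ ≤ s / 4 →
      |rb Ω ρ φ z - α * ψ z| ≤ 26 * C ^ 4 * (τ ^ 2 + ‖z - z1‖ ^ 2) := by
  have hC := h.C0
  have hC1 := h.hC
  have hs0 := h.s0
  have hs1 := h.s1
  have hz1s : z1 ∈ ball p s := ball_subset_ball (by linarith) hz1
  have ht0 : 0 < τ := by rw [hτ]; exact h.psi_neg hp hz1s hz1Ω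
  have hs2 : s ^ 2 ≤ 1 := pow_le_one₀ hs0.le hs1
  have c9 : ∀ k ≤ 9, C ^ k ≤ C ^ 9 := fun k hk => pow_le_pow_right₀ hC1 hk
  have hτ9 : C ^ 9 * τ ≤ s ^ 2 / 256 := by linarith
  have hτk : ∀ k ≤ 9, C ^ k * τ ≤ s ^ 2 / 256 := fun k hk => le_trans (by gcongr) hτ9
  have hτ1 : τ ≤ s ^ 2 / 256 := by simpa using hτk 0 (by norm_num)
  have hτC : C * τ ≤ s ^ 2 / 256 := by simpa using hτk 1 (by norm_num)
  have hup := h.up p hp z1 hz1s hz1Ω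
  have hlo := h.lo p hp z1 hz1s hz1Ω
  rw [← hτ] at hup hlo
  set α := - rb Ω ρ φ z1 / τ with hα
  have hατ : α * τ = - rb Ω ρ φ z1 := by rw [hα]; field_simp
  have hαC : α ≤ C := by rw [hα, div_le_iff₀ ht0]; exact hup
  have hαl : 1 ≤ C * α := by
    have : τ * 1 ≤ τ * (C * α) := by
      calc τ * 1 = τ := mul_one _
        _ ≤ C * (- rb Ω ρ φ z1) := hlo
        _ = τ * (C * α) := by rw [← hατ]; ring
    exact le_of_mul_le_mul_left this ht0
  have hα0 : 0 ≤ α := by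
    by_contra hc
    push Not at hc
    nlinarith
  set K : Set E := closure Ω ∩ closedBall z1 (s / 4) ∩ {z | - τ ≤ ψ z} with hK
  have hbs : closedBall z1 (s / 4) ⊆ ball p s := fun x hx => by
    rw [mem_closedBall, dist_eq_norm] at hx
    rw [mem_ball, dist_eq_norm] at hz1 ⊢
    rw [show x - p = (x - z1) + (z1 - p) by abel]
    have := norm_add_le (x - z1) (z1 - p)
    linarith
  have hψc : ContinuousOn ψ (closure Ω ∩ closedBall z1 (s / 4)) := fun x hx =>
    (h.psi_cd hp (hbs hx.2)).continuousAt.continuousWithinAt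
  have hKc : IsCompact K := by
    have := FiniteDimensional.proper ℂ E
    have hc := h.cpt.inter_right (isClosed_closedBall (x := z1) (ε := s / 4))
    have : IsClosed K := hψc.preimage_isClosed_of_isClosed hc.isClosed isClosed_Ici
    exact hc.of_isClosed_subset this fun x hx => hx.1
  have hψK : ContinuousOn ψ K := hψc.mono fun x hx => hx.1
  have hnc : ContDiff ℝ 2 (fun z : E => ‖z - z1‖ ^ 2) := (contDiff_normSq_sub z1).of_le (by exact le_top)
  -- common trichotomy
  have tri : ∀ z ∈ K, z ∈ frontier Ω ∨ (z ∈ Ω ∧ ψ z = - τ) ∨ (z ∈ Ω ∧ ‖z - z1‖ = s / 4) ∨ (z ∈ Ω ∧ K ∈ nhds z) := by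
    rintro z ⟨⟨hzc, hzb⟩, hzt⟩
    by_cases hzΩ : z ∈ Ω
    swap
    · left; rw [h.op.frontier_eq]; exact ⟨hzc, hzΩ⟩
    right
    by_cases h1 : ψ z = - τ
    · exact Or.inl ⟨hzΩ, h1⟩
    right
    by_cases h2 : ‖z - z1‖ = s / 4
    · exact Or.inl ⟨hzΩ, h2⟩
    right
    refine ⟨hzΩ, ?_⟩
    have a1 : closure Ω ∈ nhds z := Filter.mem_of_superset (h.op.mem_nhds hzΩ) subset_closure
    have a2 : closedBall z1 (s / 4) ∈ nhds z := by
      have : z ∈ ball z1 (s / 4) := by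
        rw [mem_closedBall, dist_eq_norm] at hzb
        rw [mem_ball, dist_eq_norm]; exact lt_of_le_of_ne hzb h2
      exact Filter.mem_of_superset (isOpen_ball.mem_nhds this) ball_subset_closedBall
    have a3 : {z | - τ ≤ ψ z} ∈ nhds z := by
      have hc := (h.psi_cd hp (hbs hzb)).continuousAt
      have : - τ < ψ z := lt_of_le_of_ne hzt (Ne.symm h1)
      exact Filter.mem_of_superset (hc.eventually (lt_mem_nhds this)) fun x (hx : - τ < ψ x) => hx.le
    exact Filter.inter_mem (Filter.inter_mem a1 a2) a3
  obtain ⟨c, hc⟩ : ∃ c, c = 1 / (16 * C ^ 2) := ⟨_, rfl⟩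
  have hc0 : 0 < c := by rw [hc]; positivity
  have hcC : c * (16 * C ^ 2) = 1 := by rw [hc]; field_simp
  have low : ∀ z ∈ K, (α * ψ z + ((-1) * rb Ω ρ φ z + ((- c) * ‖z - z1‖ ^ 2 + (- (4 * C ^ 4 * τ ^ 2))))) ≤ 0 := by
    refine max_principle hKc ?_ ?_
    · exact (continuousOn_const.mul hψK).add ((continuous_const.mul h.cont).continuousOn.add
        (((continuous_const.mul hnc.continuous).add continuous_const).continuousOn))
    · intro z hz
      have hzb := hbs hz.1.2
      have hψ0 := psi_nonpos h.toSys hp hzb hz.1.1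
      have hzt : - τ ≤ ψ z := hz.2
      rcases tri z hz with hf | ⟨hzΩ, h1⟩ | ⟨hzΩ, h1⟩ | ⟨hzΩ, h1⟩
      · left
        rw [h.zero z hf, rb_out (h.notMem hf)]
        have : 0 ≤ c * ‖z - z1‖ ^ 2 := by positivity
        have : 0 ≤ C ^ 4 * τ ^ 2 := by positivity
        linarith
      · left
        have m := h.m2 p hp z1 hz1s z hzb hz1Ω hz.1.1
        rw [← hτ, show ψ z - ψ z1 = 0 by rw [h1, hτ]; ring, abs_zero, zero_add] at m
        rw [h1]
        have e : C * (τ * ‖z - z1‖) ≤ c * ‖z - z1‖ ^ 2 + 4 * C ^ 4 * τ ^ 2 := by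
          have h2 : 0 ≤ (‖z - z1‖ - 8 * C ^ 3 * τ) ^ 2 := sq_nonneg _
          have h3 := mul_nonneg hc0.le h2
          have e2 : c * (‖z - z1‖ - 8 * C ^ 3 * τ) ^ 2 = c * ‖z - z1‖ ^ 2 - (c * (16 * C ^ 2)) * (C * (τ * ‖z - z1‖)) + (c * (16 * C ^ 2)) * (4 * C ^ 4 * τ ^ 2) := by ring
          rw [e2, hcC] at h3
          linarith
        linarith
      · left
        have m := h.up p hp z hzb hzΩ
        rw [h1]
        have e1 : C * (- ψ z) ≤ C * τ := by gcongr; linarith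
        have e2 : C ^ 3 * τ ≤ s ^ 2 / 256 := hτk 3 (by norm_num)
        have e3 : C * τ ≤ c * (s / 4) ^ 2 := by
          have : C ^ 2 * (C * τ) ≤ C ^ 2 * (c * (s / 4) ^ 2) := by
            have e4 : C ^ 2 * (c * (s / 4) ^ 2) = (c * (16 * C ^ 2)) * (s ^ 2 / 256) := by ring
            rw [e4, hcC]; linarith
          exact le_of_mul_le_mul_left this (by positivity)
        have e4 : α * ψ z ≤ 0 := mul_nonpos_of_nonneg_of_nonpos hα0 hψ0
        have : 0 ≤ C ^ 4 * τ ^ 2 := by positivity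
        linarith
      · right
        have c1 := h.psi_cd hp hzb
        have c2 := h.r_cd hzΩ
        have c3 : ContDiffAt ℝ 2 (fun z : E => ‖z - z1‖ ^ 2) z := hnc.contDiffAt
        have c4 : ContDiffAt ℝ 2 (fun z => α * ψ z) z := contDiffAt_const.mul c1
        have c5 : ContDiffAt ℝ 2 (fun z => (-1) * rb Ω ρ φ z) z := contDiffAt_const.mul c2
        have c6 : ContDiffAt ℝ 2 (fun z : E => (- c) * ‖z - z1‖ ^ 2) z := contDiffAt_const.mul c3
        have c7 : ContDiffAt ℝ 2 (fun z : E => (- (4 * C ^ 4 * τ ^ 2))) z := contDiffAt_const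
        obtain ⟨ξ, hξ0, hξ⟩ := h.lam hp hzb hzΩ
        refine ⟨h1, c4.add (c5.add (c6.add c7)), ξ, ?_⟩
        rw [Lv_add c4 (c5.add (c6.add c7)), Lv_add c5 (c6.add c7), Lv_add c6 c7, Lv_const_mul _ c1, Lv_const_mul _ c2,
          Lv_const_mul _ c3, Lv_const, Lv_normSq]
        have hl := (h.D p hp z hzb).lv ξ
        have hn : 0 < ‖ξ‖ ^ 2 := by have := norm_pos_iff.2 hξ0; positivity
        have e1 : C ^ 7 * (- ψ z) ^ 3 * ‖ξ‖ ^ 2 ≤ C ^ 7 * (τ * 1) * ‖ξ‖ ^ 2 := by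
          gcongr
          have : (- ψ z) ^ 3 = (- ψ z) * (- ψ z) ^ 2 := by ring
          rw [this]
          gcongr
          · linarith
          · exact pow_le_one₀ (by linarith) (by linarith)
        have e2 : ‖ξ‖ ^ 2 ≤ C ^ 2 * (α * Lv ψ z ξ) := by
          have hL0 : 0 ≤ Lv ψ z ξ := by
            by_contra hc
            push Not at hc
            nlinarith
          calc ‖ξ‖ ^ 2 ≤ C * (1 * Lv ψ z ξ) := by linarith
            _ ≤ C * ((C * α) * Lv ψ z ξ) := by gcongr
            _ = _ := by ring
        have e3 : C ^ 2 * (C ^ 7 * (τ * 1) * ‖ξ‖ ^ 2) ≤ 1 / 256 * ‖ξ‖ ^ 2 := by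
          have : C ^ 2 * (C ^ 7 * (τ * 1) * ‖ξ‖ ^ 2) = (C ^ 9 * τ) * ‖ξ‖ ^ 2 := by ring
          rw [this]; gcongr; linarith
        have e4 : C ^ 2 * (c * (4 * ‖ξ‖ ^ 2)) = 1 / 4 * ‖ξ‖ ^ 2 := by
          have : C ^ 2 * (c * (4 * ‖ξ‖ ^ 2)) = (c * (16 * C ^ 2)) * (1 / 4 * ‖ξ‖ ^ 2) := by ring
          rw [this, hcC, one_mul]
        have e5 : C ^ 2 * Lv (rb Ω ρ φ) z ξ ≤ C ^ 2 * (C ^ 7 * (τ * 1) * ‖ξ‖ ^ 2) := by gcongr; exact hξ.trans e1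
        have e6 : 0 < C ^ 2 * (α * Lv ψ z ξ + (-1 * Lv (rb Ω ρ φ) z ξ + (-c * (4 * ‖ξ‖ ^ 2) + 0))) := by nlinarith
        exact pos_of_mul_pos_right e6 (by positivity)
  obtain ⟨A, hA⟩ : ∃ A, A = 25 * C ^ 4 := ⟨_, rfl⟩
  have hA0 : 0 < A := by rw [hA]; positivity
  have high : ∀ z ∈ K, (rb Ω ρ φ z + ((- α) * ψ z + (A * ψ z ^ 2 + ((-1) * ‖z - z1‖ ^ 2 + (- (26 * C ^ 4 * τ ^ 2)))))) ≤ 0 := by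
    refine max_principle hKc ?_ ?_
    · exact h.cont.continuousOn.add ((continuousOn_const.mul hψK).add ((continuousOn_const.mul (hψK.pow 2)).add
        (((continuous_const.mul hnc.continuous).add continuous_const).continuousOn)))
    · intro z hz
      have hzb := hbs hz.1.2
      have hψ0 := psi_nonpos h.toSys hp hzb hz.1.1
      have hzt : - τ ≤ ψ z := hz.2
      have hψ2 : ψ z ^ 2 ≤ τ ^ 2 := sq_le_sq' hzt (by linarith)
      have hAψ : A * ψ z ^ 2 ≤ 25 * C ^ 4 * τ ^ 2 := by rw [hA]; gcongr
      have hC4 : 0 ≤ C ^ 4 * τ ^ 2 := by positivity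
      rcases tri z hz with hf | ⟨hzΩ, h1⟩ | ⟨hzΩ, h1⟩ | ⟨hzΩ, h1⟩
      · left
        rw [h.zero z hf, rb_out (h.notMem hf)]
        have : 0 ≤ ‖z - z1‖ ^ 2 := by positivity
        linarith
      · left
        have m := h.m2 p hp z hzb z1 hz1s hzΩ (subset_closure hz1Ω)
        rw [show ψ z1 - ψ z = 0 by rw [h1, hτ]; ring, abs_zero, zero_add, h1, neg_neg, norm_sub_rev] at m
        rw [h1] at hAψ ⊢
        have e : C * (τ * ‖z - z1‖) ≤ ‖z - z1‖ ^ 2 + C ^ 2 * τ ^ 2 := by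
          nlinarith [sq_nonneg (‖z - z1‖ - C * τ), sq_nonneg (‖z - z1‖ + C * τ)]
        have : C ^ 2 * τ ^ 2 ≤ C ^ 4 * τ ^ 2 := by
          have := pow_le_pow_right₀ hC1 (show 2 ≤ 4 by norm_num)
          gcongr
        linarith
      · left
        have m := h.rb_nonpos z
        rw [h1]
        have e1 : α * (- ψ z) ≤ C * τ := by gcongr; linarith; linarith
        nlinarith
      · right
        have c1 := h.psi_cd hp hzb
        have c2 := h.r_cd hzΩ
        have c3 : ContDiffAt ℝ 2 (fun z : E => ‖z - z1‖ ^ 2) z := hnc.contDiffAt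
        have c4 : ContDiffAt ℝ 2 (fun z => (- α) * ψ z) z := contDiffAt_const.mul c1
        have c5' : ContDiffAt ℝ 2 (fun z => ψ z ^ 2) z := c1.pow 2
        have c5 : ContDiffAt ℝ 2 (fun z => A * ψ z ^ 2) z := contDiffAt_const.mul c5'
        have c6 : ContDiffAt ℝ 2 (fun z : E => (-1) * ‖z - z1‖ ^ 2) z := contDiffAt_const.mul c3
        have c7 : ContDiffAt ℝ 2 (fun z : E => (- (26 * C ^ 4 * τ ^ 2))) z := contDiffAt_const
        have hP := h.D p hp z hzb
        obtain ⟨v, hv, hv2⟩ := dual_vec hC hP.gr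
        have q1 : fderiv ℝ ψ z v = 1 := by simpa using hv2 1
        have q2 : fderiv ℝ ψ z (I • v) = 0 := by simpa using hv2 I
        refine ⟨h1, c2.add (c4.add (c5.add (c6.add c7))), v, ?_⟩
        rw [Lv_add c2 (c4.add (c5.add (c6.add c7))), Lv_add c4 (c5.add (c6.add c7)), Lv_add c5 (c6.add c7), Lv_add c6 c7,
          Lv_const_mul _ c1, Lv_const_mul _ c5', Lv_const_mul _ c3, Lv_const, Lv_normSq, Lv_sq c1, q1, q2]
        have hr := h.Lv_rb_nonneg hzΩ v
        have hL := Lv_le hP.d2 v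
        have hv4 : ‖v‖ ^ 2 ≤ 4 * C ^ 2 := by
          calc ‖v‖ ^ 2 ≤ (2 * C) ^ 2 := by gcongr
            _ = _ := by ring
        have hL2 : |Lv ψ z v| ≤ 8 * C ^ 3 := hL.trans (by
          calc 2 * C * ‖v‖ ^ 2 ≤ 2 * C * (4 * C ^ 2) := by gcongr
            _ = _ := by ring)
        have g1 : α * Lv ψ z v ≤ C * (8 * C ^ 3) :=
          (mul_le_mul_of_nonneg_left ((le_abs_self _).trans hL2) hα0).trans (by gcongr)
        have g2 : (- ψ z) * Lv ψ z v ≤ τ * (8 * C ^ 3) :=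
          (mul_le_mul_of_nonneg_left ((le_abs_self _).trans hL2) (by linarith)).trans (by gcongr; linarith)
        have g3 : C ^ 3 * τ ≤ s ^ 2 / 256 := hτk 3 (by norm_num)
        have g4 : (- ψ z) * Lv ψ z v ≤ 1 / 32 := by linarith
        have g5 : A * ((- ψ z) * Lv ψ z v) ≤ A * (1 / 32) := by gcongr
        have c24 : C ^ 2 ≤ C ^ 4 := pow_le_pow_right₀ hC1 (by norm_num)
        have c4p : 0 < C ^ 4 := by positivity
        rw [hA] at g5 ⊢
        nlinarith
  refine ⟨α, hα0, hαC, fun z hz1 hz2 hz3 => ?_⟩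
  have hzK : z ∈ K := ⟨⟨hz1, by rwa [mem_closedBall, dist_eq_norm]⟩, hz2⟩
  have l := low z hzK
  have u := high z hzK
  have a1 : 0 ≤ A * ψ z ^ 2 := by positivity
  have c4 : 1 ≤ C ^ 4 := one_le_pow₀ hC1
  have c2 : 1 ≤ C ^ 2 := one_le_pow₀ hC1
  have a2 : ‖z - z1‖ ^ 2 ≤ C ^ 4 * ‖z - z1‖ ^ 2 := le_mul_of_one_le_left (by positivity) c4
  have hc1 : c ≤ 1 := by nlinarith
  have a3 : c * ‖z - z1‖ ^ 2 ≤ 1 * ‖z - z1‖ ^ 2 := by gcongr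
  have a4 : 0 ≤ C ^ 4 * τ ^ 2 := by positivity
  have a5 : 0 ≤ C ^ 4 * ‖z - z1‖ ^ 2 := by positivity
  rw [abs_le]
  constructor <;> nlinarith

end NSec


section RSec
variable {E : Type*} [NormedAddCommGroup E] [InnerProductSpace ℂ E] [NormedSpace ℝ E] [IsScalarTower ℝ ℂ E]

open scoped ContDiff

variable [FiniteDimensional ℂ E]
variable {Ω : Set E} {ψ : E → ℝ} {Ω₂ : Set E} {ρ : E → ℝ} {φ : E → E} {C s : ℝ}

lemma Sys.psi_taylor (h : Sys Ω ψ Ω₂ ρ φ C s) {p : E} (hp : p ∈ frontier Ω) {x y : E} (hx : x ∈ ball p s) (hy : y ∈ ball p s) :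
    |ψ y - ψ x - fderiv ℝ ψ x (y - x)| ≤ C * ‖y - x‖ ^ 2 :=
  taylor2 (convex_ball p s) (fun z hz => (h.D p hp z hz).cd.differentiableAt (by simp)) (fun z hz => cda_fderiv_diff (h.psi_cd hp hz))
    (fun z hz => (h.D p hp z hz).d2) hx hy

set_option maxHeartbeats 1000000 in
lemma Sys5.B (h : Sys5 Ω ψ Ω₂ ρ φ C s) {p z0 : E} (hp : p ∈ frontier Ω) (hz0 : z0 ∈ ball p (s / 8)) (hz0Ω : z0 ∈ Ω) {t : ℝ}
    (ht : t = - ψ z0) (hsm : 2000 * C ^ 9 * t ≤ s ^ 2) :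
    ∃ α, 0 ≤ α ∧ α ≤ C ∧ ∀ z, ‖z - z0‖ ≤ t / (2 * C) →
      rb Ω ρ φ z ≤ rb Ω ρ φ z0 + α * fderiv ℝ ψ z0 (z - z0) + 4000 * C ^ 6 * t ^ 2 := by
  have hC := h.C0
  have hC1 := h.hC
  have hs0 := h.s0
  have hs1 := h.s1
  have hz0s : z0 ∈ ball p s := ball_subset_ball (by linarith) hz0
  have ht0 : 0 < t := by rw [ht]; exact h.psi_neg hp hz0s hz0Ω
  have hs2 : s ^ 2 ≤ s := by nlinarith
  have c9 : ∀ k ≤ 9, C ^ k ≤ C ^ 9 := fun k hk => pow_le_pow_right₀ hC1 hk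
  have hτ9 : C ^ 9 * t ≤ s ^ 2 / 2000 := by linarith
  have hτk : ∀ k ≤ 9, C ^ k * t ≤ s / 2000 := fun k hk => le_trans (by gcongr) (hτ9.trans (by linarith))
  have k1 : C * t ≤ s / 2000 := by simpa using hτk 1 (by norm_num)
  have k3 : C ^ 3 * t ≤ s / 2000 := hτk 3 (by norm_num)
  obtain ⟨v, hv, hv2⟩ := dual_vec hC (h.D p hp z0 hz0s).gr
  have hv1 : fderiv ℝ ψ z0 v = 1 := by simpa using hv2 1
  obtain ⟨z1, hz1d⟩ : ∃ z1, z1 = z0 - (3 * t) • v := ⟨_, rfl⟩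
  have e1 : z1 - z0 = (- (3 * t)) • v := by rw [hz1d]; module
  have n1 : ‖z1 - z0‖ ≤ 6 * C * t := by
    rw [e1, norm_smul, Real.norm_eq_abs, abs_neg, abs_of_pos (by positivity)]
    calc 3 * t * ‖v‖ ≤ 3 * t * (2 * C) := by gcongr
      _ = _ := by ring
  have hz1b : z1 ∈ ball p (s / 4) := by
    rw [mem_ball, dist_eq_norm] at hz0 ⊢
    rw [show z1 - p = (z1 - z0) + (z0 - p) by abel]
    have := norm_add_le (z1 - z0) (z0 - p)
    linarith
  have hz1s : z1 ∈ ball p s := ball_subset_ball (by linarith) hz1b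
  have T1 := h.psi_taylor hp hz0s hz1s
  have q1 : fderiv ℝ ψ z0 (z1 - z0) = - (3 * t) := by rw [e1, map_smul, hv1]; simp
  have q2 : C * ‖z1 - z0‖ ^ 2 ≤ t := by
    calc C * ‖z1 - z0‖ ^ 2 ≤ C * (6 * C * t) ^ 2 := by gcongr
      _ = 36 * (C ^ 3 * t) * t := by ring
      _ ≤ 1 * t := by gcongr; linarith
      _ = t := one_mul t
  rw [q1] at T1
  have T2 := abs_le.1 (T1.trans q2)
  have hτ1 : 3 * t ≤ - ψ z1 := by linarith [T2.1, T2.2]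
  have hτ2 : - ψ z1 ≤ 5 * t := by linarith [T2.1, T2.2]
  have hz1Ω : z1 ∈ Ω := (h.D p hp z1 hz1s).mem.2 (by linarith)
  obtain ⟨α, hα0, hαC, hN⟩ := h.N hp hz1b hz1Ω rfl (by
    calc 256 * C ^ 9 * (- ψ z1) ≤ 256 * C ^ 9 * (5 * t) := by gcongr
      _ ≤ 2000 * C ^ 9 * t := by
        have : 0 ≤ C ^ 9 * t := by positivity
        linarith
      _ ≤ _ := hsm)
  refine ⟨α, hα0, hαC, fun z hz => ?_⟩
  obtain ⟨hzs, hzΩ, hz2, hz3⟩ := h.deep hp (ball_subset_ball (by linarith) hz0) hz0Ω (x := z) (by rwa [← ht])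
  have htC : t / (2 * C) ≤ t / 2 := by
    apply div_le_div_of_nonneg_left ht0.le (by norm_num); linarith
  have htt : t ≤ C * t := le_mul_of_one_le_left ht0.le hC1
  have key : ∀ x ∈ Ω, 2 * ψ z0 ≤ ψ x → ‖x - z0‖ ≤ t / 2 → |rb Ω ρ φ x - α * ψ x| ≤ 1924 * C ^ 6 * t ^ 2 := by
    intro x hx hx2 hx3
    have hd : ‖x - z1‖ ≤ 7 * C * t := by
      rw [show x - z1 = (x - z0) - (z1 - z0) by abel]
      have := norm_sub_le (x - z0) (z1 - z0)
      linarith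
    refine (hN x (subset_closure hx) (by linarith) (by linarith)).trans ?_
    calc 26 * C ^ 4 * ((- ψ z1) ^ 2 + ‖x - z1‖ ^ 2) ≤ 26 * C ^ 4 * ((5 * t) ^ 2 + (7 * C * t) ^ 2) := by
          gcongr; linarith
      _ = 26 * (25 * (C ^ 4 * t ^ 2) + 49 * C ^ 6 * t ^ 2) := by ring
      _ ≤ 26 * (25 * (C ^ 6 * t ^ 2) + 49 * C ^ 6 * t ^ 2) := by
          gcongr <;> first | exact hC1 | norm_num
      _ = _ := by ring
  have a1 := abs_le.1 (key z hzΩ hz2 (hz.trans htC))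
  have a2 := abs_le.1 (key z0 hz0Ω (by linarith) (by simpa using by linarith))
  have T3 := abs_le.1 (h.psi_taylor hp hz0s hzs)
  have b1 : C * ‖z - z0‖ ^ 2 ≤ C * t ^ 2 := by
    gcongr; linarith
  have b2 : α * (ψ z - ψ z0 - fderiv ℝ ψ z0 (z - z0)) ≤ C * (C * t ^ 2) :=
    (mul_le_mul_of_nonneg_left (T3.2.trans b1) hα0).trans (by gcongr)
  have b3 : C * (C * t ^ 2) ≤ C ^ 6 * t ^ 2 := by
    calc C * (C * t ^ 2) = C ^ 2 * t ^ 2 := by ring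
      _ ≤ C ^ 6 * t ^ 2 := by gcongr <;> first | exact hC1 | norm_num
  have : 0 ≤ C ^ 6 * t ^ 2 := by positivity
  linarith [a1.2, a2.1]

set_option maxHeartbeats 1000000 in
lemma Sys5.dphiB (h : Sys5 Ω ψ Ω₂ ρ φ C s) {p z0 : E} (hp : p ∈ frontier Ω) (hz0 : z0 ∈ ball p (s / 8)) (hz0Ω : z0 ∈ Ω) {t : ℝ}
    (ht : t = - ψ z0) (hsm : 2000 * C ^ 9 * t ≤ s ^ 2) : ‖fderiv ℂ φ z0‖ ≤ 254 * C ^ 5 := by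
  have : CompleteSpace E := FiniteDimensional.complete ℂ E
  have hC := h.C0
  have hC1 := h.hC
  have hs0 := h.s0
  have hs1 := h.s1
  have hz0s : z0 ∈ ball p s := ball_subset_ball (by linarith) hz0
  have ht0 : 0 < t := by rw [ht]; exact h.psi_neg hp hz0s hz0Ω
  obtain ⟨α, hα0, hαC, hB⟩ := h.B hp hz0 hz0Ω ht hsm
  refine ContinuousLinearMap.opNorm_le_of_unit_norm (by positivity) fun ξ hξ => ?_
  obtain ⟨R, hR⟩ : ∃ R, R = t / (2 * C) := ⟨_, rfl⟩
  have hR0 : 0 < R := by rw [hR]; positivity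
  set U : Set ℂ := {ζ : ℂ | z0 + ζ • ξ ∈ Ω} with hU
  have hUo : IsOpen U := line_isOpen h.op z0 ξ
  have hin : ∀ ζ ∈ closedBall (0:ℂ) R, ‖z0 + ζ • ξ - z0‖ ≤ t / (2 * C) := by
    intro ζ hζ
    have h1 : z0 + ζ • ξ ∈ closedBall z0 R := line_mem hξ.le (by simpa using hζ)
    rw [← dist_eq_norm, ← hR]; exact h1
  have hdeep : ∀ ζ ∈ closedBall (0:ℂ) R, z0 + ζ • ξ ∈ ball p s ∧ z0 + ζ • ξ ∈ Ω := by
    intro ζ hζ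
    have := h.deep hp (ball_subset_ball (by linarith) hz0) hz0Ω (x := z0 + ζ • ξ) (by rw [← ht]; exact hin ζ hζ)
    exact ⟨this.1, this.2.1⟩
  have hsub : closedBall (0:ℂ) R ⊆ U := fun ζ hζ => (hdeep ζ hζ).2
  have hgd := line_diffOn h.op h.hol z0 ξ
  set g : ℂ → E := fun ζ => φ (z0 + ζ • ξ) with hg
  have hdg : ∀ ζ, deriv (fun ζ => g ζ - g 0) ζ = deriv g ζ := fun ζ => by simp
  have hline : DifferentiableOn ℂ (fun ζ : ℂ => z0 + ζ • ξ) U := fun ζ _ => (line_hasDerivAt z0 ξ ζ).differentiableAt.differentiableWithinAt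
  -- the comparison function on E
  have hnc : ContDiff ℝ 2 (fun z : E => ‖z - z0‖ ^ 2) := (contDiff_normSq_sub z0).of_le (by exact le_top)
  have hlin : ContDiff ℝ 2 (fun z : E => fderiv ℝ ψ z0 z) := ContinuousLinearMap.contDiff _
  set W : E → ℝ := fun z => rb Ω ρ φ z + ((- α) * fderiv ℝ ψ z0 z + C ^ 3 * ‖z - z0‖ ^ 2) with hW
  have hWc : ∀ z ∈ Ω, ContDiffAt ℝ 2 W z := fun z hz =>
    (h.r_cd hz).add ((contDiffAt_const.mul hlin.contDiffAt).add (contDiffAt_const.mul hnc.contDiffAt))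
  have hWL : ∀ z ∈ Ω, Lv W z ξ = Lv (rb Ω ρ φ) z ξ + C ^ 3 * 4 := by
    intro z hz
    have c1 : ContDiffAt ℝ 2 (fun z : E => (- α) * fderiv ℝ ψ z0 z) z := contDiffAt_const.mul hlin.contDiffAt
    have c2 : ContDiffAt ℝ 2 (fun z : E => C ^ 3 * ‖z - z0‖ ^ 2) z := contDiffAt_const.mul hnc.contDiffAt
    rw [hW, Lv_add (h.r_cd hz) (c1.add c2), Lv_add c1 c2, Lv_const_mul _ hlin.contDiffAt, Lv_const_mul _ hnc.contDiffAt, Lv_normSq, Lv_clm, hξ]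
    ring
  have key := disc_lemma (g := fun ζ => g ζ - g 0) (V := fun ζ => W (z0 + ζ • ξ)) (R := R) (c := 1 / (4 * C))
    (M := W z0 + (4000 * C ^ 6 * t ^ 2 + C ^ 3 * R ^ 2))
    hUo hsub hR0 (by positivity) (hgd.sub_const _) (by simp) ?_ ?_ ?_
  · rw [hdg, show deriv g 0 = fderiv ℂ φ z0 ξ by
      have := line_deriv (φ := φ) (z := z0) (ξ := ξ) (ζ := 0) (by simpa using h.phi_d hz0Ω)
      simpa using this] at key
    simp only [zero_smul, add_zero] at key
    have h4 : 1 / (4 * C) * ‖fderiv ℂ φ z0 ξ‖ ^ 2 * R ^ 2 ≤ (16000 * C ^ 8 + C ^ 3) * R ^ 2 := by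
      have : (16000 * C ^ 8 + C ^ 3) * R ^ 2 = 4000 * C ^ 6 * t ^ 2 + C ^ 3 * R ^ 2 := by rw [hR]; field_simp; ring
      rw [this]; linarith
    have h5 := le_of_mul_le_mul_right h4 (by positivity)
    rw [one_div, inv_mul_le_iff₀ (by positivity)] at h5
    have h6 : ‖fderiv ℂ φ z0 ξ‖ ^ 2 ≤ (254 * C ^ 5) ^ 2 := by
      refine h5.trans ?_
      have a : C ^ 4 ≤ C ^ 10 := pow_le_pow_right₀ hC1 (by norm_num)
      have b : C ^ 9 ≤ C ^ 10 := pow_le_pow_right₀ hC1 (by norm_num)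
      have c0 : 0 < C ^ 10 := by positivity
      calc 4 * C * (16000 * C ^ 8 + C ^ 3) = 64000 * C ^ 9 + 4 * C ^ 4 := by ring
        _ ≤ 64516 * C ^ 10 := by linarith
        _ = _ := by ring
    exact (sq_le_sq₀ (norm_nonneg _) (by positivity)).1 h6
  · intro ζ hζ
    exact ContDiffAt.comp (g := W) ζ (hWc _ (hdeep ζ hζ).2) (holo1_facts hUo hline (hsub hζ)).1
  · intro ζ hζ
    obtain ⟨hzs, hzΩ⟩ := hdeep ζ hζ
    rw [Lv_line hUo hline (hsub hζ) (hWc _ hzΩ), (line_hasDerivAt z0 ξ ζ).deriv, hWL _ hzΩ, hdg,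
      line_deriv (φ := φ) (z := z0) (ξ := ξ) (ζ := ζ) (h.phi_d hzΩ), h.Lv_rb hzΩ]
    have h1 := (h.T p hp _ hzs hzΩ).hor (fderiv ℂ φ (z0 + ζ • ξ) ξ)
    rw [← h.Qf_rb hzΩ] at h1
    have h2 : Qf (rb Ω ρ φ) (z0 + ζ • ξ) ξ ≤ 2 * C ^ 2 := by
      have hd := h.dr p hp _ hzs hzΩ
      unfold Qf
      have g1 : ‖fderiv ℝ (rb Ω ρ φ) (z0 + ζ • ξ) ξ‖ ≤ C := (ContinuousLinearMap.le_of_opNorm_le _ hd _).trans (by rw [hξ, mul_one])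
      have g2 : ‖fderiv ℝ (rb Ω ρ φ) (z0 + ζ • ξ) (I • ξ)‖ ≤ C := (ContinuousLinearMap.le_of_opNorm_le _ hd _).trans (by rw [normI, hξ, mul_one])
      have g3 := sq_le_sq' (abs_le.1 g1).1 (abs_le.1 g1).2
      have g4 := sq_le_sq' (abs_le.1 g2).1 (abs_le.1 g2).2
      linarith
    have h3 : 4 * (1 / (4 * C)) * ‖fderiv ℂ φ (z0 + ζ • ξ) ξ‖ ^ 2 = ‖fderiv ℂ φ (z0 + ζ • ξ) ξ‖ ^ 2 / C := by field_simp
    rw [h3, div_le_iff₀ hC]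
    have h4 : C * Qf (rb Ω ρ φ) (z0 + ζ • ξ) ξ ≤ C * (2 * C ^ 2) := by gcongr
    refine h1.trans ?_
    rw [mul_comm (_ + C ^ 3 * 4)]
    refine mul_le_mul_of_nonneg_left ?_ hC.le
    have : 0 < C ^ 3 := by positivity
    linarith
  · intro ζ hζ
    have h1 := hB _ (hin ζ hζ)
    have h2 := hin ζ hζ
    rw [← hR] at h2
    have h3 : C ^ 3 * ‖z0 + ζ • ξ - z0‖ ^ 2 ≤ C ^ 3 * R ^ 2 := by gcongr
    rw [map_sub, mul_sub] at h1
    simp only [hW, sub_self, norm_zero]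
    linarith

end RSec


section SSec
variable {E : Type*} [NormedAddCommGroup E] [InnerProductSpace ℂ E] [NormedSpace ℝ E] [IsScalarTower ℝ ℂ E]

open scoped ContDiff

/-- the standing data with bounded derivative of the map and the one-sided second order bound -/
structure Sys6 (Ω : Set E) (ψ : E → ℝ) (Ω₂ : Set E) (ρ : E → ℝ) (φ : E → E) (C s : ℝ) : Prop
    extends Sys3 Ω ψ Ω₂ ρ φ C s where
  dB : ∀ p ∈ frontier Ω, ∀ z ∈ ball p s, z ∈ Ω → ‖fderiv ℂ φ z‖ ≤ C
  B : ∀ p ∈ frontier Ω, ∀ z0 ∈ ball p s, z0 ∈ Ω → ∃ α : ℝ, ∀ z, ‖z - z0‖ ≤ - ψ z0 / C →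
      rb Ω ρ φ z ≤ rb Ω ρ φ z0 + α * fderiv ℝ ψ z0 (z - z0) + C * (- ψ z0) ^ 2

variable [FiniteDimensional ℂ E]
variable {Ω : Set E} {ψ : E → ℝ} {Ω₂ : Set E} {ρ : E → ℝ} {φ : E → E} {C s : ℝ}

lemma Sys5.exists6 (h : Sys5 Ω ψ Ω₂ ρ φ C s) : ∃ C' s', Sys6 Ω ψ Ω₂ ρ φ C' s' := by
  have hC := h.C0
  have hC1 := h.hC
  have hs0 := h.s0
  have hs1 := h.s1
  obtain ⟨s', hs'⟩ : ∃ s', s' = s ^ 2 / (2000 * C ^ 10) := ⟨_, rfl⟩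
  have hs'0 : 0 < s' := by rw [hs']; positivity
  have hs'8 : s' ≤ s / 8 := by
    rw [hs', div_le_iff₀ (by positivity)]
    have : 1 ≤ C ^ 10 := one_le_pow₀ hC1
    nlinarith [mul_le_mul_of_nonneg_left this hs0.le]
  have hsm : ∀ p ∈ frontier Ω, ∀ z ∈ ball p s', z ∈ Ω → 2000 * C ^ 9 * (- ψ z) ≤ s ^ 2 := by
    intro p hp z hz hzΩ
    have hzs : z ∈ ball p s := ball_subset_ball (by linarith) hz
    have h1 := h.psi_le hp hzs
    have h2 : ‖z - p‖ ≤ s' := by rw [← dist_eq_norm]; exact hz.le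
    have h3 := neg_abs_le (ψ z)
    calc 2000 * C ^ 9 * (- ψ z) ≤ 2000 * C ^ 9 * (C * s') := by
          gcongr
          calc - ψ z ≤ C * ‖z - p‖ := by linarith
            _ ≤ C * s' := by gcongr
      _ = s ^ 2 := by rw [hs']; field_simp
  have hCC : C ≤ 4000 * C ^ 6 := by
    have : C ^ 1 ≤ C ^ 6 := pow_le_pow_right₀ hC1 (by norm_num)
    rw [pow_one] at this
    linarith
  refine ⟨4000 * C ^ 6, s', { toSys3 := h.toSys3.mono hCC (by linarith) hs'0, dB := ?_, B := ?_ }⟩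
  · intro p hp z hz hzΩ
    refine (h.dphiB hp (ball_subset_ball hs'8 hz) hzΩ rfl (hsm p hp z hz hzΩ)).trans ?_
    have : C ^ 5 ≤ C ^ 6 := pow_le_pow_right₀ hC1 (by norm_num)
    have h0 : 0 < C ^ 5 := by positivity
    linarith
  · intro p hp z hz hzΩ
    obtain ⟨α, _, _, hB⟩ := h.B hp (ball_subset_ball hs'8 hz) hzΩ rfl (hsm p hp z hz hzΩ)
    have ht := h.psi_neg hp (ball_subset_ball (by linarith) hz) hzΩ
    refine ⟨α, fun x hx => hB x (hx.trans ?_)⟩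
    apply div_le_div_of_nonneg_left ht.le (by positivity)
    have : C ^ 1 ≤ C ^ 6 := pow_le_pow_right₀ hC1 (by norm_num)
    rw [pow_one] at this
    linarith

set_option maxHeartbeats 1000000 in
lemma Sys6.d2diag (h : Sys6 Ω ψ Ω₂ ρ φ C s) {p z : E} (hp : p ∈ frontier Ω)
    (hz : z ∈ ball p (s / (2 * C ^ 2))) (hzΩ : z ∈ Ω) {ξ : E} (hξ : ‖ξ‖ = 1) : |D2 (rb Ω ρ φ) z ξ ξ| ≤ 257 * C ^ 3 := by
  have hC := h.C0
  have hC1 := h.hC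
  have hs := h.s0
  have hs1 := h.s1
  have hC2 : 1 ≤ C ^ 2 := one_le_pow₀ hC1
  have hz2 : z ∈ ball p (s / 2) := by
    refine ball_subset_ball ?_ hz
    apply div_le_div_of_nonneg_left hs.le (by norm_num); linarith
  have hzs : z ∈ ball p s := ball_subset_ball (by linarith) hz2
  have ht := h.psi_neg hp hzs hzΩ
  have htle : - ψ z ≤ 1 / (2 * C) := by
    have h1 := h.psi_le hp hzs
    rw [abs_of_neg (by linarith)] at h1
    have h2 : ‖z - p‖ ≤ s / (2 * C ^ 2) := by rw [← dist_eq_norm]; exact hz.le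
    calc - ψ z ≤ C * (s / (2 * C ^ 2)) := h1.trans (by gcongr)
      _ ≤ C * (1 / (2 * C ^ 2)) := by gcongr
      _ = _ := by field_simp
  obtain ⟨t, htd⟩ : ∃ t, t = - ψ z := ⟨_, rfl⟩
  rw [← htd] at ht htle
  obtain ⟨l, hl⟩ := exists_cfun (fderiv ℝ ρ (φ z))
  obtain ⟨l', hl'⟩ := exists_cfun (fderiv ℝ ψ z)
  obtain ⟨α, hB⟩ := h.B p hp z hzs hzΩ
  rw [← htd] at hB
  obtain ⟨R, hR⟩ : ∃ R, R = t / (2 * C) := ⟨_, rfl⟩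
  have hR0 : 0 < R := by rw [hR]; positivity
  have hCR : C * R = t / 2 := by rw [hR]; field_simp
  have hTP := h.T p hp z hzs hzΩ
  have hdp : ∀ x ∈ closedBall z R, x ∈ ball p s ∧ x ∈ Ω := by
    intro x hx
    have := h.deep hp hz2 hzΩ (x := x) (by rw [← htd, ← hR, ← dist_eq_norm]; exact hx)
    exact ⟨this.1, this.2.1⟩
  have hlin : ∀ ζ ∈ ball (0:ℂ) R, z + ζ • ξ ∈ closedBall z R := fun ζ hζ => by
    have hn : ‖ζ‖ < R := by simpa using hζ
    exact line_mem hξ.le hn.le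
  have hpt : ∀ ζ ∈ ball (0:ℂ) R, z + ζ • ξ ∈ Ω ∧ ‖φ (z + ζ • ξ) - φ z‖ ≤ t / 2 := by
    intro ζ hζ
    have h1 := hlin ζ hζ
    refine ⟨(hdp _ h1).2, ?_⟩
    have h2 := (convex_closedBall z R).norm_image_sub_le_of_norm_fderiv_le (𝕜 := ℂ) (f := φ) (C := C) (fun u hu => h.phi_d (hdp u hu).2)
      (fun u hu => h.dB p hp u (hdp u hu).1 (hdp u hu).2) (mem_closedBall_self hR0.le) h1
    refine h2.trans ?_
    rw [← hCR]
    rw [mem_closedBall, dist_eq_norm] at h1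
    gcongr
  have hG : DifferentiableOn ℂ (fun ζ : ℂ => l (φ (z + ζ • ξ) - φ z)) (ball 0 R) := by
    intro ζ hζ
    have h1 := line_diffOn h.op h.hol z ξ
    exact (l.differentiableAt.comp_differentiableWithinAt (x := ζ)  ((h1 ζ (hpt ζ hζ).1).sub_const (φ z))).mono (fun ζ' hζ' => (hpt ζ' hζ').1)
  have key := bc2 (M := 2 * C * t ^ 2) (a := α * l' ξ) hR0 (by positivity) hG (by simp) ?_
  · have hder : deriv (fun ζ : ℂ => l (φ (z + ζ • ξ) - φ z)) =ᶠ[nhds 0] fun ζ => l (fderiv ℂ φ (z + ζ • ξ) ξ) := by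
      filter_upwards [isOpen_ball.mem_nhds (mem_ball_self (x := (0:ℂ)) hR0)] with ζ hζ
      have h1 : HasDerivAt (fun ζ : ℂ => φ (z + ζ • ξ)) (fderiv ℂ φ (z + ζ • ξ) ξ) ζ :=
        (h.phi_d (hpt ζ hζ).1).hasFDerivAt.comp_hasDerivAt ζ (line_hasDerivAt z ξ ζ)
      exact (l.hasFDerivAt.comp_hasDerivAt ζ (h1.sub_const (φ z))).deriv
    have hder2 : deriv (fun ζ : ℂ => l (fderiv ℂ φ (z + ζ • ξ) ξ)) 0 = l (fderiv ℂ (fderiv ℂ φ) z ξ ξ) := by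
      have h1 : HasDerivAt (fun ζ : ℂ => fderiv ℂ φ (z + ζ • ξ)) (fderiv ℂ (fderiv ℂ φ) z ξ) 0 := by
        have h2 : HasFDerivAt (fderiv ℂ φ) (fderiv ℂ (fderiv ℂ φ) z) (z + (0:ℂ) • ξ) := by simpa using (h.phi_d2 hzΩ).hasFDerivAt
        exact h2.comp_hasDerivAt 0 (line_hasDerivAt z ξ 0)
      have h3 : HasDerivAt (fun ζ : ℂ => fderiv ℂ φ (z + ζ • ξ) ξ) (fderiv ℂ (fderiv ℂ φ) z ξ ξ) 0 :=
        (ContinuousLinearMap.apply ℂ E ξ).hasFDerivAt.comp_hasDerivAt (0:ℂ) h1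
      exact (l.hasFDerivAt.comp_hasDerivAt (0:ℂ) h3).deriv
    rw [hder.deriv_eq, hder2] at key
    have hk2 : 32 * (2 * C * t ^ 2) / R ^ 2 = 256 * C ^ 3 := by rw [hR]; field_simp; ring
    rw [hk2] at key
    have e1 : D2 (rb Ω ρ φ) z ξ ξ = D2 ρ (φ z) (fderiv ℝ φ z ξ) (fderiv ℝ φ z ξ) + fderiv ℝ ρ (φ z) (D2 φ z ξ ξ) := by
      rw [D2_congr (h.rb_ev hzΩ)]
      exact D2_comp (h.rho_cd hzΩ) (h.phi_cd hzΩ) ξ ξ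
    rw [e1, D2_holo (h.phi_ev hzΩ) (h.phi_d2 hzΩ), ← hl]
    have e2 : ‖fderiv ℝ φ z ξ‖ ≤ C := by
      rw [fderiv_real_eq (h.phi_d hzΩ)]
      exact (ContinuousLinearMap.le_of_opNorm_le _ (h.dB p hp z hzs hzΩ) ξ).trans (by rw [hξ, mul_one])
    have e3 : |D2 ρ (φ z) (fderiv ℝ φ z ξ) (fderiv ℝ φ z ξ)| ≤ C * C * C := by
      refine ((D2 ρ (φ z)).le_opNorm₂ _ _).trans ?_
      have := hTP.d2 (φ z) (mem_ball_self (by positivity))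
      gcongr
    have e4 := (Complex.abs_re_le_norm (l (fderiv ℂ (fderiv ℂ φ) z ξ ξ))).trans key
    refine (abs_add_le _ _).trans ?_
    calc _ ≤ C * C * C + 256 * C ^ 3 := add_le_add e3 e4
      _ = _ := by ring
  · intro ζ hζ
    rw [hl]
    obtain ⟨h1, h2⟩ := hpt ζ hζ
    have hball : φ (z + ζ • ξ) ∈ ball (φ z) (1 / C) := by
      rw [mem_ball, dist_eq_norm]
      have h0 : 0 < 1 / C := by positivity
      have : 1 / (2 * C) = 1 / C / 2 := by field_simp
      linarith
    have h3 := taylor2 (f := ρ) (convex_ball (φ z) (1 / C)) (fun x hx => (hTP.cd x hx).differentiableAt (by simp))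
      (fun x hx => cda_fderiv_diff ((hTP.cd x hx).of_le (WithTop.coe_le_coe.2 le_top))) (fun x hx => hTP.d2 x hx) (mem_ball_self (by positivity)) hball
    rw [Real.norm_eq_abs] at h3
    have h4 := (abs_le.1 h3).1
    have h5 := hB (z + ζ • ξ) (by
      have := hlin ζ hζ
      rw [mem_closedBall, dist_eq_norm] at this
      refine this.trans ?_
      rw [hR]
      apply div_le_div_of_nonneg_left ht.le hC; linarith)
    rw [rb_in hzΩ, rb_in h1, add_sub_cancel_left, ← hl'] at h5
    have h6 : (α * l' ξ * ζ).re = α * (l' (ζ • ξ)).re := by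
      rw [map_smul, smul_eq_mul, mul_assoc, mul_comm (l' ξ), Complex.re_ofReal_mul]
    rw [h6]
    have h7 : C * ‖φ (z + ζ • ξ) - φ z‖ ^ 2 ≤ C * (t / 2) ^ 2 := by gcongr
    have h8 : 0 < C * t ^ 2 := by positivity
    linarith

lemma Sys6.d2 (h : Sys6 Ω ψ Ω₂ ρ φ C s) {p z : E} (hp : p ∈ frontier Ω)
    (hz : z ∈ ball p (s / (2 * C ^ 2))) (hzΩ : z ∈ Ω) : ‖D2 (rb Ω ρ φ) z‖ ≤ 514 * C ^ 3 := by
  have hC := h.C0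
  have hg : ∀ ξ : E, |D2 (rb Ω ρ φ) z ξ ξ| ≤ 257 * C ^ 3 * ‖ξ‖ ^ 2 := by
    intro ξ
    by_cases h0 : ξ = 0
    · simp [h0]
    have hn : 0 < ‖ξ‖ := norm_pos_iff.2 h0
    have h1 := h.d2diag hp hz hzΩ (ξ := (‖ξ‖⁻¹ : ℝ) • ξ) (by rw [norm_smul]; simp [hn.ne'])
    have e : D2 (rb Ω ρ φ) z ((‖ξ‖⁻¹ : ℝ) • ξ) ((‖ξ‖⁻¹ : ℝ) • ξ) = (‖ξ‖⁻¹) ^ 2 * D2 (rb Ω ρ φ) z ξ ξ := by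
      simp only [map_smul, ContinuousLinearMap.smul_apply, smul_eq_mul]; ring
    rw [e, abs_mul, abs_of_pos (by positivity), inv_pow, inv_mul_le_iff₀ (by positivity)] at h1
    linarith
  refine ContinuousLinearMap.opNorm_le_of_unit_norm (by positivity) fun ξ hξ => ?_
  refine ContinuousLinearMap.opNorm_le_of_unit_norm (by positivity) fun η hη => ?_
  have hsy := D2_symm (h.r_cd hzΩ) ξ η
  have e1 : D2 (rb Ω ρ φ) z (ξ + η) (ξ + η) - D2 (rb Ω ρ φ) z (ξ - η) (ξ - η) = 4 * D2 (rb Ω ρ φ) z ξ η := by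
    simp only [map_add, map_sub, ContinuousLinearMap.add_apply, ContinuousLinearMap.sub_apply]
    linarith
  have n1 : ‖ξ + η‖ ≤ 2 := (norm_add_le _ _).trans (by rw [hξ, hη]; norm_num)
  have n2 : ‖ξ - η‖ ≤ 2 := (norm_sub_le _ _).trans (by rw [hξ, hη]; norm_num)
  have g1 := abs_le.1 ((hg (ξ + η)).trans (b := 257 * C ^ 3 * ‖ξ + η‖ ^ 2) (c := 257 * C ^ 3 * 2 ^ 2) (by gcongr))
  have g2 := abs_le.1 ((hg (ξ - η)).trans (b := 257 * C ^ 3 * ‖ξ - η‖ ^ 2) (c := 257 * C ^ 3 * 2 ^ 2) (by gcongr))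
  rw [Real.norm_eq_abs, abs_le]
  constructor <;> linarith [g1.1, g1.2, g2.1, g2.2]

end SSec


section TSec
variable {E : Type*} [NormedAddCommGroup E] [InnerProductSpace ℂ E] [NormedSpace ℝ E] [IsScalarTower ℝ ℂ E]

open scoped ContDiff

/-- a function which is locally Lipschitz up to the boundary is globally Lipschitz -/
lemma glob_lip {F G : Type*} [NormedAddCommGroup F] [NormedAddCommGroup G] {f : F → G} {S : Set F} (hS : IsCompact (closure S))
    (h : ∀ p ∈ closure S, ∃ K δ, 0 < δ ∧ ∀ x ∈ S, x ∈ ball p δ → ∀ y ∈ S, y ∈ ball p δ → ‖f x - f y‖ ≤ K * ‖x - y‖) :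
    ∃ K, ∀ x ∈ S, ∀ y ∈ S, ‖f x - f y‖ ≤ K * ‖x - y‖ := by
  have hb : ∀ p ∈ closure S, ∃ M δ, 0 < δ ∧ ∀ x ∈ S, x ∈ ball p δ → ‖f x‖ ≤ M := by
    intro p hp
    obtain ⟨K, δ, hδ, hK⟩ := h p hp
    obtain ⟨x0, hx0, hd⟩ := Metric.mem_closure_iff.1 hp δ hδ
    have hx0b : x0 ∈ ball p δ := by rw [mem_ball, dist_comm]; exact hd
    refine ⟨‖f x0‖ + |K| * (2 * δ), δ, hδ, fun x hx hxb => ?_⟩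
    have h1 := hK x hx hxb x0 hx0 hx0b
    have h2 : ‖x - x0‖ ≤ 2 * δ := by
      rw [← dist_eq_norm]
      rw [mem_ball] at hxb hx0b
      linarith [dist_triangle_right x x0 p]
    have h3 : K * ‖x - x0‖ ≤ |K| * (2 * δ) := (mul_le_mul_of_nonneg_right (le_abs_self K) (norm_nonneg _)).trans (by gcongr)
    have h4 := norm_add_le (f x - f x0) (f x0)
    rw [sub_add_cancel] at h4
    linarith
  have key : ∃ K, ∀ q ∈ closure S ×ˢ closure S, q.1 ∈ S → q.2 ∈ S → ‖f q.1 - f q.2‖ ≤ K * ‖q.1 - q.2‖ := by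
    refine (hS.prod hS).induction_on (p := fun T => ∃ K, ∀ q ∈ T, q.1 ∈ S → q.2 ∈ S → ‖f q.1 - f q.2‖ ≤ K * ‖q.1 - q.2‖) ?_ ?_ ?_ ?_
    · exact ⟨0, by simp⟩
    · rintro s t hst ⟨K, hK⟩
      exact ⟨K, fun q hq => hK q (hst hq)⟩
    · rintro s t ⟨K, hK⟩ ⟨L, hL⟩
      refine ⟨max K L, ?_⟩
      rintro q (hq | hq) h1 h2
      · exact (hK q hq h1 h2).trans (mul_le_mul_of_nonneg_right (le_max_left _ _) (norm_nonneg _))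
      · exact (hL q hq h1 h2).trans (mul_le_mul_of_nonneg_right (le_max_right _ _) (norm_nonneg _))
    · rintro ⟨p, q⟩ ⟨hp, hq⟩
      by_cases hpq : p = q
      · subst hpq
        obtain ⟨K, δ, hδ, hK⟩ := h p hp
        refine ⟨ball p δ ×ˢ ball p δ, mem_nhdsWithin_of_mem_nhds (prod_mem_nhds (ball_mem_nhds p hδ) (ball_mem_nhds p hδ)), K, ?_⟩
        rintro ⟨x, y⟩ ⟨hx, hy⟩ h1 h2
        exact hK x h1 hx y h2 hy
      · obtain ⟨M, δ, hδ, hM⟩ := hb p hp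
        obtain ⟨N, ε, hε, hN⟩ := hb q hq
        have hd : 0 < dist p q := dist_pos.2 hpq
        obtain ⟨d, hdd⟩ : ∃ d, d = dist p q := ⟨_, rfl⟩
        rw [← hdd] at hd
        refine ⟨ball p (min δ (d / 4)) ×ˢ ball q (min ε (d / 4)),
          mem_nhdsWithin_of_mem_nhds (prod_mem_nhds (ball_mem_nhds p (by positivity)) (ball_mem_nhds q (by positivity))), (|M| + |N|) * (2 / d), ?_⟩
        rintro ⟨x, y⟩ ⟨hx, hy⟩ h1 h2
        have a1 := hM x h1 (ball_subset_ball (min_le_left _ _) hx)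
        have a2 := hN y h2 (ball_subset_ball (min_le_left _ _) hy)
        have a3 : dist x p < d / 4 := lt_of_lt_of_le hx (min_le_right _ _)
        have a4 : dist y q < d / 4 := lt_of_lt_of_le hy (min_le_right _ _)
        have a5 : d / 2 ≤ ‖x - y‖ := by
          rw [← dist_eq_norm]
          have b1 := dist_triangle p x q
          have b2 := dist_triangle x y q
          rw [dist_comm p x] at b1
          linarith
        change ‖f x - f y‖ ≤ _ * ‖x - y‖
        calc ‖f x - f y‖ ≤ |M| + |N| := (norm_sub_le _ _).trans (add_le_add (a1.trans (le_abs_self _)) (a2.trans (le_abs_self _)))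
          _ = (|M| + |N|) * (2 / d) * (d / 2) := by field_simp
          _ ≤ _ := by gcongr
  obtain ⟨K, hK⟩ := key
  exact ⟨K, fun x hx y hy => hK (x, y) ⟨subset_closure hx, subset_closure hy⟩ hx hy⟩

variable [FiniteDimensional ℂ E]
variable {Ω : Set E} {ψ : E → ℝ} {Ω₂ : Set E} {ρ : E → ℝ} {φ : E → E} {C s : ℝ}

set_option maxHeartbeats 1000000 in
lemma Sys.bdry_lip (h : Sys Ω ψ Ω₂ ρ φ C s) {K : ℝ} {p : E} (hp : p ∈ frontier Ω)
    (hK : ∀ z ∈ ball p s, z ∈ Ω → ‖D2 (rb Ω ρ φ) z‖ ≤ K) :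
    ∃ K' δ, 0 < δ ∧ ∀ x ∈ Ω, x ∈ ball p δ → ∀ y ∈ Ω, y ∈ ball p δ →
      ‖fderiv ℝ (rb Ω ρ φ) x - fderiv ℝ (rb Ω ρ φ) y‖ ≤ K' * ‖x - y‖ := by
  have hC := h.C0
  have hC1 := h.hC
  have hs0 := h.s0
  have hs1 := h.s1
  have hC2 : 1 ≤ C ^ 2 := one_le_pow₀ hC1
  have hps : p ∈ ball p s := mem_ball_self hs0
  obtain ⟨v, hv, hv2⟩ := dual_vec hC (h.D p hp p hps).gr
  have hv1 : fderiv ℝ ψ p v = 1 := by simpa using hv2 1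
  obtain ⟨b, hb⟩ : ∃ b, b = s / (4 * C ^ 2) := ⟨_, rfl⟩
  have hb0 : 0 < b := by rw [hb]; positivity
  have hb1 : C ^ 2 * b ≤ 1 / 4 := by
    have : C ^ 2 * b = s / 4 := by rw [hb]; field_simp
    rw [this]; linarith
  have hbs : b ≤ s := by rw [hb, div_le_iff₀ (by positivity)]; nlinarith
  have hbb : ball p b ⊆ ball p s := ball_subset_ball hbs
  -- monotonicity along v
  have hdv : ∀ z ∈ ball p b, 1 / 2 ≤ fderiv ℝ ψ z v := by
    intro z hz
    have h1 : ‖fderiv ℝ ψ z - fderiv ℝ ψ p‖ ≤ C * ‖z - p‖ :=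
      mv1 (convex_ball p s) (fun x hx => cda_fderiv_diff (h.psi_cd hp hx)) (fun x hx => (h.D p hp x hx).d2) hps (hbb hz)
    have h2 : ‖z - p‖ ≤ b := by rw [← dist_eq_norm]; exact hz.le
    have h3 : |(fderiv ℝ ψ z - fderiv ℝ ψ p) v| ≤ C * b * (2 * C) := by
      refine (ContinuousLinearMap.le_of_opNorm_le _ h1 v).trans ?_
      gcongr
    have h4 := (abs_le.1 h3).1
    rw [sub_apply, hv1] at h4
    nlinarith
  have hmono : ∀ x ∈ ball p b, ∀ τ : ℝ, 0 ≤ τ → x - τ • v ∈ ball p b → ψ (x - τ • v) ≤ ψ x - τ / 2 := by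
    intro x hx τ hτ hx'
    obtain ⟨z, hz, he⟩ := domain_mvt (s := ball p b) (f := ψ) (f' := fun z => fderiv ℝ ψ z)
      (fun z hz => ((h.D p hp z (hbb hz)).cd.differentiableAt (by simp)).hasFDerivAt.hasFDerivWithinAt) (convex_ball p b) hx hx'
    have hzb : z ∈ ball p b := (convex_ball p b).segment_subset hx hx' hz
    rw [show x - τ • v - x = (- τ) • v by module, map_smul, smul_eq_mul] at he
    nlinarith [hdv z hzb]
  obtain ⟨δ, hδ⟩ : ∃ δ, δ = b / (20 * C ^ 2) := ⟨_, rfl⟩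
  have hδ0 : 0 < δ := by rw [hδ]; positivity
  have hδb : C ^ 2 * δ = b / 20 := by rw [hδ]; field_simp
  have hK0 : 0 ≤ K ∨ ∀ z ∈ ball p s, z ∉ Ω := by
    by_cases hz : ∃ z ∈ ball p s, z ∈ Ω
    · obtain ⟨z, hz, hzΩ⟩ := hz
      exact Or.inl ((norm_nonneg (D2 (rb Ω ρ φ) z)).trans (hK z hz hzΩ))
    · push Not at hz; exact Or.inr hz
  have hδ1 : δ ≤ b / 20 := by nlinarith
  rcases hK0 with hK0 | hno
  swap
  · exact ⟨0, δ, hδ0, fun x hx hxb => absurd hx (hno x (hbb (ball_subset_ball (by linarith) hxb)))⟩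
  have seg : ∀ x y, segment ℝ x y ⊆ ball p s → segment ℝ x y ⊆ Ω →
      ‖fderiv ℝ (rb Ω ρ φ) y - fderiv ℝ (rb Ω ρ φ) x‖ ≤ K * ‖y - x‖ := by
    intro x y h1 h2
    exact mv1 (convex_segment x y) (fun z hz => cda_fderiv_diff (h.r_cd (h2 hz))) (fun z hz => hK z (h1 hz) (h2 hz))
      (left_mem_segment ℝ x y) (right_mem_segment ℝ x y)
  refine ⟨K * (8 * C ^ 2 + 1), δ, hδ0, fun x hx hxb y hy hyb => ?_⟩
  obtain ⟨d, hd⟩ : ∃ d, d = ‖x - y‖ := ⟨_, rfl⟩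
  by_cases hd0 : d = 0
  · rw [hd] at hd0
    have : x = y := sub_eq_zero.1 (norm_eq_zero.1 hd0)
    subst this; simp
  have hdp : 0 < d := lt_of_le_of_ne (by rw [hd]; positivity) (Ne.symm hd0)
  have hd2 : d ≤ 2 * δ := by
    rw [hd, ← dist_eq_norm]
    rw [mem_ball] at hxb hyb
    linarith [dist_triangle_right x y p]
  obtain ⟨τ, hτ⟩ : ∃ τ, τ = 2 * C * d := ⟨_, rfl⟩
  have hτ0 : 0 < τ := by rw [hτ]; positivity
  have hτv : ‖τ • v‖ ≤ 4 * C ^ 2 * d := by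
    rw [norm_smul, Real.norm_eq_abs, abs_of_pos hτ0, hτ]
    calc 2 * C * d * ‖v‖ ≤ 2 * C * d * (2 * C) := by gcongr
      _ = _ := by ring
  have hτb : ‖τ • v‖ ≤ 8 * (b / 20) := by
    rw [← hδb]; nlinarith
  have hin : ∀ x ∈ ball p δ, x - τ • v ∈ ball p b := by
    intro x hx
    rw [mem_ball, dist_eq_norm] at hx ⊢
    rw [show x - τ • v - p = (x - p) - τ • v by abel]
    have := norm_sub_le (x - p) (τ • v)
    linarith
  have hδbb : ball p δ ⊆ ball p b := ball_subset_ball (by linarith)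
  -- vertical segments
  have vert : ∀ x ∈ Ω, x ∈ ball p δ → ‖fderiv ℝ (rb Ω ρ φ) (x - τ • v) - fderiv ℝ (rb Ω ρ φ) x‖ ≤ K * (4 * C ^ 2 * d) := by
    intro x hx hxb
    have hsb : segment ℝ x (x - τ • v) ⊆ ball p b := (convex_ball p b).segment_subset (hδbb hxb) (hin x hxb)
    refine (seg x (x - τ • v) (hsb.trans hbb) ?_).trans ?_
    · intro z hz
      have hzb := hsb hz
      rw [segment_eq_image'] at hz
      obtain ⟨θ, hθ, rfl⟩ := hz
      have e : x + θ • (x - τ • v - x) = x - (θ * τ) • v := by module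
      simp only [e] at hzb ⊢
      have h1 := hmono x (hδbb hxb) (θ * τ) (mul_nonneg hθ.1 hτ0.le) hzb
      have h2 : 0 ≤ θ * τ := mul_nonneg hθ.1 hτ0.le
      have h3 := (h.D p hp x (hbb (hδbb hxb))).mem.1 hx
      exact (h.D p hp _ (hbb hzb)).mem.2 (by linarith)
    · have e : x - τ • v - x = - (τ • v) := by abel
      rw [e, norm_neg]
      gcongr
  have v1 := vert x hx hxb
  have v2 := vert y hy hyb
  have hor : ‖fderiv ℝ (rb Ω ρ φ) (y - τ • v) - fderiv ℝ (rb Ω ρ φ) (x - τ • v)‖ ≤ K * d := by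
    have hsb : segment ℝ (x - τ • v) (y - τ • v) ⊆ ball p b := (convex_ball p b).segment_subset (hin x hxb) (hin y hyb)
    refine (seg _ _ (hsb.trans hbb) ?_).trans ?_
    · intro z hz
      have hzb := hsb hz
      have h1 : ‖z - (x - τ • v)‖ ≤ d := by
        rw [segment_eq_image'] at hz
        obtain ⟨θ, hθ, rfl⟩ := hz
        have e : x - τ • v + θ • (y - τ • v - (x - τ • v)) - (x - τ • v) = θ • (y - x) := by module
        simp only [e]
        rw [norm_smul, Real.norm_eq_abs, abs_of_nonneg hθ.1, norm_sub_rev, ← hd]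
        exact mul_le_of_le_one_left hdp.le hθ.2
      have h2 := hmono x (hδbb hxb) τ hτ0.le (hin x hxb)
      have h3 := (h.D p hp x (hbb (hδbb hxb))).mem.1 hx
      have h4 := (abs_le.1 (h.psi_lip hp (hbb (hin x hxb)) (hbb hzb))).2
      have h5 : C * ‖z - (x - τ • v)‖ ≤ C * d := by gcongr
      refine (h.D p hp _ (hbb hzb)).mem.2 ?_
      rw [hτ] at h2 h4 h5
      linarith
    · have e : y - τ • v - (x - τ • v) = - (x - y) := by abel
      rw [e, norm_neg, ← hd]
  rw [← hd]
  have e : fderiv ℝ (rb Ω ρ φ) x - fderiv ℝ (rb Ω ρ φ) y = (fderiv ℝ (rb Ω ρ φ) (y - τ • v) - fderiv ℝ (rb Ω ρ φ) y)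
      - (fderiv ℝ (rb Ω ρ φ) (y - τ • v) - fderiv ℝ (rb Ω ρ φ) (x - τ • v))
      - (fderiv ℝ (rb Ω ρ φ) (x - τ • v) - fderiv ℝ (rb Ω ρ φ) x) := by abel
  rw [e]
  refine (norm_sub_le _ _).trans ((add_le_add ((norm_sub_le _ _).trans (add_le_add v2 hor)) v1).trans (le_of_eq ?_))
  ring

lemma Sys6.lipgrad (h : Sys6 Ω ψ Ω₂ ρ φ C s) :
    ∃ K, ∀ x ∈ Ω, ∀ y ∈ Ω, ‖fderiv ℝ (rb Ω ρ φ) x - fderiv ℝ (rb Ω ρ φ) y‖ ≤ K * ‖x - y‖ := by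
  have hC := h.C0
  have hC1 := h.hC
  have hs0 := h.s0
  refine glob_lip h.cpt fun p hp => ?_
  by_cases hpΩ : p ∈ Ω
  · have hc : ContDiffAt ℝ 1 (fderiv ℝ (rb Ω ρ φ)) p := (h.r_cd hpΩ).fderiv_right (by norm_num)
    obtain ⟨K, δ, _, hδ, hK⟩ := loc_lip hc
    exact ⟨K, δ, hδ, fun x _ hx y _ hy => hK y hy x hx⟩
  · have hpf : p ∈ frontier Ω := by rw [h.op.frontier_eq]; exact ⟨hp, hpΩ⟩
    have hs' : s / (2 * C ^ 2) ≤ s := by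
      rw [div_le_iff₀ (by positivity)]
      have : 1 ≤ C ^ 2 := one_le_pow₀ hC1
      nlinarith
    have h' : Sys Ω ψ Ω₂ ρ φ C (s / (2 * C ^ 2)) := h.toSys.mono le_rfl hs' (by positivity)
    exact h'.bdry_lip hpf fun z hz hzΩ => h.d2 hpf hz hzΩ

end TSec


section USec
open scoped ContDiff

variable {n : ℕ}

lemma defn_cd {Ω U : Set (EuclideanSpace ℂ (Fin n))} {ρ : EuclideanSpace ℂ (Fin n) → ℝ} (h : IsDefiningFn n ⊤ Ω U ρ)
    {z : EuclideanSpace ℂ (Fin n)} (hz : z ∈ U) : ContDiffAt ℝ ∞ ρ z := h.2.2.1.contDiffAt (h.1.mem_nhds hz)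

lemma defn_loc {Ω U : Set (EuclideanSpace ℂ (Fin n))} {ρ : EuclideanSpace ℂ (Fin n) → ℝ} (h : IsDefiningFn n ⊤ Ω U ρ)
    (hop : IsOpen Ω) (hb : Bornology.IsBounded Ω) : LocDef Ω ρ where
  op := hop
  cpt := by
    have := FiniteDimensional.proper ℂ (EuclideanSpace ℂ (Fin n))
    exact hb.isCompact_closure
  cd := fun p hp => by
    filter_upwards [h.1.mem_nhds (h.2.1 (frontier_subset_closure hp))] with x hx using defn_cd h hx
  mem := fun p hp => by
    filter_upwards [h.1.mem_nhds (h.2.1 (frontier_subset_closure hp))] with x hx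
    have : x ∈ Ω ↔ x ∈ {z ∈ U | ρ z < 0} := by rw [← h.2.2.2.1]
    exact this.trans ⟨fun h => h.2, fun h => ⟨hx, h⟩⟩
  zero := fun p hp => by
    have hpc := frontier_subset_closure hp
    have hpU := h.2.1 hpc
    have hc : ContinuousAt ρ p := (defn_cd h hpU).continuousAt
    apply le_antisymm
    · have hnb := mem_closure_iff_nhdsWithin_neBot.1 hpc
      refine le_of_tendsto (hc.tendsto.mono_left (nhdsWithin_le_nhds (s := Ω))) ?_
      filter_upwards [self_mem_nhdsWithin] with x hx
      rw [h.2.2.2.1] at hx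
      exact hx.2.le
    · by_contra hcon
      push Not at hcon
      rw [hop.frontier_eq] at hp
      refine hp.2 ?_
      rw [h.2.2.2.1]
      exact ⟨hpU, hcon⟩
  grad := h.2.2.2.2

lemma levi_of {Ω U : Set (EuclideanSpace ℂ (Fin n))} {ρ : EuclideanSpace ℂ (Fin n) → ℝ} (h : IsDefiningFn n ⊤ Ω U ρ)
    (hl : ∀ z ∈ frontier Ω, ∀ w : Fin n → ℂ, w ≠ 0 → cGradPair n ρ z w = 0 → 0 < (cHessForm n ρ z w).re) :
    ∀ p ∈ frontier Ω, ∀ ξ : EuclideanSpace ℂ (Fin n), ξ ≠ 0 → fderiv ℝ ρ p ξ = 0 → fderiv ℝ ρ p (I • ξ) = 0 → 0 < Lv ρ p ξ := by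
  intro p hp ξ hξ h1 h2
  have hcd := defn_cd h (h.2.1 (frontier_subset_closure hp))
  have hw : (fun i => ξ i) ≠ (0 : Fin n → ℂ) := fun h0 => hξ (by
    ext i
    exact congrFun h0 i)
  have := hl p hp (fun i => ξ i) hw (cGradPair_eq (hcd.differentiableAt (by simp)) ξ h1 h2)
  have h3 := cHessForm_re (hcd.of_le (WithTop.coe_le_coe.2 le_top)) ξ
  linarith

end USec

theorem pullback_in_C11 (n : ℕ)
    (Ω₁ Ω₂ : Set (EuclideanSpace ℂ (Fin n)))
    (hΩ₁ : IsStrictlyPseudoconvexDomain n ⊤ Ω₁)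
    (hΩ₂ : IsStrictlyPseudoconvexDomain n ⊤ Ω₂)
    (φ : EuclideanSpace ℂ (Fin n) → EuclideanSpace ℂ (Fin n))
    (hφ : DifferentiableOn ℂ φ Ω₁)
    (hproper : IsProperMapOn n φ Ω₁ Ω₂)
    (U : Set (EuclideanSpace ℂ (Fin n))) (ρ : EuclideanSpace ℂ (Fin n) → ℝ)
    (hρdef : IsDefiningFn n ⊤ Ω₂ U ρ)
    (hρpsh : ∀ w ∈ Ω₂, ∀ ξ : Fin n → ℂ, 0 ≤ (cHessForm n ρ w ξ).re)
    (C₀ : ℝ)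
    (hρdet : ∀ w ∈ Ω₂,
      ‖(cHess n ρ w).det‖ ≤ C₀ * Metric.infDist w (frontier Ω₂) ^ (4 * n)) :
    ContDiffOn ℝ 1 (fun z => ρ (φ z)) Ω₁ ∧
    (∃ C : ℝ, ∀ z ∈ Ω₁, ∀ w ∈ Ω₁,
      ‖fderiv ℝ (fun v => ρ (φ v)) z - fderiv ℝ (fun v => ρ (φ v)) w‖ ≤ C * ‖z - w‖) ∧
    ∃ R : EuclideanSpace ℂ (Fin n) → ℝ,
      ContinuousOn R (closure Ω₁) ∧ (∀ z ∈ Ω₁, R z = ρ (φ z)) ∧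
      ∀ z ∈ frontier Ω₁, R z = 0 := by
  rcases Nat.eq_zero_or_pos n with hn | hn
  · subst hn
    have hcst : (fun z => ρ (φ z)) = fun _ => ρ (φ 0) := by
      funext z; rw [Subsingleton.elim z 0]
    refine ⟨by rw [hcst]; exact contDiffOn_const, ⟨0, fun z _ w _ => ?_⟩, fun z => ρ (φ z), ?_, fun _ _ => rfl, ?_⟩
    · rw [Subsingleton.elim z w]; simp
    · rw [hcst]; exact continuousOn_const
    · intro z hz
      rw [hΩ₁.1.frontier_eq] at hz
      obtain ⟨y, hy⟩ := closure_nonempty_iff.1 ⟨z, hz.1⟩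
      exact absurd (Subsingleton.elim y z ▸ hy) hz.2
  obtain ⟨hop1, hb1, U1, ψ0, hdef1, hlev1⟩ := hΩ₁
  obtain ⟨hop2, hb2, U2, ψ2, hdef2, hlev2⟩ := hΩ₂
  have L1 := defn_loc hdef1 hop1 hb1
  have L2 := defn_loc hdef2 hop2 hb2
  have L := defn_loc hρdef hop2 hb2
  obtain ⟨ψ, hψ, hψs⟩ := L1.strict (levi_of hdef1 hlev1)
  have hneg : ∀ w ∈ Ω₂, ρ w < 0 := fun w hw => by
    rw [hρdef.2.2.2.1] at hw
    exact hw.2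
  have hU : ∀ w ∈ Ω₂, w ∈ U := fun w hw => hρdef.2.1 (subset_closure hw)
  have hcd2 := fun w hw => defn_cd hρdef (hU w hw)
  have hcd2' : ∀ w ∈ Ω₂, ContDiffAt ℝ 2 ρ w := fun w hw => (hcd2 w hw).of_le (WithTop.coe_le_coe.2 le_top)
  have hpsh : ∀ w ∈ Ω₂, ∀ ξ, 0 ≤ Lv ρ w ξ := by
    intro w hw ξ
    have h1 := hρpsh w hw (fun i => ξ i)
    have h2 := cHessForm_re (hcd2' w hw) ξ
    linarith
  have hlev : ∀ p ∈ frontier Ω₂, ∀ ξ : EuclideanSpace ℂ (Fin n), ξ ≠ 0 → fderiv ℝ ρ p ξ = 0 → fderiv ℝ ρ p (I • ξ) = 0 → 0 < Lv ρ p ξ := by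
    intro p hp
    have hpc := frontier_subset_closure hp
    refine levi_transfer (defn_cd hρdef (hρdef.2.1 hpc)) (defn_cd hdef2 (hdef2.2.1 hpc)) (L.zero p hp) (L2.zero p hp)
      (L.grad p hp) (L2.grad p hp) ?_ (levi_of hdef2 hlev2 p hp)
    filter_upwards [L.mem p hp, L2.mem p hp] with x hx1 hx2
    rw [← hx1, hx2]
  have heig : ∀ p ∈ frontier Ω₂, ∃ C, ∀ᶠ w in nhds p, w ∈ Ω₂ → ∃ e, ‖e‖ = 1 ∧ Lv ρ w e ≤ C * (- ρ w) ^ 4 ∧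
      ∀ η, |Bv ρ w e η| ≤ Lv ρ w e * ‖η‖ := by
    intro p hp
    obtain ⟨K, hK⟩ := L.near hp
    refine ⟨4 * (max C₀ 1 * |K| ^ 4), ?_⟩
    filter_upwards [hK] with w hw hwΩ
    obtain ⟨q, hq, hwq⟩ := hw
    have hr := hneg w hwΩ
    have h0 : 0 ≤ infDist w (frontier Ω₂) := infDist_nonneg
    have h1 : infDist w (frontier Ω₂) ≤ |K| * (- ρ w) := by
      refine (infDist_le_dist_of_mem hq).trans ?_
      rw [dist_eq_norm]
      rw [abs_of_neg hr] at hwq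
      exact hwq.trans (mul_le_mul_of_nonneg_right (le_abs_self K) (by linarith))
    have hm : 1 ≤ max C₀ 1 := le_max_right _ _
    have hm0 : 0 ≤ max C₀ 1 := by linarith
    obtain ⟨e, he1, he2, he3⟩ := eigen_lemma hn (hcd2' w hwΩ) (hpsh w hwΩ) (d := max C₀ 1 * (|K| * (- ρ w)) ^ 4)
      (mul_nonneg hm0 (pow_nonneg (h0.trans h1) 4)) (by
        refine (hρdet w hwΩ).trans ?_
        rw [mul_pow, ← pow_mul]
        have h2 : C₀ ≤ (max C₀ 1) ^ n := (le_max_left _ _).trans (le_self_pow₀ hm hn.ne')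
        have h3 : infDist w (frontier Ω₂) ^ (4 * n) ≤ (|K| * (- ρ w)) ^ (4 * n) := pow_le_pow_left₀ h0 h1 _
        exact mul_le_mul h2 h3 (pow_nonneg h0 _) (pow_nonneg hm0 _))
    exact ⟨e, he1, he2.trans (le_of_eq (by ring)), he3⟩
  obtain ⟨C1, s1, S1⟩ := Sys.exists hψ hψs L hneg hcd2 hpsh hlev heig hφ hproper.1 hproper.2
  obtain ⟨C2, s2, S2⟩ := S1.exists2
  obtain ⟨C3, s3, S3⟩ := S2.exists3
  obtain ⟨C4, s4, S4⟩ := S3.exists4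
  obtain ⟨C5, s5, S5⟩ := S4.exists5
  obtain ⟨C6, s6, S6⟩ := S5.exists6
  obtain ⟨K, hK⟩ := S6.lipgrad
  refine ⟨?_, ⟨K, fun z hz w hw => ?_⟩, rb Ω₁ ρ φ, S6.cont.continuousOn, fun z hz => rb_in hz, fun z hz => rb_out (S6.notMem hz)⟩
  · intro z hz
    have h1 : ContDiffAt ℝ 2 (fun x => ρ (φ x)) z := ContDiffAt.comp z (S6.rho_cd hz) (S6.phi_cd hz)
    exact (h1.of_le (by norm_num)).contDiffWithinAt
  · have := hK z hz w hw
    rwa [(S6.rb_ev hz).fderiv_eq, (S6.rb_ev hw).fderiv_eq] at this
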